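/- Let σ : ℝⁿ → ℝ^{n×n} be C², symmetric, and uniformly elliptic, let σ̃ be the (n+1)×(n+1) block matrix diag(σ, 1), and let s ∈ (0,1). If u₁ ∈ C²(ℝ^{n+1} × (0,∞)) is a classical solution of y^{2s-1} ∂_t u₁ - ∇_{x,y}·( y^{2s-1} σ̃ ∇_{x,y} u₁ ) = 0 in ℝ^{n+1} × (0,∞), then u₂(t,x,y) := - y^{2s-1} ∂_y u₁(t,x,y) is a classical solution of the conjugate equation y^{1-2s} ∂_t u₂ - ∇_{x,y}·( y^{1-2s} σ̃ ∇_{x,y} u₂ ) = 0 in ℝ^{n+1} × (0,∞). -/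

import Mathlib

open MeasureTheory Set

/-- Time partial derivative `∂_t u(t,x,y)`. -/
noncomputable def dtP (n : ℕ) (u : ℝ → EuclideanSpace ℝ (Fin n) → ℝ → ℝ)
    (t : ℝ) (x : EuclideanSpace ℝ (Fin n)) (y : ℝ) : ℝ :=
  deriv (fun τ => u τ x y) t

/-- Spatial partial derivative `∂_{x_i} u(t,x,y)`. -/
noncomputable def dxP (n : ℕ) (u : ℝ → EuclideanSpace ℝ (Fin n) → ℝ → ℝ) (i : Fin n)
    (t : ℝ) (x : EuclideanSpace ℝ (Fin n)) (y : ℝ) : ℝ :=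
  deriv (fun a : ℝ => u t (x + a • EuclideanSpace.single i (1 : ℝ)) y) 0

/-- The weighted divergence-form operator
`∇_{x,y}·(y^r σ̃ ∇_{x,y} u) = ∑_i ∂_{x_i}(y^r ∑_j σ_{ij} ∂_{x_j} u) + ∂_y(y^r ∂_y u)`,
for `σ̃ = diag(σ(x),1)`. -/
noncomputable def divFormP (n : ℕ) (σ : EuclideanSpace ℝ (Fin n) → Fin n → Fin n → ℝ) (r : ℝ)
    (u : ℝ → EuclideanSpace ℝ (Fin n) → ℝ → ℝ)
    (t : ℝ) (x : EuclideanSpace ℝ (Fin n)) (y : ℝ) : ℝ :=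
  (∑ i, dxP n (fun t' x' y' => y' ^ r * ∑ j, σ x' i j * dxP n u j t' x' y') i t x y)
    + deriv (fun b : ℝ => b ^ r * deriv (fun c => u t x c) b) y

set_option linter.unusedSectionVars false

section Gaussian

variable {Z : Type*} [NormedAddCommGroup Z] [InnerProductSpace ℝ Z] [FiniteDimensional ℝ Z]
  [MeasurableSpace Z] [BorelSpace Z]

theorem one_add_pow_four_mul_exp_le (r : ℝ) (hr : 0 ≤ r) :
    (1 + r) ^ 4 * Real.exp (-r ^ 2 / 4) ≤ 9 ^ 4 * Real.exp (-(1 / 8) * r ^ 2) := by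
  have h1 : 1 + r ≤ 9 * Real.exp (r ^ 2 / 32) := by
    have := Real.add_one_le_exp (r ^ 2 / 32)
    nlinarith [sq_nonneg (r - 16), sq_nonneg r]
  have h2 : (1 + r) ^ 4 ≤ (9 * Real.exp (r ^ 2 / 32)) ^ 4 := by gcongr
  calc (1 + r) ^ 4 * Real.exp (-r ^ 2 / 4)
      ≤ (9 * Real.exp (r ^ 2 / 32)) ^ 4 * Real.exp (-r ^ 2 / 4) := by gcongr
    _ = 9 ^ 4 * Real.exp (-(1 / 8) * r ^ 2) := by
      rw [mul_pow, ← Real.exp_nat_mul, mul_assoc, ← Real.exp_add]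
      congr 2; push_cast; ring

/-- The Gaussian weight `exp (-‖z‖² / 4)`. -/
noncomputable def gaussWeight (z : Z) : ℝ := Real.exp (-‖z‖ ^ 2 / 4)

theorem gaussWeight_pos (z : Z) : 0 < gaussWeight z := Real.exp_pos _

theorem continuous_gaussWeight : Continuous (gaussWeight : Z → ℝ) := by
  unfold gaussWeight; fun_prop

/-- `f` is continuous and grows at most like `(1 + ‖z‖) ^ m`. -/
def PolyGrowth (m : ℕ) (f : Z → ℝ) : Prop :=
  Continuous f ∧ ∃ C, 0 ≤ C ∧ ∀ z, |f z| ≤ C * (1 + ‖z‖) ^ m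

theorem PolyGrowth.of_bounded {f : Z → ℝ} (hf : Continuous f) {C : ℝ} (hC : ∀ z, |f z| ≤ C) :
    PolyGrowth 0 f :=
  ⟨hf, C, (abs_nonneg _).trans (hC 0), by simpa using hC⟩

theorem PolyGrowth.const (a : ℝ) : PolyGrowth 0 (fun _ : Z => a) :=
  .of_bounded continuous_const (C := |a|) fun _ => le_rfl

theorem PolyGrowth.inner_left (c : Z) : PolyGrowth 1 (fun z : Z => inner ℝ z c) := by
  refine ⟨by fun_prop, ‖c‖, norm_nonneg _, fun z => ?_⟩
  nlinarith [abs_real_inner_le_norm z c, norm_nonneg c]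

theorem PolyGrowth.mul {m k : ℕ} {f g : Z → ℝ} (hf : PolyGrowth m f) (hg : PolyGrowth k g) :
    PolyGrowth (m + k) (fun z => f z * g z) := by
  obtain ⟨hf, C, hC, h⟩ := hf
  obtain ⟨hg, D, hD, h'⟩ := hg
  refine ⟨hf.mul hg, C * D, by positivity, fun z => ?_⟩
  rw [abs_mul, pow_add]
  calc |f z| * |g z| ≤ (C * (1 + ‖z‖) ^ m) * (D * (1 + ‖z‖) ^ k) := by
        gcongr; exacts [h z, h' z]
    _ = _ := by ring

theorem PolyGrowth.mono {m k : ℕ} {f : Z → ℝ} (hf : PolyGrowth m f) (hmk : m ≤ k) :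
    PolyGrowth k f := by
  obtain ⟨hf, C, hC, h⟩ := hf
  refine ⟨hf, C, hC, fun z => (h z).trans ?_⟩
  gcongr
  linarith [norm_nonneg z]

theorem PolyGrowth.add {m : ℕ} {f g : Z → ℝ} (hf : PolyGrowth m f) (hg : PolyGrowth m g) :
    PolyGrowth m (fun z => f z + g z) := by
  obtain ⟨hf, C, hC, h⟩ := hf
  obtain ⟨hg, D, hD, h'⟩ := hg
  refine ⟨hf.add hg, C + D, by positivity, fun z => ?_⟩
  calc |f z + g z| ≤ |f z| + |g z| := abs_add_le _ _
    _ ≤ _ := by linarith [h z, h' z]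

theorem PolyGrowth.sum {m : ℕ} {ι : Type*} {s : Finset ι} {f : ι → Z → ℝ}
    (hf : ∀ i ∈ s, PolyGrowth m (f i)) : PolyGrowth m (fun z => ∑ i ∈ s, f i z) := by
  classical
  induction s using Finset.induction_on with
  | empty => simpa using (PolyGrowth.const (Z := Z) 0).mono (Nat.zero_le m)
  | insert a s ha ih =>
    simp_rw [Finset.sum_insert ha]
    exact (hf a (by simp)).add (ih fun i hi => hf i (by simp [hi]))

theorem PolyGrowth.integrable {g : Z → ℝ} (hg : PolyGrowth 4 g) :
    Integrable (fun z => gaussWeight z * g z) := by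
  obtain ⟨hg, C, hC0, hC⟩ := hg
  have h0 : Integrable (fun z : Z => Real.exp (-(1 / 8) * ‖z‖ ^ 2)) := by
    have := (GaussianFourier.integrable_cexp_neg_mul_sq_norm_add (V := Z) (b := (1 / 8 : ℂ))
      (by norm_num) 0 0).norm
    refine this.congr (Filter.Eventually.of_forall fun z => ?_)
    simp only [Complex.norm_exp]
    congr 1
    simp [← Complex.ofReal_pow]
  refine (h0.const_mul (C * 9 ^ 4)).mono'
    ((continuous_gaussWeight.mul hg).aestronglyMeasurable) (Filter.Eventually.of_forall fun z => ?_)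
  rw [norm_mul, Real.norm_of_nonneg (gaussWeight_pos z).le, Real.norm_eq_abs]
  calc gaussWeight z * |g z| ≤ gaussWeight z * (C * (1 + ‖z‖) ^ 4) := by
        gcongr; exacts [(gaussWeight_pos z).le, hC z]
    _ = C * ((1 + ‖z‖) ^ 4 * Real.exp (-‖z‖ ^ 2 / 4)) := by unfold gaussWeight; ring
    _ ≤ C * (9 ^ 4 * Real.exp (-(1 / 8) * ‖z‖ ^ 2)) := by
        gcongr C * ?_; exact one_add_pow_four_mul_exp_le _ (norm_nonneg z)
    _ = _ := by ring

theorem hasFDerivAt_gaussWeight (z : Z) :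
    HasFDerivAt gaussWeight (-(gaussWeight z / 2) • innerSL ℝ z) z := by
  have h := (((hasStrictFDerivAt_norm_sq z).hasFDerivAt.neg).mul_const (1 / 4 : ℝ)).exp
  unfold gaussWeight
  convert h using 1
  · ext x; simp; ring_nf
  · ext v; simp; ring_nf

/-- Gaussian integration by parts. -/
theorem integral_gaussWeight_mul_fderiv {g : Z → ℝ} (hgd : Differentiable ℝ g) {v : Z}
    (hg : PolyGrowth 3 g) (hg' : PolyGrowth 4 (fun z => fderiv ℝ g z v)) :
    ∫ z, gaussWeight z * fderiv ℝ g z v = ∫ z, gaussWeight z * (inner ℝ z v / 2 * g z) := by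
  have i2 : Integrable (fun z => gaussWeight z * (inner ℝ z v / 2 * g z)) := by
    have h := ((PolyGrowth.const (1 / 2)).mul ((PolyGrowth.inner_left v).mul hg)).integrable
    convert h using 3
    ring
  have e : ∀ z, fderiv ℝ gaussWeight z v * g z = -(gaussWeight z * (inner ℝ z v / 2 * g z)) := by
    intro z
    rw [(hasFDerivAt_gaussWeight z).fderiv]
    simp; ring
  rw [integral_mul_fderiv_eq_neg_fderiv_mul_of_integrable (f := gaussWeight) (g := g) (v := v)
    _ hg'.integrable (hg.mono (by norm_num)).integrable
    (fun z _ => (hasFDerivAt_gaussWeight z).differentiableAt) fun z _ => hgd z]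
  · simp_rw [e, integral_neg, neg_neg]
  · simp_rw [e]; exact i2.neg

/-- The second Hermite polynomial in direction `c`, adapted to `gaussWeight`. -/
noncomputable def hermiteTwo (c z : Z) : ℝ := (inner ℝ z c) ^ 2 / 4 - ‖c‖ ^ 2 / 2

theorem polyGrowth_hermiteTwo (c : Z) : PolyGrowth 2 (hermiteTwo c) := by
  have h := ((PolyGrowth.const (1 / 4)).mul
    ((PolyGrowth.inner_left c).mul (PolyGrowth.inner_left c))).add
    ((PolyGrowth.const (-(‖c‖ ^ 2 / 2))).mono (Nat.zero_le 2))
  convert h using 2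
  unfold hermiteTwo
  ring

theorem abs_hermiteTwo_le (c z : Z) : |hermiteTwo c z| ≤ ‖c‖ ^ 2 * (1 + ‖z‖) ^ 2 := by
  unfold hermiteTwo
  have h := abs_real_inner_le_norm z c
  have h2 : (inner ℝ z c) ^ 2 ≤ (‖z‖ * ‖c‖) ^ 2 := by
    rw [← sq_abs]; gcongr
  have := norm_nonneg z
  rw [abs_le]
  constructor <;> nlinarith [sq_nonneg ‖c‖, sq_nonneg (inner ℝ z c), mul_nonneg (sq_nonneg ‖c‖) this,
    mul_nonneg (sq_nonneg ‖c‖) (sq_nonneg ‖z‖)]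

theorem hasFDerivAt_hermiteTwo (c z : Z) :
    HasFDerivAt (hermiteTwo c) ((inner ℝ z c / 2) • innerSL ℝ c) z := by
  have h0 : HasFDerivAt (fun z : Z => inner ℝ z c) (innerSL ℝ c) z := by
    have := (innerSL ℝ c).hasFDerivAt (x := z)
    convert this using 2
    rw [real_inner_comm]; rfl
  have h := ((h0.pow 2).mul_const (1 / 4 : ℝ)).sub_const (‖c‖ ^ 2 / 2)
  have e : hermiteTwo c = fun x => inner ℝ x c ^ 2 * (1 / 4) - ‖c‖ ^ 2 / 2 := by
    ext x; unfold hermiteTwo; ring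
  rw [e]
  refine h.congr_fderiv ?_
  ext v; simp; ring

section Identities

variable {G : Z → ℝ} (hG : ContDiff ℝ 2 G) {C : ℝ} (h0 : ∀ z, |G z| ≤ C)
  (h1 : ∀ z, ‖fderiv ℝ G z‖ ≤ C) (h2 : ∀ z, ‖fderiv ℝ (fderiv ℝ G) z‖ ≤ C)

include hG h1 in
theorem polyGrowth_fderiv (v : Z) : PolyGrowth 0 (fun z => fderiv ℝ G z v) :=
  .of_bounded ((hG.continuous_fderiv (by norm_num)).clm_apply continuous_const) (C := C * ‖v‖)
    fun z => ((fderiv ℝ G z).le_opNorm v).trans (by gcongr; exact h1 z)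

include hG h2 in
theorem polyGrowth_fderiv_fderiv (v v' : Z) :
    PolyGrowth 0 (fun z => fderiv ℝ (fderiv ℝ G) z v v') := by
  have hc : Continuous (fderiv ℝ (fderiv ℝ G)) :=
    (hG.fderiv_right (m := 1) (by norm_num)).continuous_fderiv (by norm_num)
  refine .of_bounded ((hc.clm_apply continuous_const).clm_apply continuous_const)
    (C := C * ‖v‖ * ‖v'‖) fun z => ?_
  refine ((fderiv ℝ (fderiv ℝ G) z).le_opNorm₂ v v').trans (by gcongr; exact h2 z)

include hG h0 h1 in
theorem integral_gauss_inner_mul_fderiv (c : Z) :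
    ∫ z, gaussWeight z * (inner ℝ z c / 2 * fderiv ℝ G z c)
      = ∫ z, gaussWeight z * (hermiteTwo c z * G z) := by
  have hd : Differentiable ℝ G := hG.differentiable (by norm_num)
  have p0 : PolyGrowth 0 G := .of_bounded hG.continuous h0
  have pin : PolyGrowth 1 (fun z : Z => inner ℝ z c / 2) := by
    convert (PolyGrowth.const (1 / 2)).mul (PolyGrowth.inner_left c) using 2; ring
  have p1 := polyGrowth_fderiv hG h1 c
  have hin : ∀ z, HasFDerivAt (fun z : Z => inner ℝ z c / 2) ((1 / 2 : ℝ) • innerSL ℝ c) z := by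
    intro z
    have := ((1 / 2 : ℝ) • innerSL ℝ c).hasFDerivAt (x := z)
    convert this using 2
    simp [real_inner_comm c]; ring
  have hg : ∀ z, HasFDerivAt (fun z => inner ℝ z c / 2 * G z) _ z :=
    fun z => (hin z).mul (hd z).hasFDerivAt
  have e : ∀ z, fderiv ℝ (fun z => inner ℝ z c / 2 * G z) z c
      = inner ℝ z c / 2 * fderiv ℝ G z c + ‖c‖ ^ 2 / 2 * G z := by
    intro z
    rw [(hg z).fderiv]
    simp; ring
  have pA : PolyGrowth 4 (fun z => inner ℝ z c / 2 * fderiv ℝ G z c) :=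
    (pin.mul p1).mono (by norm_num)
  have pB : PolyGrowth 4 (fun z => ‖c‖ ^ 2 / 2 * G z) :=
    ((PolyGrowth.const _).mul p0).mono (by norm_num)
  have key := integral_gaussWeight_mul_fderiv (v := c) (fun z => (hg z).differentiableAt)
    ((pin.mul p0).mono (by norm_num)) (by simp_rw [e]; exact pA.add pB)
  simp_rw [e, mul_add] at key
  rw [integral_add pA.integrable pB.integrable] at key
  have pC : PolyGrowth 4 (fun z => inner ℝ z c / 2 * (inner ℝ z c / 2 * G z)) :=
    (pin.mul (pin.mul p0)).mono (by norm_num)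
  rw [eq_sub_of_add_eq key, ← integral_sub pC.integrable pB.integrable]
  congr 1; ext z
  unfold hermiteTwo; ring

include hG h0 h1 h2 in
theorem integral_gauss_fderiv_fderiv (c : Z) :
    ∫ z, gaussWeight z * fderiv ℝ (fderiv ℝ G) z c c
      = ∫ z, gaussWeight z * (hermiteTwo c z * G z) := by
  rw [← integral_gauss_inner_mul_fderiv hG h0 h1 c]
  have hd : Differentiable ℝ (fderiv ℝ G) :=
    (hG.fderiv_right (m := 1) (by norm_num)).differentiable (by norm_num)
  have hg : ∀ z, HasFDerivAt (fun z => fderiv ℝ G z c) ((fderiv ℝ (fderiv ℝ G) z).flip c) z := by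
    intro z
    refine ((hd z).hasFDerivAt.clm_apply (hasFDerivAt_const c z)).congr_fderiv ?_
    ext v; simp
  have e : ∀ z, fderiv ℝ (fun z => fderiv ℝ G z c) z c = fderiv ℝ (fderiv ℝ G) z c c := by
    intro z; rw [(hg z).fderiv]; rfl
  have key := integral_gaussWeight_mul_fderiv (v := c) (fun z => (hg z).differentiableAt)
    ((polyGrowth_fderiv hG h1 c).mono (by norm_num))
    (by simp_rw [e]; exact (polyGrowth_fderiv_fderiv hG h2 c c).mono (by norm_num))
  simpa only [e] using key

include hG h0 h1 h2 in
theorem integral_gauss_hermiteTwo_euler {ι : Type*} [Fintype ι] (e : OrthonormalBasis ι ℝ Z)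
    (c : Z) :
    ∫ z, gaussWeight z * (hermiteTwo c z * fderiv ℝ G z z)
      = 2 * (∫ z, gaussWeight z * (hermiteTwo c z * G z))
        + 2 * ∫ z, gaussWeight z * (hermiteTwo c z * ∑ k, fderiv ℝ (fderiv ℝ G) z (e k) (e k)) := by
  have hd : Differentiable ℝ (fderiv ℝ G) :=
    (hG.fderiv_right (m := 1) (by norm_num)).differentiable (by norm_num)
  have hg : ∀ k z, HasFDerivAt (fun z => hermiteTwo c z * fderiv ℝ G z (e k))
      (hermiteTwo c z • (fderiv ℝ (fderiv ℝ G) z).flip (e k)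
        + fderiv ℝ G z (e k) • ((inner ℝ z c / 2) • innerSL ℝ c)) z := by
    intro k z
    refine ((hasFDerivAt_hermiteTwo c z).mul
      ((hd z).hasFDerivAt.clm_apply (hasFDerivAt_const (e k) z))).congr_fderiv ?_
    ext v; simp
  have pA : ∀ k, PolyGrowth 4 (fun z => hermiteTwo c z * fderiv ℝ (fderiv ℝ G) z (e k) (e k)) :=
    fun k => ((polyGrowth_hermiteTwo c).mul
      (polyGrowth_fderiv_fderiv hG h2 (e k) (e k))).mono (by norm_num)
  have pin : PolyGrowth 1 (fun z : Z => inner ℝ z c / 2) := by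
    convert (PolyGrowth.const (1 / 2)).mul (PolyGrowth.inner_left c) using 2; ring
  have pB : ∀ k, PolyGrowth 4 (fun z => inner ℝ c (e k) * (inner ℝ z c / 2 * fderiv ℝ G z (e k))) :=
    fun k => ((PolyGrowth.const _).mul (pin.mul (polyGrowth_fderiv hG h1 (e k)))).mono (by norm_num)
  have pC : ∀ k, PolyGrowth 4 (fun z => inner ℝ z (e k) / 2 *
      (hermiteTwo c z * fderiv ℝ G z (e k))) := by
    intro k
    have : PolyGrowth 1 (fun z : Z => inner ℝ z (e k) / 2) := by
      convert (PolyGrowth.const (1 / 2)).mul (PolyGrowth.inner_left (e k)) using 2; ring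
    exact (this.mul ((polyGrowth_hermiteTwo c).mul (polyGrowth_fderiv hG h1 (e k)))).mono
      (by norm_num)
  have ed : ∀ k z, fderiv ℝ (fun z => hermiteTwo c z * fderiv ℝ G z (e k)) z (e k)
      = hermiteTwo c z * fderiv ℝ (fderiv ℝ G) z (e k) (e k)
        + inner ℝ c (e k) * (inner ℝ z c / 2 * fderiv ℝ G z (e k)) := by
    intro k z
    rw [(hg k z).fderiv]
    simp; ring
  have key : ∀ k, _ := fun k => integral_gaussWeight_mul_fderiv (v := e k)
    (fun z => (hg k z).differentiableAt)
    (((polyGrowth_hermiteTwo c).mul (polyGrowth_fderiv hG h1 (e k))).mono (by norm_num))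
    (by simp_rw [ed]; exact (pA k).add (pB k))
  have hsum := Finset.sum_congr (rfl : (Finset.univ : Finset ι) = _) fun k _ => key k
  simp_rw [ed, mul_add] at hsum
  rw [Finset.sum_congr rfl fun k _ => integral_add (pA k).integrable (pB k).integrable,
    Finset.sum_add_distrib, ← integral_finsetSum _ fun k _ => (pA k).integrable,
    ← integral_finsetSum _ fun k _ => (pB k).integrable,
    ← integral_finsetSum _ fun k _ => (pC k).integrable] at hsum
  have e1 : ∀ z, ∑ k, gaussWeight z * (hermiteTwo c z * fderiv ℝ (fderiv ℝ G) z (e k) (e k))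
      = gaussWeight z * (hermiteTwo c z * ∑ k, fderiv ℝ (fderiv ℝ G) z (e k) (e k)) := by
    intro z; simp_rw [Finset.mul_sum]
  have e2 : ∀ z, ∑ k, gaussWeight z * (inner ℝ c (e k) * (inner ℝ z c / 2 * fderiv ℝ G z (e k)))
      = gaussWeight z * (inner ℝ z c / 2 * fderiv ℝ G z c) := by
    intro z
    have : fderiv ℝ G z c = ∑ k, inner ℝ (e k) c * fderiv ℝ G z (e k) := by
      conv_lhs => rw [← e.sum_repr' c, map_sum]
      simp
    rw [this]
    simp_rw [Finset.mul_sum]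
    exact Finset.sum_congr rfl fun k _ => by rw [real_inner_comm (e k) c]; ring
  have e3 : ∀ z, ∑ k, gaussWeight z * (inner ℝ z (e k) / 2 *
      (hermiteTwo c z * fderiv ℝ G z (e k)))
      = 1 / 2 * (gaussWeight z * (hermiteTwo c z * fderiv ℝ G z z)) := by
    intro z
    have : fderiv ℝ G z z = ∑ k, inner ℝ (e k) z * fderiv ℝ G z (e k) := by
      conv_lhs => rw [← e.sum_repr' z, map_sum]
      simp [e.sum_repr' z]
    rw [this]
    simp_rw [Finset.mul_sum]
    exact Finset.sum_congr rfl fun k _ => by rw [real_inner_comm]; ring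
  simp_rw [e1, e2, e3] at hsum
  rw [integral_const_mul, integral_gauss_inner_mul_fderiv hG h0 h1 c] at hsum
  linarith

end Identities

theorem integral_gauss_hermiteTwo (c : Z) : ∫ z, gaussWeight z * hermiteTwo c z = 0 := by
  have h := integral_gauss_fderiv_fderiv (G := fun _ : Z => (1 : ℝ)) contDiff_const (C := 1)
    (by simp) (by simp) (fun z => by
      have : fderiv ℝ (fderiv ℝ (fun _ : Z => (1 : ℝ))) z = 0 := by
        rw [fderiv_fun_const]; exact fderiv_const_apply 0
      rw [this]
      exact (le_of_eq (norm_zero (E := Z →L[ℝ] Z →L[ℝ] ℝ))).trans zero_le_one) c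
  simpa using h.symm

end Gaussian

section Representation

variable {Z : Type*} [NormedAddCommGroup Z] [InnerProductSpace ℝ Z] [FiniteDimensional ℝ Z]
  [MeasurableSpace Z] [BorelSpace Z]
  {Y : Type*} [NormedAddCommGroup Y] [NormedSpace ℝ Y]

/-- Parabolic path through `X₀`. -/
def parabolicPoint (X₀ θ : Y) (S : Z →L[ℝ] Y) (s : ℝ) (z : Z) : Y := X₀ - s ^ 2 • θ + s • S z

theorem hasFDerivAt_parabolicPoint (X₀ θ : Y) (S : Z →L[ℝ] Y) (s : ℝ) (z : Z) :
    HasFDerivAt (parabolicPoint X₀ θ S s) (s • S) z :=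
  (S.hasFDerivAt.const_smul s).const_add _

theorem hasDerivAt_parabolicPoint (X₀ θ : Y) (S : Z →L[ℝ] Y) (s : ℝ) (z : Z) :
    HasDerivAt (fun s => parabolicPoint X₀ θ S s z) (-((2 * s) • θ) + S z) s := by
  have h1 : HasDerivAt (fun s : ℝ => s ^ 2) (2 * s) s := by simpa using hasDerivAt_pow 2 s
  have := ((h1.smul_const θ).const_sub X₀).add ((hasDerivAt_id s).smul_const (S z))
  rw [one_smul] at this
  exact this

theorem continuous_parabolicPoint (X₀ θ : Y) (S : Z →L[ℝ] Y) (s : ℝ) :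
    Continuous (parabolicPoint X₀ θ S s) := by
  unfold parabolicPoint; fun_prop

section Slice

variable {w : Y → ℝ} (hw : ContDiff ℝ 2 w) {C : ℝ} (h1 : ∀ X, ‖fderiv ℝ w X‖ ≤ C)
  (h2 : ∀ X, ‖fderiv ℝ (fderiv ℝ w) X‖ ≤ C) (X₀ θ : Y) (S : Z →L[ℝ] Y) (s : ℝ)

include hw

theorem contDiff_slice : ContDiff ℝ 2 (fun z => w (parabolicPoint X₀ θ S s z)) := by
  unfold parabolicPoint
  exact hw.comp (by fun_prop)

theorem hasFDerivAt_slice (z : Z) : HasFDerivAt (fun z => w (parabolicPoint X₀ θ S s z))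
    (s • (fderiv ℝ w (parabolicPoint X₀ θ S s z)).comp S) z := by
  have := ((hw.differentiable (by norm_num)) (parabolicPoint X₀ θ S s z)).hasFDerivAt.comp z
    (hasFDerivAt_parabolicPoint X₀ θ S s z)
  refine this.congr_fderiv ?_
  ext v; simp

theorem hasFDerivAt_fderiv_slice (z : Z) :
    HasFDerivAt (fderiv ℝ (fun z => w (parabolicPoint X₀ θ S s z)))
      (s • ((ContinuousLinearMap.compL ℝ Z Y ℝ).flip S).comp
        ((fderiv ℝ (fderiv ℝ w) (parabolicPoint X₀ θ S s z)).comp (s • S))) z := by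
  have e : fderiv ℝ (fun z => w (parabolicPoint X₀ θ S s z)) =
      fun z => s • ((ContinuousLinearMap.compL ℝ Z Y ℝ).flip S)
        (fderiv ℝ w (parabolicPoint X₀ θ S s z)) := by
    ext1 z
    rw [(hasFDerivAt_slice hw X₀ θ S s z).fderiv]; rfl
  rw [e]
  have hd := ((hw.fderiv_right (m := 1) (by norm_num)).differentiable (by norm_num)
    (parabolicPoint X₀ θ S s z)).hasFDerivAt.comp z (hasFDerivAt_parabolicPoint X₀ θ S s z)
  exact ((((ContinuousLinearMap.compL ℝ Z Y ℝ).flip S).hasFDerivAt).comp z hd).const_smul s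

theorem fderiv_slice_apply (z v : Z) : fderiv ℝ (fun z => w (parabolicPoint X₀ θ S s z)) z v
    = s * fderiv ℝ w (parabolicPoint X₀ θ S s z) (S v) := by
  rw [(hasFDerivAt_slice hw X₀ θ S s z).fderiv]; simp

theorem fderiv_fderiv_slice_apply (z v v' : Z) :
    fderiv ℝ (fderiv ℝ (fun z => w (parabolicPoint X₀ θ S s z))) z v v'
      = s ^ 2 * fderiv ℝ (fderiv ℝ w) (parabolicPoint X₀ θ S s z) (S v) (S v') := by
  rw [(hasFDerivAt_fderiv_slice hw X₀ θ S s z).fderiv]; simp; ring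

include h1 h2 in
theorem exists_bound_slice : ∃ D, (∀ z, ‖fderiv ℝ (fun z => w (parabolicPoint X₀ θ S s z)) z‖ ≤ D) ∧
    ∀ z, ‖fderiv ℝ (fderiv ℝ (fun z => w (parabolicPoint X₀ θ S s z))) z‖ ≤ D := by
  have hC : 0 ≤ C := (norm_nonneg _).trans (h1 0)
  refine ⟨max (|s| * (C * ‖S‖)) (s ^ 2 * (C * ‖S‖ * ‖S‖)),
    fun z => le_max_of_le_left ?_, fun z => le_max_of_le_right ?_⟩
  · rw [(hasFDerivAt_slice hw X₀ θ S s z).fderiv, norm_smul, Real.norm_eq_abs]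
    gcongr
    exact (ContinuousLinearMap.opNorm_comp_le _ _).trans (by gcongr; exact h1 _)
  · refine ContinuousLinearMap.opNorm_le_bound₂ _ (by positivity) fun v v' => ?_
    rw [fderiv_fderiv_slice_apply hw, norm_mul, Real.norm_of_nonneg (sq_nonneg s)]
    have := (fderiv ℝ (fderiv ℝ w) (parabolicPoint X₀ θ S s z)).le_opNorm₂ (S v) (S v')
    calc s ^ 2 * ‖fderiv ℝ (fderiv ℝ w) (parabolicPoint X₀ θ S s z) (S v) (S v')‖
        ≤ s ^ 2 * (C * (‖S‖ * ‖v‖) * (‖S‖ * ‖v'‖)) := by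
          gcongr
          refine this.trans ?_
          gcongr
          exacts [h2 _, S.le_opNorm v, S.le_opNorm v']
      _ = _ := by ring

end Slice

theorem polyGrowth_one_add_norm_pow (m : ℕ) : PolyGrowth m (fun z : Z => (1 + ‖z‖) ^ m) :=
  ⟨by fun_prop, 1, by norm_num, fun z => by rw [abs_of_nonneg (by positivity), one_mul]⟩

theorem hasDerivAt_integral_slice {w : Y → ℝ} (hw : ContDiff ℝ 2 w) {C : ℝ} (h0 : ∀ X, |w X| ≤ C)
    (h1 : ∀ X, ‖fderiv ℝ w X‖ ≤ C) (X₀ θ : Y) (S : Z →L[ℝ] Y) (c : Z) (s : ℝ) :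
    Integrable (fun z => gaussWeight z * (hermiteTwo c z *
      fderiv ℝ w (parabolicPoint X₀ θ S s z) (-((2 * s) • θ) + S z))) ∧
    HasDerivAt (fun s => ∫ z, gaussWeight z * (hermiteTwo c z * w (parabolicPoint X₀ θ S s z)))
      (∫ z, gaussWeight z * (hermiteTwo c z *
        fderiv ℝ w (parabolicPoint X₀ θ S s z) (-((2 * s) • θ) + S z))) s := by
  have hC : 0 ≤ C := (norm_nonneg _).trans (h1 0)
  have hK : Continuous (gaussWeight : Z → ℝ) := continuous_gaussWeight
  have hh : Continuous (hermiteTwo c) := (polyGrowth_hermiteTwo c).1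
  have hdw : Continuous (fderiv ℝ w) := hw.continuous_fderiv (by norm_num)
  have hF : ∀ s, PolyGrowth 4 (fun z => hermiteTwo c z * w (parabolicPoint X₀ θ S s z)) := fun s =>
    ((polyGrowth_hermiteTwo c).mul (PolyGrowth.of_bounded
      (hw.continuous.comp (continuous_parabolicPoint X₀ θ S s)) fun z => h0 _)).mono (by norm_num)
  set A : ℝ := 2 * (|s| + 1) * ‖θ‖ + ‖S‖ with hA
  have hA0 : 0 ≤ A := by positivity
  refine hasDerivAt_integral_of_dominated_loc_of_deriv_le (F' := fun s z => gaussWeight z *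
    (hermiteTwo c z * fderiv ℝ w (parabolicPoint X₀ θ S s z) (-((2 * s) • θ) + S z)))
    (Metric.ball_mem_nhds s one_pos)
    (bound := fun z => gaussWeight z * (‖c‖ ^ 2 * C * A * (1 + ‖z‖) ^ 3))
    (Filter.Eventually.of_forall fun s => (hF s).integrable.aestronglyMeasurable)
    (hF s).integrable ?_ ?_ ?_ ?_
  · refine (hK.mul (hh.mul ((hdw.comp (continuous_parabolicPoint X₀ θ S s)).clm_apply
      ?_))).aestronglyMeasurable
    fun_prop
  · refine Filter.Eventually.of_forall fun z s' hs' => ?_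
    rw [norm_mul, norm_mul, Real.norm_of_nonneg (gaussWeight_pos z).le]
    refine mul_le_mul_of_nonneg_left ?_ (gaussWeight_pos z).le
    have hs1 : |s'| ≤ |s| + 1 := by
      rw [Metric.mem_ball, Real.dist_eq] at hs'
      have := abs_sub_abs_le_abs_sub s' s
      linarith
    have hv : ‖-((2 * s') • θ) + S z‖ ≤ A * (1 + ‖z‖) := by
      have a1 : ‖-((2 * s') • θ)‖ ≤ 2 * (|s| + 1) * ‖θ‖ := by
        rw [norm_neg, norm_smul, norm_mul, Real.norm_eq_abs, Real.norm_eq_abs, abs_two]; gcongr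
      have a2 := S.le_opNorm z
      have a3 := norm_add_le (-((2 * s') • θ)) (S z)
      have : 0 ≤ 2 * (|s| + 1) * ‖θ‖ := by positivity
      rw [hA]
      nlinarith [norm_nonneg z, norm_nonneg S]
    calc ‖hermiteTwo c z‖ * ‖fderiv ℝ w (parabolicPoint X₀ θ S s' z) (-((2 * s') • θ) + S z)‖
        ≤ (‖c‖ ^ 2 * (1 + ‖z‖) ^ 2) * (C * (A * (1 + ‖z‖))) := by
          gcongr
          · exact abs_hermiteTwo_le c z
          · exact (ContinuousLinearMap.le_opNorm _ _).trans (by gcongr; exact h1 _)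
      _ = _ := by ring
  · exact (((PolyGrowth.const _).mul (polyGrowth_one_add_norm_pow 3)).mono (by norm_num)).integrable
  · refine Filter.Eventually.of_forall fun z s' _ => ?_
    have hd := ((hw.differentiable (by norm_num)) (parabolicPoint X₀ θ S s' z)).hasFDerivAt
    exact ((hd.comp_hasDerivAt s' (hasDerivAt_parabolicPoint X₀ θ S s' z)).const_mul _).const_mul _

/-- Pointwise estimate of the Hessian of `w` by the oscillation of its image under a
constant-coefficient heat operator. -/
theorem gauss_hessian_bound {ι : Type*} [Fintype ι] (e : OrthonormalBasis ι ℝ Z)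
    {w : Y → ℝ} (hw : ContDiff ℝ 2 w) {C : ℝ} (h0 : ∀ X, |w X| ≤ C)
    (h1 : ∀ X, ‖fderiv ℝ w X‖ ≤ C) (h2 : ∀ X, ‖fderiv ℝ (fderiv ℝ w) X‖ ≤ C)
    (X₀ θ : Y) (S : Z →L[ℝ] Y) (c : Z) {s₀ : ℝ} (hs₀ : 0 < s₀) {B M f₀ : ℝ}
    (hB : ∀ X, |w X| ≤ B)
    (hM : ∀ s, 0 < s → s ≤ s₀ → ∀ z : Z, |fderiv ℝ w (parabolicPoint X₀ θ S s z) θ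
      - ∑ k, fderiv ℝ (fderiv ℝ w) (parabolicPoint X₀ θ S s z) (S (e k)) (S (e k)) - f₀|
        ≤ M * s * (1 + ‖z‖)) :
    (∫ z : Z, gaussWeight z) * |fderiv ℝ (fderiv ℝ w) X₀ (S c) (S c)|
      ≤ ‖c‖ ^ 2 * (∫ z : Z, gaussWeight z * (1 + ‖z‖) ^ 3) * (B / s₀ ^ 2 + 2 * M * s₀) := by
  set I : ℝ := ∫ z : Z, gaussWeight z * (1 + ‖z‖) ^ 3 with hI
  have hI3 : Integrable (fun z : Z => gaussWeight z * (1 + ‖z‖) ^ 3) :=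
    ((polyGrowth_one_add_norm_pow 3).mono (by norm_num)).integrable
  have hK : Continuous (gaussWeight : Z → ℝ) := continuous_gaussWeight
  have hh : Continuous (hermiteTwo c) := (polyGrowth_hermiteTwo c).1
  have hdw : Continuous (fderiv ℝ w) := hw.continuous_fderiv (by norm_num)
  have hddw : Continuous (fderiv ℝ (fderiv ℝ w)) :=
    (hw.fderiv_right (m := 1) (by norm_num)).continuous_fderiv (by norm_num)
  have hX : ∀ s, Continuous (parabolicPoint X₀ θ S s) := continuous_parabolicPoint X₀ θ S
  set m : ℝ → ℝ := fun s =>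
    ∫ z, gaussWeight z * (hermiteTwo c z * w (parabolicPoint X₀ θ S s z)) with hm
  set f : Y → ℝ := fun X => fderiv ℝ w X θ - ∑ k, fderiv ℝ (fderiv ℝ w) X (S (e k)) (S (e k)) with hf
  have hB0 : 0 ≤ B := (abs_nonneg _).trans (hB 0)
  -- the derivative of `m`
  have hderiv : ∀ s, 0 < s → s ≤ s₀ → ∃ d, HasDerivAt m d s ∧
      |s * d - 2 * m s| ≤ 2 * s ^ 3 * M * ‖c‖ ^ 2 * I := by
    intro s hs hs'
    obtain ⟨hint, hd⟩ := hasDerivAt_integral_slice hw h0 h1 X₀ θ S c s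
    refine ⟨_, hd, ?_⟩
    obtain ⟨D, hD1, hD2⟩ := exists_bound_slice hw h1 h2 X₀ θ S s
    have hid := integral_gauss_hermiteTwo_euler (contDiff_slice hw X₀ θ S s) (C := max C D)
      (fun z => (h0 _).trans (le_max_left _ _)) (fun z => (hD1 z).trans (le_max_right _ _))
      (fun z => (hD2 z).trans (le_max_right _ _)) e c
    simp_rw [fderiv_slice_apply hw, fderiv_fderiv_slice_apply hw] at hid
    have pθ : PolyGrowth 4 (fun z => hermiteTwo c z *
        fderiv ℝ w (parabolicPoint X₀ θ S s z) θ) :=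
      ((polyGrowth_hermiteTwo c).mul (PolyGrowth.of_bounded (C := C * ‖θ‖)
        ((hdw.comp (hX s)).clm_apply continuous_const)
        fun z => ((fderiv ℝ w (parabolicPoint X₀ θ S s z)).le_opNorm θ).trans
          (mul_le_mul_of_nonneg_right (h1 _) (norm_nonneg _)))).mono
        (by norm_num)
    have pk : ∀ k, PolyGrowth 0 (fun z =>
        fderiv ℝ (fderiv ℝ w) (parabolicPoint X₀ θ S s z) (S (e k)) (S (e k))) := fun k =>
      PolyGrowth.of_bounded (C := C * ‖S (e k)‖ * ‖S (e k)‖)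
        (((hddw.comp (hX s)).clm_apply continuous_const).clm_apply continuous_const)
        fun z => ((fderiv ℝ (fderiv ℝ w) (parabolicPoint X₀ θ S s z)).le_opNorm₂ _ _).trans
          (by gcongr; exact h2 _)
    have pS : PolyGrowth 4 (fun z => hermiteTwo c z * ∑ k,
        fderiv ℝ (fderiv ℝ w) (parabolicPoint X₀ θ S s z) (S (e k)) (S (e k))) :=
      ((polyGrowth_hermiteTwo c).mul (PolyGrowth.sum fun k _ => pk k)).mono (by norm_num)
    have e1 : s * (∫ z, gaussWeight z * (hermiteTwo c z *
        fderiv ℝ w (parabolicPoint X₀ θ S s z) (-((2 * s) • θ) + S z))) - 2 * m s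
        = -(2 * s ^ 2 * ∫ z, gaussWeight z * (hermiteTwo c z *
            (f (parabolicPoint X₀ θ S s z) - f₀))) := by
      have a1 : ∫ z, gaussWeight z * (hermiteTwo c z * (f (parabolicPoint X₀ θ S s z) - f₀))
          = (∫ z, gaussWeight z * (hermiteTwo c z * fderiv ℝ w (parabolicPoint X₀ θ S s z) θ))
            - (∫ z, gaussWeight z * (hermiteTwo c z * ∑ k,
        fderiv ℝ (fderiv ℝ w) (parabolicPoint X₀ θ S s z) (S (e k)) (S (e k)))) := by
        have a0 := integral_gauss_hermiteTwo c
        have a00 : ∫ z, f₀ * (gaussWeight z * hermiteTwo c z) = 0 := by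
          rw [integral_const_mul, a0, mul_zero]
        have i1 := pθ.integrable
        have i2 := pS.integrable
        have i3 := (((polyGrowth_hermiteTwo c).mono (by norm_num :
          2 ≤ 4)).integrable.const_mul f₀)
        have i4 := i1.sub i2
        rw [← integral_sub i1 i2, ← sub_zero (∫ z, (_ - _)), ← a00]
        refine Eq.trans ?_ (integral_sub i4 i3)
        congr 1; ext z; simp only [hf]; ring
      have a2 : s * (∫ z, gaussWeight z * (hermiteTwo c z *
          fderiv ℝ w (parabolicPoint X₀ θ S s z) (-((2 * s) • θ) + S z)))
          = (∫ z, gaussWeight z * (hermiteTwo c z *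
              (s * fderiv ℝ w (parabolicPoint X₀ θ S s z) (S z))))
            - 2 * s ^ 2 * ∫ z, gaussWeight z * (hermiteTwo c z *
              fderiv ℝ w (parabolicPoint X₀ θ S s z) θ) := by
        rw [eq_sub_iff_add_eq, ← integral_const_mul, ← integral_const_mul,
          ← integral_add (hint.const_mul _) (pθ.integrable.const_mul _)]
        congr 1; ext z; simp; ring
      have a3 : (∫ z, gaussWeight z * (hermiteTwo c z * ∑ k,
          s ^ 2 * fderiv ℝ (fderiv ℝ w) (parabolicPoint X₀ θ S s z) (S (e k)) (S (e k))))
          = s ^ 2 * (∫ z, gaussWeight z * (hermiteTwo c z * ∑ k,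
            fderiv ℝ (fderiv ℝ w) (parabolicPoint X₀ θ S s z) (S (e k)) (S (e k)))) := by
        rw [← integral_const_mul]
        congr 1; ext z; rw [← Finset.mul_sum]; ring_nf
      rw [a3] at hid
      rw [a1, a2, hid]
      ring
    rw [e1, abs_neg, abs_mul, abs_of_nonneg (by positivity : 0 ≤ 2 * s ^ 2)]
    have e2 : |∫ z, gaussWeight z * (hermiteTwo c z * (f (parabolicPoint X₀ θ S s z) - f₀))|
        ≤ ∫ z : Z, (‖c‖ ^ 2 * (M * s)) * (gaussWeight z * (1 + ‖z‖) ^ 3) := by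
      rw [← Real.norm_eq_abs]
      refine norm_integral_le_of_norm_le (hI3.const_mul _) (Filter.Eventually.of_forall fun z => ?_)
      rw [norm_mul, norm_mul, Real.norm_of_nonneg (gaussWeight_pos z).le]
      calc gaussWeight z * (‖hermiteTwo c z‖ * ‖f (parabolicPoint X₀ θ S s z) - f₀‖)
          ≤ gaussWeight z * ((‖c‖ ^ 2 * (1 + ‖z‖) ^ 2) * (M * s * (1 + ‖z‖))) := by
            gcongr
            · exact (gaussWeight_pos z).le
            · exact abs_hermiteTwo_le c z
            · exact hM s hs hs' z
        _ = _ := by ring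
    rw [integral_const_mul] at e2
    calc _ ≤ 2 * s ^ 2 * (‖c‖ ^ 2 * (M * s) * I) := by gcongr
      _ = _ := by ring
  -- the normalised mean
  have hM0 : 0 ≤ M := by
    have h := (abs_nonneg _).trans (hM s₀ hs₀ le_rfl 0)
    simp only [norm_zero, add_zero, mul_one] at h
    exact nonneg_of_mul_nonneg_left h hs₀
  have hn : ∀ s, 0 < s → s ≤ s₀ → |m s₀ / s₀ ^ 2 - m s / s ^ 2| ≤ 2 * M * ‖c‖ ^ 2 * I * (s₀ - s) := by
    intro s hs hs'
    have hder : ∀ x ∈ Icc s s₀, ∃ d, HasDerivWithinAt (fun x => m x / x ^ 2) d (Icc s s₀) x ∧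
        ‖d‖ ≤ 2 * M * ‖c‖ ^ 2 * I := by
      intro x hx
      have hx0 : 0 < x := hs.trans_le hx.1
      obtain ⟨d, hd, hd'⟩ := hderiv x hx0 hx.2
      refine ⟨_, (hd.div (hasDerivAt_pow 2 x) (by positivity)).hasDerivWithinAt, ?_⟩
      have : (d * x ^ 2 - m x * ((2 : ℕ) * x ^ (2 - 1))) / (x ^ 2) ^ 2
          = (x * d - 2 * m x) / x ^ 3 := by
        field_simp
        push_cast
        ring
      rw [this, norm_div, Real.norm_eq_abs, Real.norm_of_nonneg (by positivity : 0 ≤ x ^ 3),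
        div_le_iff₀ (by positivity)]
      linarith
    choose! d hd hd' using hder
    have := (convex_Icc s s₀).norm_image_sub_le_of_norm_hasDerivWithin_le hd hd'
      (left_mem_Icc.2 hs') (right_mem_Icc.2 hs')
    rwa [Real.norm_eq_abs, Real.norm_of_nonneg (sub_nonneg.2 hs')] at this
  have hrep : ∀ s, 0 < s → m s / s ^ 2 = ∫ z, gaussWeight z *
      fderiv ℝ (fderiv ℝ w) (parabolicPoint X₀ θ S s z) (S c) (S c) := by
    intro s hs
    obtain ⟨D, hD1, hD2⟩ := exists_bound_slice hw h1 h2 X₀ θ S s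
    have hid := integral_gauss_fderiv_fderiv (contDiff_slice hw X₀ θ S s) (C := max C D)
      (fun z => (h0 _).trans (le_max_left _ _)) (fun z => (hD1 z).trans (le_max_right _ _))
      (fun z => (hD2 z).trans (le_max_right _ _)) c
    simp_rw [fderiv_fderiv_slice_apply hw] at hid
    rw [div_eq_iff (by positivity), ← integral_mul_const]
    refine hid.symm.trans ?_
    congr 1; ext z; ring
  have hlim : Filter.Tendsto (fun s => m s / s ^ 2) (nhdsWithin 0 (Ioi 0))
      (nhds ((∫ z : Z, gaussWeight z) * fderiv ℝ (fderiv ℝ w) X₀ (S c) (S c))) := by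
    rw [← integral_mul_const]
    have hK0 : Integrable (fun z : Z => gaussWeight z) := by
      simpa using ((PolyGrowth.const (Z := Z) 1).mono (by norm_num : 0 ≤ 4)).integrable
    refine Filter.Tendsto.congr' (f₁ := fun s => ∫ z, gaussWeight z *
      fderiv ℝ (fderiv ℝ w) (parabolicPoint X₀ θ S s z) (S c) (S c)) ?_ ?_
    · filter_upwards [self_mem_nhdsWithin] with s hs using (hrep s hs).symm
    refine tendsto_integral_filter_of_dominated_convergence
      (fun z => gaussWeight z * (C * ‖S c‖ * ‖S c‖)) ?_ ?_ (hK0.mul_const _) ?_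
    · exact Filter.Eventually.of_forall fun s => (hK.mul (((hddw.comp (hX s)).clm_apply
        continuous_const).clm_apply continuous_const)).aestronglyMeasurable
    · refine Filter.Eventually.of_forall fun s => Filter.Eventually.of_forall fun z => ?_
      rw [norm_mul, Real.norm_of_nonneg (gaussWeight_pos z).le]
      gcongr
      · exact (gaussWeight_pos z).le
      · exact (ContinuousLinearMap.le_opNorm₂ _ _ _).trans (by gcongr; exact h2 _)
    · refine Filter.Eventually.of_forall fun z => (Filter.Tendsto.const_mul _ ?_)
      have hc : Continuous fun s : ℝ =>
          fderiv ℝ (fderiv ℝ w) (parabolicPoint X₀ θ S s z) (S c) (S c) := by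
        refine ((hddw.comp ?_).clm_apply continuous_const).clm_apply continuous_const
        unfold parabolicPoint; fun_prop
      have := (hc.tendsto 0).mono_left (nhdsWithin_le_nhds (s := Ioi 0))
      simpa [parabolicPoint] using this
  have hms : |m s₀ / s₀ ^ 2| ≤ ‖c‖ ^ 2 * I * (B / s₀ ^ 2) := by
    have : |m s₀| ≤ ∫ z : Z, (‖c‖ ^ 2 * B) * (gaussWeight z * (1 + ‖z‖) ^ 3) := by
      rw [← Real.norm_eq_abs]
      refine norm_integral_le_of_norm_le (hI3.const_mul _) (Filter.Eventually.of_forall fun z => ?_)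
      rw [norm_mul, norm_mul, Real.norm_of_nonneg (gaussWeight_pos z).le]
      have hz : (1 + ‖z‖) ^ 2 ≤ (1 + ‖z‖) ^ 3 :=
        pow_le_pow_right₀ (by linarith [norm_nonneg z]) (by norm_num)
      calc gaussWeight z * (‖hermiteTwo c z‖ * ‖w (parabolicPoint X₀ θ S s₀ z)‖)
          ≤ gaussWeight z * ((‖c‖ ^ 2 * (1 + ‖z‖) ^ 3) * B) := by
            gcongr
            · exact (gaussWeight_pos z).le
            · exact (abs_hermiteTwo_le c z).trans (by gcongr)
            · exact hB _
        _ = _ := by ring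
    rw [integral_const_mul] at this
    rw [abs_div, abs_of_pos (by positivity : 0 < s₀ ^ 2), mul_div_assoc', ]
    gcongr
    linarith
  have hIpos : 0 ≤ I := integral_nonneg fun z => mul_nonneg (gaussWeight_pos z).le (by positivity)
  have hfin : |(∫ z : Z, gaussWeight z) * fderiv ℝ (fderiv ℝ w) X₀ (S c) (S c)|
      ≤ ‖c‖ ^ 2 * I * (B / s₀ ^ 2 + 2 * M * s₀) := by
    refine le_of_tendsto hlim.abs ?_
    filter_upwards [Ioc_mem_nhdsGT hs₀] with s hs
    have b1 := hn s hs.1 hs.2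
    have b2 : |m s / s ^ 2| ≤ |m s₀ / s₀ ^ 2| + |m s₀ / s₀ ^ 2 - m s / s ^ 2| := by
      have := abs_sub (m s₀ / s₀ ^ 2) (m s₀ / s₀ ^ 2 - m s / s ^ 2)
      rwa [sub_sub_cancel] at this
    have b3 : 2 * M * ‖c‖ ^ 2 * I * (s₀ - s) ≤ 2 * M * ‖c‖ ^ 2 * I * s₀ := by
      gcongr; linarith [hs.1]
    calc _ ≤ _ := b2
      _ ≤ ‖c‖ ^ 2 * I * (B / s₀ ^ 2) + 2 * M * ‖c‖ ^ 2 * I * s₀ := by linarith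
      _ = _ := by ring
  rwa [abs_mul, abs_of_nonneg (integral_nonneg fun z => (gaussWeight_pos z).le)] at hfin

end Representation

section Cutoff

variable {Y : Type*} [NormedAddCommGroup Y] [NormedSpace ℝ Y] [FiniteDimensional ℝ Y]

/-- A `C¹` compactly supported map vanishing at the origin has at most linear size. -/
theorem exists_norm_le_mul_norm_of_hasCompactSupport {G : Type*} [NormedAddCommGroup G]
    [NormedSpace ℝ G] {f : Y → G} (hf : ContDiff ℝ 1 f) (hs : HasCompactSupport f) :
    ∃ K, 0 ≤ K ∧ ∀ X, ‖f X - f 0‖ ≤ K * ‖X‖ := by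
  obtain ⟨K, hK⟩ := ContDiff.lipschitzWith_of_hasCompactSupport hs hf one_ne_zero
  exact ⟨K, K.2, fun X => by simpa using hK.norm_sub_le X 0⟩

theorem exists_cutoff : ∃ K, 0 ≤ K ∧ ∃ χ : Y → ℝ, ContDiff ℝ 2 χ ∧ tsupport χ ⊆ Metric.ball 0 1 ∧
    (∀ X, |χ X| ≤ 1) ∧ (χ =ᶠ[nhds 0] fun _ => 1) ∧ ∀ X, |χ X - 1| ≤ K * ‖X‖ ∧
      ‖fderiv ℝ χ X‖ ≤ K * ‖X‖ ∧ ∀ p q, |fderiv ℝ (fderiv ℝ χ) X p q| ≤ K * ‖X‖ * ‖p‖ * ‖q‖ := by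
  have : HasContDiffBump Y := inferInstance
  let f : ContDiffBump (0 : Y) := ⟨1 / 4, 1 / 2, by norm_num, by norm_num⟩
  have hf : ContDiff ℝ 3 f := f.contDiff
  have hs : HasCompactSupport f := f.hasCompactSupport
  have e0 : (f : Y → ℝ) =ᶠ[nhds 0] fun _ => 1 := f.eventuallyEq_one
  have e1 : fderiv ℝ f =ᶠ[nhds 0] fun _ => 0 := by
    refine (e0.fderiv (𝕜 := ℝ)).trans (Filter.Eventually.of_forall fun X => ?_)
    exact fderiv_const_apply 1
  have e2 : fderiv ℝ (fderiv ℝ f) 0 = 0 := by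
    rw [e1.fderiv_eq]; exact fderiv_const_apply 0
  have c1 : ContDiff ℝ 2 (fderiv ℝ f) := hf.fderiv_right (by norm_num)
  have c2 : ContDiff ℝ 1 (fderiv ℝ (fderiv ℝ f)) := c1.fderiv_right (by norm_num)
  have s1 := hs.fderiv (𝕜 := ℝ)
  have s2 := s1.fderiv (𝕜 := ℝ)
  obtain ⟨K0, h0, hK0⟩ := exists_norm_le_mul_norm_of_hasCompactSupport (hf.of_le (by norm_num)) hs
  obtain ⟨K1, h1, hK1⟩ := exists_norm_le_mul_norm_of_hasCompactSupport (c1.of_le (by norm_num)) s1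
  obtain ⟨K2, h2, hK2⟩ := exists_norm_le_mul_norm_of_hasCompactSupport c2 s2
  refine ⟨K0 + K1 + K2, by positivity, f, hf.of_le (by norm_num), ?_, ?_, e0, fun X => ⟨?_, ?_, ?_⟩⟩
  · rw [f.tsupport_eq]
    exact Metric.closedBall_subset_ball (by norm_num [f])
  · intro X
    rw [abs_of_nonneg f.nonneg]; exact f.le_one
  · have := hK0 X
    rw [e0.self_of_nhds, Real.norm_eq_abs] at this
    refine this.trans ?_
    gcongr; linarith
  · have := hK1 X
    rw [e1.self_of_nhds, sub_zero] at this
    refine this.trans ?_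
    gcongr; linarith
  · intro p q
    have := hK2 X
    rw [e2, sub_zero] at this
    refine ((fderiv ℝ (fderiv ℝ f) X).le_opNorm₂ p q).trans ?_
    gcongr
    refine this.trans ?_
    gcongr; linarith

theorem exists_scaled_cutoff : ∃ K, 0 ≤ K ∧ ∀ (X₀ : Y) (ρ : ℝ), 0 < ρ → ∃ φ : Y → ℝ,
    ContDiff ℝ 2 φ ∧ tsupport φ ⊆ Metric.ball X₀ ρ ∧
    (∀ X, |φ X| ≤ 1) ∧ (φ =ᶠ[nhds X₀] fun _ => 1) ∧ ∀ X, |φ X - 1| ≤ K * ρ⁻¹ * ‖X - X₀‖ ∧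
      ‖fderiv ℝ φ X‖ ≤ K * ρ⁻¹ ^ 2 * ‖X - X₀‖ ∧
      ∀ p q, |fderiv ℝ (fderiv ℝ φ) X p q| ≤ K * ρ⁻¹ ^ 3 * ‖X - X₀‖ * ‖p‖ * ‖q‖ := by
  obtain ⟨K, hK, χ, hχ, hsupp, h1, he, hb⟩ := exists_cutoff (Y := Y)
  refine ⟨K, hK, fun X₀ ρ hρ => ?_⟩
  set g : Y → Y := fun X => ρ⁻¹ • (X - X₀) with hg
  have hgc : ContDiff ℝ 2 g := by fun_prop
  have hgd : ∀ X, HasFDerivAt g (ρ⁻¹ • ContinuousLinearMap.id ℝ Y) X := fun X =>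
    ((hasFDerivAt_id X).sub_const X₀).const_smul ρ⁻¹
  have hgn : ∀ X, ‖g X‖ = ρ⁻¹ * ‖X - X₀‖ := fun X => by
    rw [hg]; simp only; rw [norm_smul, Real.norm_of_nonneg (by positivity)]
  have d1 : ∀ X, HasFDerivAt (fun X => χ (g X)) (ρ⁻¹ • fderiv ℝ χ (g X)) X := fun X => by
    refine (((hχ.differentiable (by norm_num)) (g X)).hasFDerivAt.comp X (hgd X)).congr_fderiv ?_
    ext v; simp
  have d1' : fderiv ℝ (fun X => χ (g X)) = fun X => ρ⁻¹ • fderiv ℝ χ (g X) := by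
    ext1 X; exact (d1 X).fderiv
  have d2 : ∀ X p q, fderiv ℝ (fderiv ℝ (fun X => χ (g X))) X p q
      = ρ⁻¹ ^ 2 * fderiv ℝ (fderiv ℝ χ) (g X) p q := fun X p q => by
    have h := ((hχ.fderiv_right (m := 1) (by norm_num)).differentiable (by norm_num)
      (g X)).hasFDerivAt.comp X (hgd X)
    have h' := h.const_smul ρ⁻¹
    rw [d1']
    refine (congrArg (fun L : Y →L[ℝ] Y →L[ℝ] ℝ => L p q) h'.fderiv).trans ?_
    simp; ring
  refine ⟨fun X => χ (g X), hχ.comp hgc, ?_, fun X => h1 _, ?_, fun X => ⟨?_, ?_, ?_⟩⟩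
  · intro X hX
    have h : g X ∈ tsupport χ := by
      have := closure_mono (s := Function.support fun X => χ (g X))
        (t := g ⁻¹' Function.support χ) (fun _ h => h) hX
      exact hgc.continuous.closure_preimage_subset _ this
    have := hsupp h
    rw [mem_ball_zero_iff, hgn, inv_mul_lt_iff₀ hρ, mul_one] at this
    rwa [mem_ball_iff_norm]
  · have : Filter.Tendsto g (nhds X₀) (nhds 0) := by
      have := hgc.continuous.tendsto X₀
      simpa [hg] using this
    exact this.eventually he
  · have := (hb (g X)).1
    rw [hgn] at this; linarith
  · have := (hb (g X)).2.1
    rw [hgn] at this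
    rw [d1', norm_smul, Real.norm_of_nonneg (by positivity)]
    calc ρ⁻¹ * ‖fderiv ℝ χ (g X)‖ ≤ ρ⁻¹ * (K * (ρ⁻¹ * ‖X - X₀‖)) := by gcongr
      _ = _ := by ring
  · intro p q
    have := (hb (g X)).2.2 p q
    rw [hgn] at this
    rw [d2, abs_mul, abs_of_nonneg (by positivity)]
    calc _ ≤ ρ⁻¹ ^ 2 * (K * (ρ⁻¹ * ‖X - X₀‖) * ‖p‖ * ‖q‖) := by gcongr
      _ = _ := by ring

end Cutoff

section Product

variable {Y : Type*} [NormedAddCommGroup Y] [NormedSpace ℝ Y]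

theorem fderiv_mul_apply_apply {φ V : Y → ℝ} {X : Y} (hφ : ContDiffAt ℝ 2 φ X)
    (hV : ContDiffAt ℝ 2 V X) :
    (∀ v, fderiv ℝ (fun X => φ X * V X) X v = φ X * fderiv ℝ V X v + V X * fderiv ℝ φ X v) ∧
    ∀ p q, fderiv ℝ (fderiv ℝ (fun X => φ X * V X)) X p q = φ X * fderiv ℝ (fderiv ℝ V) X p q
      + fderiv ℝ φ X p * fderiv ℝ V X q + fderiv ℝ V X p * fderiv ℝ φ X q
      + V X * fderiv ℝ (fderiv ℝ φ) X p q := by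
  have hd : ∀ {f : Y → ℝ} {X : Y}, ContDiffAt ℝ 2 f X → HasFDerivAt f (fderiv ℝ f X) X :=
    fun h => (h.differentiableAt (by norm_num)).hasFDerivAt
  have hdd : ∀ {f : Y → ℝ} {X : Y}, ContDiffAt ℝ 2 f X →
      HasFDerivAt (fderiv ℝ f) (fderiv ℝ (fderiv ℝ f) X) X :=
    fun h => ((h.fderiv_right (m := 1) (by norm_num)).differentiableAt (by norm_num)).hasFDerivAt
  have hev : ∀ {f : Y → ℝ} {X : Y}, ContDiffAt ℝ 2 f X → ∀ᶠ X' in nhds X, ContDiffAt ℝ 2 f X' :=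
    fun h => h.eventually (by simp)
  refine ⟨fun v => ?_, fun p q => ?_⟩
  · rw [((hd hφ).fun_mul (hd hV)).fderiv]; simp
  · have e : fderiv ℝ (fun X => φ X * V X) =ᶠ[nhds X]
        fun X => φ X • fderiv ℝ V X + V X • fderiv ℝ φ X := by
      filter_upwards [hev hφ, hev hV] with X' h1 h2
      exact ((hd h1).fun_mul (hd h2)).fderiv
    rw [e.fderiv_eq]
    have h := ((hd hφ).fun_smul (hdd hV)).fun_add ((hd hV).fun_smul (hdd hφ))
    refine (congrArg (fun L : Y →L[ℝ] Y →L[ℝ] ℝ => L p q) h.fderiv).trans ?_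
    simp; ring

end Product

section TimeOscillation

variable {E : Type*} [NormedAddCommGroup E] [NormedSpace ℝ E]

/-- Hölder continuity in time of the spatial gradient. -/
theorem abs_fderiv_sub_le {V : ℝ × E → ℝ} {U : Set (ℝ × E)} (hU : Convex ℝ U) (hUo : IsOpen U)
    (hV : ContDiffOn ℝ 2 V U) {ε H : ℝ} (h1 : ∀ X ∈ U, ‖fderiv ℝ V X‖ ≤ ε)
    (h2 : ∀ X ∈ U, ∀ p q : E, |fderiv ℝ (fderiv ℝ V) X (0, p) (0, q)| ≤ H * ‖p‖ * ‖q‖) :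
    (∀ X ∈ U, ∀ v p : E, X + (0, v) ∈ U →
      |fderiv ℝ V (X + (0, v)) (0, p) - fderiv ℝ V X (0, p)| ≤ H * ‖v‖ * ‖p‖) ∧
    ∀ X ∈ U, ∀ s : ℝ, 0 < s → X - s ^ 2 • ((1 : ℝ), (0 : E)) ∈ U → ∀ p : E, ‖p‖ = 1 →
      X + (0, s • p) ∈ U → X - s ^ 2 • ((1 : ℝ), (0 : E)) + (0, s • p) ∈ U →
      |fderiv ℝ V (X - s ^ 2 • ((1 : ℝ), (0 : E))) (0, p) - fderiv ℝ V X (0, p)|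
        ≤ 2 * (ε + H) * s := by
  have hd : ∀ X ∈ U, HasFDerivAt V (fderiv ℝ V X) X := fun X hX =>
    ((hV.contDiffAt (hUo.mem_nhds hX)).differentiableAt (by norm_num)).hasFDerivAt
  have hdd : ∀ X ∈ U, HasFDerivAt (fderiv ℝ V) (fderiv ℝ (fderiv ℝ V) X) X := fun X hX =>
    (((hV.contDiffAt (hUo.mem_nhds hX)).fderiv_right (m := 1)
      (by norm_num)).differentiableAt (by norm_num)).hasFDerivAt
  have hpath : ∀ X ∈ U, ∀ v : E, X + (0, v) ∈ U → ∀ r ∈ Icc (0 : ℝ) 1,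
      X + r • ((0 : ℝ), v) ∈ U := fun X hX v hv r hr => hU.add_smul_mem hX hv hr
  have hline : ∀ (X : ℝ × E) (v : E) (r : ℝ), HasDerivAt (fun r : ℝ => X + r • ((0 : ℝ), v))
      (0, v) r := fun X v r => by
    have := ((hasDerivAt_id r).smul_const ((0 : ℝ), v)).const_add X
    rw [one_smul] at this
    exact this
  have key : ∀ X ∈ U, ∀ v p : E, X + (0, v) ∈ U →
      |fderiv ℝ V (X + (0, v)) (0, p) - fderiv ℝ V X (0, p)| ≤ H * ‖v‖ * ‖p‖ := by
    intro X hX v p hv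
    have := (convex_Icc (0 : ℝ) 1).norm_image_sub_le_of_norm_hasDerivWithin_le
      (f := fun r => fderiv ℝ V (X + r • ((0 : ℝ), v)) (0, p))
      (f' := fun r => fderiv ℝ (fderiv ℝ V) (X + r • ((0 : ℝ), v)) (0, v) (0, p))
      (C := H * ‖v‖ * ‖p‖)
      (fun r hr => by
        have h := (hdd _ (hpath X hX v hv r hr)).comp_hasDerivAt r (hline X v r)
        exact (h.clm_apply (hasDerivAt_const r ((0 : ℝ), p))).hasDerivWithinAt.congr_deriv
          (by simp))
      (fun r hr => h2 _ (hpath X hX v hv r hr) _ _)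
      (left_mem_Icc.2 zero_le_one) (right_mem_Icc.2 zero_le_one)
    simpa using this
  refine ⟨key, fun X hX s hs hX' p hp hXp hXp' => ?_⟩
  set X' := X - s ^ 2 • ((1 : ℝ), (0 : E)) with hX'def
  have hε : 0 ≤ ε := (norm_nonneg _).trans (h1 X hX)
  have htime : ∀ P ∈ U, ∀ P' ∈ U, P' - P = -(s ^ 2 • ((1 : ℝ), (0 : E))) →
      |V P' - V P| ≤ ε * s ^ 2 := by
    intro P hP P' hP' hPP
    have := hU.norm_image_sub_le_of_norm_hasFDerivWithin_le
      (fun X hX => (hd X hX).hasFDerivWithinAt) h1 hP hP'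
    rw [hPP, norm_neg, norm_smul] at this
    simpa using this
  have hs1 : s ≠ 0 := hs.ne'
  have hmem : ∀ P ∈ U, P + (0, s • p) ∈ U → ∀ r ∈ Icc (0 : ℝ) s, P + r • ((0 : ℝ), p) ∈ U := by
    intro P hP hPs r hr
    have := hpath P hP (s • p) hPs (r / s) ⟨by have := hr.1; positivity, (div_le_one hs).2 hr.2⟩
    have e : (r / s) • ((0 : ℝ), s • p) = r • ((0 : ℝ), p) := by
      ext <;> simp [smul_smul, hs1]
    rwa [e] at this
  have hkd : ∀ r ∈ Icc (0 : ℝ) s, HasDerivAt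
      (fun r => V (X' + r • ((0 : ℝ), p)) - V (X + r • ((0 : ℝ), p)))
      (fderiv ℝ V (X' + r • ((0 : ℝ), p)) (0, p) - fderiv ℝ V (X + r • ((0 : ℝ), p)) (0, p)) r :=
    fun r hr => ((hd _ (hmem X' hX' hXp' r hr)).comp_hasDerivAt r (hline X' p r)).sub
      ((hd _ (hmem X hX hXp r hr)).comp_hasDerivAt r (hline X p r))
  obtain ⟨r, hr, hr'⟩ := exists_hasDerivAt_eq_slope _ _ hs
    (fun r hr => (hkd r hr).continuousAt.continuousWithinAt)
    (fun r hr => hkd r (Ioo_subset_Icc_self hr))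
  have hrI := Ioo_subset_Icc_self hr
  have e1 : X' + s • ((0 : ℝ), p) = X' + (0, s • p) := by simp
  have e2 : X + s • ((0 : ℝ), p) = X + (0, s • p) := by simp
  have e3 : ∀ P : ℝ × E, P + r • ((0 : ℝ), p) = P + (0, r • p) := by simp
  have t1 := htime (X + (0, s • p)) hXp (X' + (0, s • p)) hXp' (by rw [hX'def]; abel)
  have t2 := htime X hX X' hX' (by rw [hX'def]; abel)
  have hHr : H * ‖r • p‖ * ‖p‖ = H * r := by
    rw [norm_smul, hp, Real.norm_of_nonneg hr.1.le]; ring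
  have k1 := key X hX (r • p) p (by rw [← e3]; exact hmem X hX hXp r hrI)
  have k2 := key X' hX' (r • p) p (by rw [← e3]; exact hmem X' hX' hXp' r hrI)
  rw [hHr] at k1 k2
  rw [eq_div_iff (by linarith), e1, e2, e3, e3] at hr'
  simp only [sub_zero, zero_smul, add_zero] at hr'
  have hH : 0 ≤ H := by
    have := (abs_nonneg _).trans (h2 X hX p p)
    rw [hp] at this; linarith
  rw [abs_le] at *
  have hrs : H * r ≤ H * s := by gcongr; exact hr.2.le
  set D1 := fderiv ℝ V (X' + (0, r • p)) (0, p) - fderiv ℝ V (X + (0, r • p)) (0, p) with hD1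
  have m1 : D1 ≤ 2 * ε * s := by
    by_contra! h
    nlinarith [t1.1, t1.2, t2.1, t2.2]
  have m2 : -(2 * ε * s) ≤ D1 := by
    by_contra! h
    nlinarith [t1.1, t1.2, t2.1, t2.2]
  constructor <;> linarith [k1.1, k1.2, k2.1, k2.2]

end TimeOscillation

section Step

variable {Z : Type*} [NormedAddCommGroup Z] [InnerProductSpace ℝ Z] [FiniteDimensional ℝ Z]
  [MeasurableSpace Z] [BorelSpace Z]
  {E : Type*} [NormedAddCommGroup E] [NormedSpace ℝ E] [FiniteDimensional ℝ E]

theorem integral_gaussWeight_pos : 0 < ∫ z : Z, gaussWeight z := by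
  have hK0 : Integrable (fun z : Z => gaussWeight z) := by
    simpa using ((PolyGrowth.const (Z := Z) 1).mono (by norm_num : 0 ≤ 4)).integrable
  rw [integral_pos_iff_support_of_nonneg (fun z => (gaussWeight_pos z).le) hK0]
  have : Function.support (fun z : Z => gaussWeight z) = univ := by
    ext z; simp [(gaussWeight_pos z).ne']
  rw [this]
  exact isOpen_univ.measure_pos volume univ_nonempty

theorem abs_apply_le_of_abs_apply_self_le {Y : Type*} [NormedAddCommGroup Y] [NormedSpace ℝ Y]
    {Q : Y →L[ℝ] Y →L[ℝ] ℝ} (hQ : ∀ p q, Q p q = Q q p) {S : Z →L[ℝ] Y} {K : ℝ}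
    (h : ∀ c, |Q (S c) (S c)| ≤ K * ‖c‖ ^ 2) (c c' : Z) :
    |Q (S c) (S c')| ≤ K * ‖c‖ * ‖c'‖ := by
  have key : ∀ c c' : Z, |Q (S c) (S c')| ≤ K * (‖c‖ ^ 2 + ‖c'‖ ^ 2) / 2 := by
    intro c c'
    have e : 4 * Q (S c) (S c') = Q (S (c + c')) (S (c + c')) - Q (S (c - c')) (S (c - c')) := by
      simp [hQ (S c') (S c)]; ring
    have h1 := h (c + c')
    have h2 := h (c - c')
    have h3 := parallelogram_law_with_norm ℝ c c'
    have h4 : K * ‖c + c'‖ ^ 2 + K * ‖c - c'‖ ^ 2 = K * (2 * (‖c‖ ^ 2 + ‖c'‖ ^ 2)) := by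
      rw [← mul_add, h3]
    rw [abs_le] at *
    constructor <;> linarith [h1.1, h1.2, h2.1, h2.2]
  rcases eq_or_ne c 0 with rfl | hc
  · simp
  rcases eq_or_ne c' 0 with rfl | hc'
  · simp
  have h1 := norm_pos_iff.2 hc
  have h2 := norm_pos_iff.2 hc'
  have := key (‖c'‖ • c) (‖c‖ • c')
  simp only [map_smul, smul_apply, smul_eq_mul, norm_smul, norm_norm,
    abs_mul, abs_norm] at this
  have h3 : (‖c‖ * ‖c'‖) * |Q (S c) (S c')| ≤ (‖c‖ * ‖c'‖) * (K * ‖c‖ * ‖c'‖) := by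
    linarith
  exact le_of_mul_le_mul_left h3 (by positivity)

theorem contDiff_mul_of_tsupport_subset {Y : Type*} [NormedAddCommGroup Y] [NormedSpace ℝ Y]
    {φ V : Y → ℝ} {U : Set Y} (hU : IsOpen U) (hφ : ContDiff ℝ 2 φ) (hV : ContDiffOn ℝ 2 V U)
    (hs : tsupport φ ⊆ U) : ContDiff ℝ 2 (fun X => φ X * V X) := by
  rw [contDiff_iff_contDiffAt]
  intro X
  by_cases hX : X ∈ U
  · exact hφ.contDiffAt.mul (hV.contDiffAt (hU.mem_nhds hX))
  · have h0 : φ =ᶠ[nhds X] 0 := notMem_tsupport_iff_eventuallyEq.1 fun h => hX (hs h)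
    have : (fun X => φ X * V X) =ᶠ[nhds X] fun _ => 0 := by
      filter_upwards [h0] with X' h; simp [h]
    exact contDiffAt_const.congr_of_eventuallyEq this

/-- Data of a linear parabolic equation on a ball, together with the bounds used for the interior
estimate of the Hessian at the centre. -/
structure ParabolicBounds (ι : Type*) [Fintype ι] (Z : Type*) [NormedAddCommGroup Z]
    [InnerProductSpace ℝ Z] {E : Type*} [NormedAddCommGroup E] [NormedSpace ℝ E]
    (Λ : ℝ) (A : ℝ × E → (E → E → ℝ) → ℝ) (b : ℝ × E → E) (F V : ℝ × E → ℝ)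
    (X₀ : ℝ × E) (ρ ε H : ℝ) : Prop where
  contDiffOn : ContDiffOn ℝ 2 V (Metric.ball X₀ (3 * ρ))
  abs_le : ∀ X ∈ Metric.ball X₀ (3 * ρ), |V X| ≤ ε
  norm_fderiv_le : ∀ X ∈ Metric.ball X₀ (3 * ρ), ‖fderiv ℝ V X‖ ≤ ε
  hessian_le : ∀ X ∈ Metric.ball X₀ (3 * ρ), ∀ p q : E,
    |fderiv ℝ (fderiv ℝ V) X (0, p) (0, q)| ≤ H * ‖p‖ * ‖q‖
  equation : ∀ X ∈ Metric.ball X₀ (3 * ρ), fderiv ℝ V X (1, 0) =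
    A X (fun p q => fderiv ℝ (fderiv ℝ V) X (0, p) (0, q)) + fderiv ℝ V X (0, b X) + F X
  frozen : ∃ (e : OrthonormalBasis ι ℝ Z) (S : Z →L[ℝ] E) (T : E → Z), (∀ p, S (T p) = p) ∧
    ‖S‖ ≤ Λ ∧ (∀ p, ‖T p‖ ≤ Λ * ‖p‖) ∧ ∀ B : (ℝ × E) →L[ℝ] (ℝ × E) →L[ℝ] ℝ,
      A X₀ (fun p q => B (0, p) (0, q)) = ∑ k, B (0, S (e k)) (0, S (e k))
  lipschitz : ∀ X ∈ Metric.ball X₀ (3 * ρ), ∀ (Q : E → E → ℝ) (K : ℝ), 0 ≤ K →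
    (∀ p q, |Q p q| ≤ K * ‖p‖ * ‖q‖) → |A X Q - A X₀ Q| ≤ Λ * ‖X - X₀‖ * K
  norm_drift_le : ‖b X₀‖ ≤ Λ
  drift_lipschitz : ∀ X ∈ Metric.ball X₀ (3 * ρ), ‖b X - b X₀‖ ≤ Λ * ‖X - X₀‖
  abs_source_le : |F X₀| ≤ ε
  source_lipschitz : ∀ X ∈ Metric.ball X₀ (3 * ρ), |F X - F X₀| ≤ ε * ‖X - X₀‖

end Step

section Step

variable {ι : Type*} [Fintype ι] {Z : Type*} [NormedAddCommGroup Z] [InnerProductSpace ℝ Z]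
  [FiniteDimensional ℝ Z] [MeasurableSpace Z] [BorelSpace Z]
  {E : Type*} [NormedAddCommGroup E] [NormedSpace ℝ E] [FiniteDimensional ℝ E]

theorem ParabolicBounds.abs_lower_order_sub_le {Λ : ℝ} {A : ℝ × E → (E → E → ℝ) → ℝ}
    {b : ℝ × E → E} {F V : ℝ × E → ℝ} {X₀ : ℝ × E} {ρ ε H : ℝ} (hΛ : 0 ≤ Λ) (hρ : 0 < ρ)
    (hρ1 : ρ ≤ 1) (hε : 0 ≤ ε) (hH : 0 ≤ H) (h : ParabolicBounds ι Z Λ A b F V X₀ ρ ε H)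
    {s : ℝ} (hs : 0 < s) (hsρ : s ≤ ρ) {v : E} {ζ : ℝ} (hζ : 1 ≤ ζ) (hv : ‖v‖ ≤ s * (Λ * ζ))
    (hX : X₀ - s ^ 2 • ((1 : ℝ), (0 : E)) + (0, v) ∈ Metric.ball X₀ (3 * ρ))
    (hD : ‖X₀ - s ^ 2 • ((1 : ℝ), (0 : E)) + (0, v) - X₀‖ ≤ (1 + Λ) * (s * ζ)) :
    |fderiv ℝ V (X₀ - s ^ 2 • ((1 : ℝ), (0 : E)) + (0, v))
        (0, b (X₀ - s ^ 2 • ((1 : ℝ), (0 : E)) + (0, v)))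
      + F (X₀ - s ^ 2 • ((1 : ℝ), (0 : E)) + (0, v)) - (fderiv ℝ V X₀ (0, b X₀) + F X₀)|
      ≤ ((1 + Λ) ^ 2 + (2 + Λ) * Λ) * (ε + H) * (s * ζ) := by
  set U := Metric.ball X₀ (3 * ρ) with hU
  set X₁ := X₀ - s ^ 2 • ((1 : ℝ), (0 : E)) with hX₁
  set X := X₁ + (0, v) with hXdef
  have hX0 : X₀ ∈ U := Metric.mem_ball_self (by positivity)
  have hs2 : s ^ 2 ≤ s := by nlinarith
  obtain ⟨k1, k2⟩ := abs_fderiv_sub_le (convex_ball X₀ (3 * ρ)) Metric.isOpen_ball h.contDiffOn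
    h.norm_fderiv_le h.hessian_le
  have n1 : ‖s ^ 2 • ((1 : ℝ), (0 : E))‖ ≤ s := by
    rw [norm_smul]; simpa using hs2
  have hX1 : X₁ ∈ U := by
    rw [hU, mem_ball_iff_norm, hX₁, sub_sub_cancel_left, norm_neg]; linarith
  have hgrad : ∀ p : E, |fderiv ℝ V X (0, p) - fderiv ℝ V X₀ (0, p)|
      ≤ (2 + Λ) * (ε + H) * (s * ζ) * ‖p‖ := by
    have hunit : ∀ p : E, ‖p‖ = 1 → |fderiv ℝ V X (0, p) - fderiv ℝ V X₀ (0, p)|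
        ≤ (2 + Λ) * (ε + H) * (s * ζ) := by
      intro p hp
      have np : ‖((0 : ℝ), s • p)‖ ≤ s := by
        simp [Prod.norm_def, norm_smul, hp, abs_of_pos hs, hs.le]
      have a1 := k2 X₀ hX0 s hs hX1 p hp
        (by rw [mem_ball_iff_norm, add_sub_cancel_left]; linarith)
        (by
          rw [mem_ball_iff_norm]
          have : X₀ - s ^ 2 • ((1 : ℝ), (0 : E)) + (0, s • p) - X₀
            = (0, s • p) - s ^ 2 • ((1 : ℝ), (0 : E)) := by abel
          rw [this]
          have := norm_sub_le ((0 : ℝ), s • p) (s ^ 2 • ((1 : ℝ), (0 : E)))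
          linarith)
      have a2 := k1 X₁ hX1 v p hX
      rw [hp, mul_one] at a2
      have a3 : H * ‖v‖ ≤ H * (s * (Λ * ζ)) := by gcongr
      have a4 : 2 * (ε + H) * s ≤ 2 * (ε + H) * (s * ζ) := by
        have : s ≤ s * ζ := by nlinarith
        gcongr
      have a5 : H * (s * (Λ * ζ)) ≤ (ε + H) * (s * (Λ * ζ)) := by gcongr; linarith
      have := abs_sub_le (fderiv ℝ V X (0, p)) (fderiv ℝ V X₁ (0, p)) (fderiv ℝ V X₀ (0, p))
      linarith
    intro p
    rcases eq_or_ne p 0 with rfl | hp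
    · rw [Prod.mk_zero_zero, map_zero, map_zero]; simp
    have hp' := norm_pos_iff.2 hp
    have := hunit (‖p‖⁻¹ • p) (by rw [norm_smul, norm_inv, norm_norm, inv_mul_cancel₀ hp'.ne'])
    have e : ((0 : ℝ), p) = ‖p‖ • ((0 : ℝ), ‖p‖⁻¹ • p) := by
      ext <;> simp [smul_smul, hp'.ne']
    rw [e, map_smul, map_smul, ← smul_sub, smul_eq_mul, abs_mul, abs_norm, mul_comm]
    gcongr
  have e : fderiv ℝ V X (0, b X) + F X - (fderiv ℝ V X₀ (0, b X₀) + F X₀)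
      = fderiv ℝ V X (0, b X - b X₀) + (fderiv ℝ V X (0, b X₀) - fderiv ℝ V X₀ (0, b X₀))
        + (F X - F X₀) := by
    have : ((0 : ℝ), b X) = (0, b X - b X₀) + (0, b X₀) := by ext <;> simp
    rw [this, map_add]; ring
  have b1 : |fderiv ℝ V X (0, b X - b X₀)| ≤ ε * (Λ * ((1 + Λ) * (s * ζ))) := by
    refine ((fderiv ℝ V X).le_opNorm _).trans ?_
    have : ‖((0 : ℝ), b X - b X₀)‖ ≤ Λ * ((1 + Λ) * (s * ζ)) := by
      have := h.drift_lipschitz X hX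
      have h2 : Λ * ‖X - X₀‖ ≤ Λ * ((1 + Λ) * (s * ζ)) := by gcongr
      simp only [Prod.norm_def, norm_zero]
      exact max_le (by positivity) (this.trans h2)
    gcongr
    exact h.norm_fderiv_le X hX
  have b2 : |fderiv ℝ V X (0, b X₀) - fderiv ℝ V X₀ (0, b X₀)|
      ≤ (2 + Λ) * (ε + H) * (s * ζ) * Λ := (hgrad _).trans (by
        have := h.norm_drift_le
        gcongr)
  have b3 : |F X - F X₀| ≤ ε * ((1 + Λ) * (s * ζ)) := (h.source_lipschitz X hX).trans (by gcongr)
  rw [e]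
  have c1 := abs_add_le (fderiv ℝ V X (0, b X - b X₀) + (fderiv ℝ V X (0, b X₀) -
    fderiv ℝ V X₀ (0, b X₀))) (F X - F X₀)
  have c2 := abs_add_le (fderiv ℝ V X (0, b X - b X₀)) (fderiv ℝ V X (0, b X₀) -
    fderiv ℝ V X₀ (0, b X₀))
  have c3 : (1 + Λ) ^ 2 * ε * (s * ζ) ≤ (1 + Λ) ^ 2 * (ε + H) * (s * ζ) := by
    gcongr; linarith
  linarith

theorem exists_bound_fderiv_of_hasCompactSupport {Y G : Type*} [NormedAddCommGroup Y]
    [NormedSpace ℝ Y] [NormedAddCommGroup G] [NormedSpace ℝ G] {w : Y → G} (hw : ContDiff ℝ 1 w)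
    (hs : HasCompactSupport w) : ∃ D, ∀ X, ‖fderiv ℝ w X‖ ≤ D :=
  (hs.fderiv ℝ).exists_bound_of_continuous (hw.continuous_fderiv one_ne_zero)

theorem exists_bound_two_of_hasCompactSupport {Y : Type*} [NormedAddCommGroup Y] [NormedSpace ℝ Y]
    {w : Y → ℝ} (hw : ContDiff ℝ 2 w) (hs : HasCompactSupport w) :
    ∃ D, (∀ X, |w X| ≤ D) ∧ (∀ X, ‖fderiv ℝ w X‖ ≤ D) ∧ ∀ X, ‖fderiv ℝ (fderiv ℝ w) X‖ ≤ D := by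
  obtain ⟨D0, hD0⟩ := hs.exists_bound_of_continuous hw.continuous
  obtain ⟨D1, hD1⟩ := exists_bound_fderiv_of_hasCompactSupport (hw.of_le (by norm_num)) hs
  have hc1 : ContDiff ℝ 1 (fderiv ℝ w) := hw.fderiv_right (by norm_num)
  obtain ⟨D2, hD2⟩ := exists_bound_fderiv_of_hasCompactSupport hc1 (hs.fderiv ℝ)
  exact ⟨max D0 (max D1 D2), fun X => (hD0 X).trans (le_max_left _ _),
    fun X => (hD1 X).trans ((le_max_left _ _).trans (le_max_right _ _)),
    fun X => (hD2 X).trans ((le_max_right _ _).trans (le_max_right _ _))⟩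

set_option maxHeartbeats 1600000 in
theorem exists_hessian_step {Λ : ℝ} (hΛ : 0 ≤ Λ) : ∃ C, 0 ≤ C ∧
    ∀ (A : ℝ × E → (E → E → ℝ) → ℝ) (b : ℝ × E → E) (F V : ℝ × E → ℝ) (X₀ : ℝ × E)
      (ρ ε H : ℝ), 0 < ρ → ρ ≤ 1 → 0 ≤ ε → 0 ≤ H → ParabolicBounds ι Z Λ A b F V X₀ ρ ε H →
      ∀ p q : E, |fderiv ℝ (fderiv ℝ V) X₀ (0, p) (0, q)|
        ≤ C * (ε * ρ⁻¹ ^ 2 + ρ * H) * ‖p‖ * ‖q‖ := by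
  obtain ⟨K, hK, hcut⟩ := exists_scaled_cutoff (Y := ℝ × E)
  set N : ℝ := (Fintype.card ι : ℝ)
  have hN : 0 ≤ N := Nat.cast_nonneg _
  set g₀ : ℝ := ∫ z : Z, gaussWeight z with hg₀
  have hg : 0 < g₀ := integral_gaussWeight_pos
  set I : ℝ := ∫ z : Z, gaussWeight z * (1 + ‖z‖) ^ 3 with hI
  have hI0 : 0 ≤ I := integral_nonneg fun z => mul_nonneg (gaussWeight_pos z).le (by positivity)
  set L := 1 + Λ with hL
  have hL1 : 1 ≤ L := by linarith
  set C₁ : ℝ := Λ * L + (L ^ 2 + (2 + Λ) * Λ) + K * L ^ 2 + K * L + N * K * L * Λ ^ 2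
    + 2 * N * K * L * Λ ^ 2 + L ^ 2 with hC₁
  have hC₁0 : 0 ≤ C₁ := by positivity
  refine ⟨Λ ^ 2 * (I / g₀ * (1 + 2 * C₁)), by positivity, ?_⟩
  intro A b F V X₀ ρ ε H hρ hρ1 hε hH h
  obtain ⟨φ, hφ, hφs, hφ1, hφe, hφb⟩ := hcut X₀ ρ hρ
  obtain ⟨e, S, T, hST, hSn, hTn, hA₀⟩ := h.frozen
  set R := ρ⁻¹ with hR
  have hR1 : 1 ≤ R := (one_le_inv₀ hρ).2 hρ1
  set St : Z →L[ℝ] ℝ × E := (ContinuousLinearMap.inr ℝ ℝ E).comp S with hSt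
  have hStz : ∀ z, St z = (0, S z) := fun z => rfl
  set w : ℝ × E → ℝ := fun X => φ X * V X with hw
  have hsub : Metric.ball X₀ ρ ⊆ Metric.ball X₀ (3 * ρ) :=
    Metric.ball_subset_ball (by linarith)
  have hX0 : X₀ ∈ Metric.ball X₀ (3 * ρ) := Metric.mem_ball_self (by positivity)
  have hwc : ContDiff ℝ 2 w :=
    contDiff_mul_of_tsupport_subset Metric.isOpen_ball hφ (h.contDiffOn.mono hsub) hφs
  have hφc : HasCompactSupport φ := HasCompactSupport.intro' (isCompact_closedBall X₀ ρ)
    Metric.isClosed_closedBall fun X hX => image_eq_zero_of_notMem_tsupport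
      fun h => hX (Metric.ball_subset_closedBall (hφs h))
  have hwcs : HasCompactSupport w := hφc.mul_right
  obtain ⟨D, hD0, hD1, hD2⟩ := exists_bound_two_of_hasCompactSupport hwc hwcs
  have hwB : ∀ X, |w X| ≤ ε := by
    intro X
    by_cases hX : X ∈ Metric.ball X₀ ρ
    · have h1 := h.abs_le X (hsub hX)
      rw [hw]; simp only; rw [abs_mul]
      calc |φ X| * |V X| ≤ 1 * ε := by gcongr; exact hφ1 X
        _ = ε := one_mul _
    · have : φ X = 0 := image_eq_zero_of_notMem_tsupport fun h => hX (hφs h)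
      simp [hw, this, hε]
  set f₀ := fderiv ℝ V X₀ (0, b X₀) + F X₀ with hf₀
  have hf₀b : |f₀| ≤ L * ε := by
    have h1 := abs_add_le (fderiv ℝ V X₀ (0, b X₀)) (F X₀)
    have h2 := (fderiv ℝ V X₀).le_opNorm (0, b X₀)
    have h3 : ‖((0 : ℝ), b X₀)‖ ≤ Λ := by
      simp only [Prod.norm_def, norm_zero]; exact max_le hΛ h.norm_drift_le
    have h4 : ‖fderiv ℝ V X₀‖ * ‖((0 : ℝ), b X₀)‖ ≤ ε * Λ := by
      gcongr; exact h.norm_fderiv_le X₀ hX0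
    rw [Real.norm_eq_abs] at h2
    rw [hL]; linarith [h.abs_source_le]
  have hM : ∀ s, 0 < s → s ≤ ρ → ∀ z : Z, |fderiv ℝ w (parabolicPoint X₀ (1, 0) St s z) (1, 0)
      - ∑ k, fderiv ℝ (fderiv ℝ w) (parabolicPoint X₀ (1, 0) St s z) (St (e k)) (St (e k)) - f₀|
        ≤ C₁ * (R ^ 3 * ε + H) * s * (1 + ‖z‖) := by
    intro s hs hsρ z
    have hXe : parabolicPoint X₀ (1, 0) St s z
        = X₀ - s ^ 2 • ((1 : ℝ), (0 : E)) + (0, s • S z) := by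
      rw [parabolicPoint, hStz]; simp
    rw [hXe]
    set ζ := 1 + ‖z‖ with hζ
    have hζ1 : 1 ≤ ζ := by linarith [norm_nonneg z]
    have hv : ‖s • S z‖ ≤ s * (Λ * ζ) := by
      rw [norm_smul, Real.norm_of_nonneg hs.le]
      gcongr
      refine (S.le_opNorm z).trans ?_
      gcongr
      linarith
    have hs2 : s ^ 2 ≤ s := by nlinarith
    have hD : ‖X₀ - s ^ 2 • ((1 : ℝ), (0 : E)) + (0, s • S z) - X₀‖ ≤ L * (s * ζ) := by
      have e1 : X₀ - s ^ 2 • ((1 : ℝ), (0 : E)) + (0, s • S z) - X₀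
        = (0, s • S z) - s ^ 2 • ((1 : ℝ), (0 : E)) := by abel
      have n1 : ‖s ^ 2 • ((1 : ℝ), (0 : E))‖ ≤ s := by rw [norm_smul]; simpa using hs2
      have n2 : ‖((0 : ℝ), s • S z)‖ ≤ s * (Λ * ζ) := by
        simp only [Prod.norm_def, norm_zero]; exact max_le (by positivity) hv
      have n3 := norm_sub_le ((0 : ℝ), s • S z) (s ^ 2 • ((1 : ℝ), (0 : E)))
      have n4 : s ≤ s * ζ := by nlinarith
      rw [e1, hL]; linarith
    have hlow := fun hX => h.abs_lower_order_sub_le hΛ hρ hρ1 hε hH hs hsρ hζ1 hv hX hD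
    set X := X₀ - s ^ 2 • ((1 : ℝ), (0 : E)) + (0, s • S z) with hXdef
    have hP : 0 < s * ζ := by positivity
    set P := s * ζ with hPdef
    have hR0 : 0 < R := by positivity
    have hR2 : R ≤ R ^ 3 := by nlinarith [mul_le_mul hR1 hR1 zero_le_one hR0.le]
    have hR3 : R ^ 2 ≤ R ^ 3 := by nlinarith [mul_le_mul hR1 hR1 zero_le_one hR0.le]
    have hR4 : 1 ≤ R ^ 3 := hR1.trans hR2
    by_cases hX : X ∈ Metric.ball X₀ ρ
    · have hX3 := hsub hX
      obtain ⟨q1, q2⟩ := fderiv_mul_apply_apply hφ.contDiffAt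
        (h.contDiffOn.contDiffAt (Metric.isOpen_ball.mem_nhds hX3))
      obtain ⟨f1, f2, f3⟩ := hφb X
      have hSk : ∀ k, ‖St (e k)‖ ≤ Λ := fun k => by
        rw [hStz]
        simp only [Prod.norm_def, norm_zero]
        refine max_le hΛ ((S.le_opNorm _).trans ?_)
        rw [e.orthonormal.1 k, mul_one]; exact hSn
      set Q : E → E → ℝ := fun p q => fderiv ℝ (fderiv ℝ V) X (0, p) (0, q) with hQ
      have hdec : fderiv ℝ w X (1, 0)
          - ∑ k, fderiv ℝ (fderiv ℝ w) X (St (e k)) (St (e k)) - f₀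
          = φ X * (A X Q - A X₀ Q) + φ X * (fderiv ℝ V X (0, b X) + F X - f₀) + (φ X - 1) * f₀
            + V X * fderiv ℝ φ X (1, 0)
            - V X * ∑ k, fderiv ℝ (fderiv ℝ φ) X (St (e k)) (St (e k))
            - 2 * ∑ k, fderiv ℝ φ X (St (e k)) * fderiv ℝ V X (St (e k)) := by
        rw [q1, h.equation X hX3, hA₀ (fderiv ℝ (fderiv ℝ V) X)]
        simp_rw [hw, q2, Finset.sum_add_distrib, ← hStz, Finset.mul_sum]
        have : ∑ k, fderiv ℝ V X (St (e k)) * fderiv ℝ φ X (St (e k))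
          = ∑ k, fderiv ℝ φ X (St (e k)) * fderiv ℝ V X (St (e k)) :=
          Finset.sum_congr rfl fun k _ => mul_comm _ _
        rw [this, ← Finset.mul_sum, ← Finset.mul_sum, ← Finset.mul_sum]
        ring
      have t1 : |φ X * (A X Q - A X₀ Q)| ≤ 1 * (Λ * (L * P) * H) := by
        rw [abs_mul]
        gcongr
        · exact hφ1 X
        · refine (h.lipschitz X hX3 Q H hH (h.hessian_le X hX3)).trans ?_
          gcongr
      have t2 : |φ X * (fderiv ℝ V X (0, b X) + F X - f₀)|
          ≤ 1 * ((L ^ 2 + (2 + Λ) * Λ) * (ε + H) * P) := by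
        rw [abs_mul]
        gcongr
        · exact hφ1 X
        · exact hlow hX3
      have t3 : |(φ X - 1) * f₀| ≤ K * R * (L * P) * (L * ε) := by
        rw [abs_mul]
        gcongr
        exact f1.trans (by gcongr)
      have t4 : |V X * fderiv ℝ φ X (1, 0)| ≤ ε * (K * R ^ 2 * (L * P)) := by
        rw [abs_mul]
        gcongr
        · exact h.abs_le X hX3
        · refine ((fderiv ℝ φ X).le_opNorm _).trans ?_
          have : ‖((1 : ℝ), (0 : E))‖ = 1 := by simp [Prod.norm_def]
          rw [this, mul_one]
          exact f2.trans (by gcongr)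
      have t5 : |V X * ∑ k, fderiv ℝ (fderiv ℝ φ) X (St (e k)) (St (e k))|
          ≤ ε * (N * (K * R ^ 3 * (L * P) * Λ * Λ)) := by
        rw [abs_mul]
        gcongr
        · exact h.abs_le X hX3
        · refine (Finset.abs_sum_le_sum_abs _ _).trans ((Finset.sum_le_card_nsmul _ _
            (K * R ^ 3 * (L * P) * Λ * Λ) fun k _ => (f3 _ _).trans ?_).trans_eq ?_)
          · gcongr <;> exact hSk k
          · simp [N]
      have t6 : |2 * ∑ k, fderiv ℝ φ X (St (e k)) * fderiv ℝ V X (St (e k))|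
          ≤ 2 * (N * (K * R ^ 2 * (L * P) * Λ * (ε * Λ))) := by
        rw [abs_mul, abs_two]
        gcongr
        refine (Finset.abs_sum_le_sum_abs _ _).trans ((Finset.sum_le_card_nsmul _ _
            (K * R ^ 2 * (L * P) * Λ * (ε * Λ)) fun k _ => ?_).trans_eq ?_)
        · rw [abs_mul]
          gcongr
          · exact ((fderiv ℝ φ X).le_opNorm _).trans (mul_le_mul (f2.trans (by gcongr)) (hSk k)
              (norm_nonneg _) (by positivity))
          · exact ((fderiv ℝ V X).le_opNorm _).trans (mul_le_mul (h.norm_fderiv_le X hX3) (hSk k)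
              (norm_nonneg _) hε)
        · simp [N]
      have hε3 : ε ≤ R ^ 3 * ε := by nlinarith
      have hε1 : R * ε ≤ R ^ 3 * ε := by gcongr
      have hε2 : R ^ 2 * ε ≤ R ^ 3 * ε := by gcongr
      set G := R ^ 3 * ε + H with hG
      have hRε : 0 ≤ R ^ 3 * ε := by positivity
      have u1 : 1 * (Λ * (L * P) * H) ≤ Λ * L * G * P := by
        have : Λ * L * P * H ≤ Λ * L * P * G := by gcongr; linarith
        linarith
      have u2 : 1 * ((L ^ 2 + (2 + Λ) * Λ) * (ε + H) * P) ≤ (L ^ 2 + (2 + Λ) * Λ) * G * P := by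
        rw [one_mul]; gcongr; linarith
      have u3 : K * R * (L * P) * (L * ε) ≤ K * L ^ 2 * G * P := by
        have : K * L ^ 2 * P * (R * ε) ≤ K * L ^ 2 * P * G := by gcongr; linarith
        linarith
      have u4 : ε * (K * R ^ 2 * (L * P)) ≤ K * L * G * P := by
        have : K * L * P * (R ^ 2 * ε) ≤ K * L * P * G := by gcongr; linarith
        linarith
      have u5 : ε * (N * (K * R ^ 3 * (L * P) * Λ * Λ)) ≤ N * K * L * Λ ^ 2 * G * P := by
        have : N * K * L * Λ ^ 2 * P * (R ^ 3 * ε) ≤ N * K * L * Λ ^ 2 * P * G := by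
          gcongr; linarith
        linarith
      have u6 : 2 * (N * (K * R ^ 2 * (L * P) * Λ * (ε * Λ)))
          ≤ 2 * N * K * L * Λ ^ 2 * G * P := by
        have : 2 * N * K * L * Λ ^ 2 * P * (R ^ 2 * ε) ≤ 2 * N * K * L * Λ ^ 2 * P * G := by
          gcongr; linarith
        linarith
      have hG0 : 0 ≤ G := by positivity
      have u7 : 0 ≤ L ^ 2 * G * P := by positivity
      rw [hdec, mul_assoc, ← hPdef]
      have htot : C₁ * G * P = Λ * L * G * P + (L ^ 2 + (2 + Λ) * Λ) * G * P + K * L ^ 2 * G * P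
          + K * L * G * P + N * K * L * Λ ^ 2 * G * P + 2 * N * K * L * Λ ^ 2 * G * P
          + L ^ 2 * G * P := by rw [hC₁]; ring
      rw [htot]
      rw [abs_le] at t1 t2 t3 t4 t5 t6 ⊢
      constructor <;> linarith [t1.1, t2.1, t3.1, t4.1, t5.1, t6.1, t1.2, t2.2, t3.2, t4.2,
        t5.2, t6.2]
    · have hw0 : w =ᶠ[nhds X] fun _ => 0 := by
        have : φ =ᶠ[nhds X] 0 := notMem_tsupport_iff_eventuallyEq.1 fun h => hX (hφs h)
        filter_upwards [this] with X' h; simp [hw, h]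
      have hw1 : fderiv ℝ w =ᶠ[nhds X] fun _ => 0 :=
        hw0.fderiv.trans (Filter.Eventually.of_forall fun X => fderiv_const_apply 0)
      have hw2 : fderiv ℝ (fderiv ℝ w) X = 0 := by
        rw [hw1.fderiv_eq]; exact fderiv_const_apply 0
      rw [hw1.self_of_nhds, hw2]
      have hd : ρ ≤ L * P := by
        rw [mem_ball_iff_norm, not_lt] at hX
        exact hX.trans hD
      have hd1 : 1 ≤ R * (L * P) := by
        rw [hR, le_inv_mul_iff₀ hρ]; linarith
      simp only [zero_apply, Finset.sum_const_zero, sub_zero, zero_sub, abs_neg]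
      have u1 : L * ε ≤ L * ε * (R * (L * P)) := le_mul_of_one_le_right (by positivity) hd1
      have u2 : L ^ 2 * P * (R * ε) ≤ L ^ 2 * P * (R ^ 3 * ε + H) := by
        have : R * ε ≤ R ^ 3 * ε := by gcongr
        gcongr; linarith
      have u3 : L ^ 2 * P * (R ^ 3 * ε + H) ≤ C₁ * P * (R ^ 3 * ε + H) := by
        have : L ^ 2 ≤ C₁ := by
          have : 0 ≤ Λ * L + (L ^ 2 + (2 + Λ) * Λ) + K * L ^ 2 + K * L + N * K * L * Λ ^ 2
            + 2 * N * K * L * Λ ^ 2 := by positivity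
          linarith
        gcongr
      rw [mul_assoc, ← hPdef]
      linarith
  have hfin := fun c => gauss_hessian_bound e hwc (C := D)
    hD0 hD1 hD2 X₀ (1, 0) St c hρ
    hwB hM
  have hwV : w =ᶠ[nhds X₀] V := by
    filter_upwards [hφe] with X hX; simp [hw, hX]
  rw [hwV.fderiv.fderiv_eq] at hfin
  set B := fderiv ℝ (fderiv ℝ V) X₀ with hBdef
  have hsymm : ∀ p q, B p q = B q p := fun p q =>
    ((h.contDiffOn.contDiffAt (Metric.isOpen_ball.mem_nhds hX0)).isSymmSndFDerivAt (by simp)) p q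
  set G := ε * R ^ 2 + ρ * H with hG
  have hG0 : 0 ≤ G := by positivity
  have hquad : ∀ c, |B (St c) (St c)| ≤ (I / g₀ * (1 + 2 * C₁) * G) * ‖c‖ ^ 2 := by
    intro c
    have h1 := hfin c
    have h2 : ε / ρ ^ 2 + 2 * (C₁ * (R ^ 3 * ε + H)) * ρ ≤ (1 + 2 * C₁) * G := by
      have e1 : ε / ρ ^ 2 = ε * R ^ 2 := by rw [hR]; field_simp
      have e2 : R ^ 3 * ρ = R ^ 2 := by rw [hR]; field_simp
      have e3 : 2 * (C₁ * (R ^ 3 * ε + H)) * ρ = 2 * C₁ * G := by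
        rw [hG, ← e2]; ring
      have e4 : ε * R ^ 2 ≤ G := by rw [hG]; linarith [mul_nonneg hρ.le hH]
      rw [e1, e3]; linarith
    have h3 : g₀ * |B (St c) (St c)| ≤ ‖c‖ ^ 2 * I * ((1 + 2 * C₁) * G) :=
      h1.trans (by gcongr)
    rw [← le_div_iff₀' hg] at h3
    refine h3.trans_eq ?_
    field_simp
  intro p q
  have h1 := abs_apply_le_of_abs_apply_self_le hsymm hquad (T p) (T q)
  rw [hStz, hStz, hST, hST] at h1
  refine h1.trans ?_
  calc I / g₀ * (1 + 2 * C₁) * G * ‖T p‖ * ‖T q‖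
      ≤ I / g₀ * (1 + 2 * C₁) * G * (Λ * ‖p‖) * (Λ * ‖q‖) := by
        gcongr <;> apply hTn
    _ = _ := by ring

end Step

theorem exists_absorption_bound {C R : ℝ} (hC : 0 ≤ C) (hR : 0 < R) (hR1 : R ≤ 1) :
    ∃ C', 0 ≤ C' ∧ ∀ {Y : Type*} [PseudoMetricSpace Y] [ProperSpace Y] (c : Y) (g : Y → ℝ) (ε : ℝ),
      0 ≤ ε → ContinuousOn g (Metric.closedBall c R) → (∀ x, 0 ≤ g x) →
      (∀ x ρ H, 0 < ρ → ρ ≤ 1 → 0 ≤ H → Metric.ball x (3 * ρ) ⊆ Metric.closedBall c R →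
        (∀ x' ∈ Metric.ball x (3 * ρ), g x' ≤ H) → g x ≤ C * (ε * ρ⁻¹ ^ 2 + ρ * H)) →
      ∀ x ∈ Metric.closedBall c (R / 2), g x ≤ C' * ε := by
  set κ : ℝ := (8 * (C + 1))⁻¹ with hκ
  have hκ0 : 0 < κ := by positivity
  have hκ8 : κ ≤ 1 / 8 := by
    rw [hκ, inv_eq_one_div]; exact one_div_le_one_div_of_le (by norm_num) (by linarith)
  have hκC : C * κ ≤ 1 / 8 := by
    rw [hκ, ← div_eq_mul_inv, div_le_div_iff₀ (by positivity) (by norm_num)]; linarith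
  refine ⟨4 / R ^ 2 * (2 * C * κ⁻¹ ^ 2), by positivity, ?_⟩
  intro Y _ _ c g ε hε hg hg0 hstep x hx
  have hcont : ContinuousOn (fun x => (R - dist x c) ^ 2 * g x) (Metric.closedBall c R) :=
    ContinuousOn.mul (by fun_prop) hg
  obtain ⟨z, hz, hmax⟩ := (isCompact_closedBall c R).exists_isMaxOn
    ⟨c, Metric.mem_closedBall_self hR.le⟩ hcont
  set M := (R - dist z c) ^ 2 * g z with hM
  have hM0 : 0 ≤ M := mul_nonneg (sq_nonneg _) (hg0 z)
  have hmax' : ∀ x' ∈ Metric.closedBall c R, (R - dist x' c) ^ 2 * g x' ≤ M :=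
    fun x' hx' => hmax hx'
  have key : M ≤ 2 * C * κ⁻¹ ^ 2 * ε := by
    rcases (sub_nonneg.2 (Metric.mem_closedBall.1 hz)).eq_or_lt with h0 | hd
    · have : M = 0 := by rw [hM, ← h0]; simp
      rw [this]; positivity
    set d := R - dist z c with hddef
    have hd1 : d ≤ 1 := by linarith [dist_nonneg (x := z) (y := c)]
    have hdist : ∀ x' ∈ Metric.ball z (3 * (κ * d)), d / 2 ≤ R - dist x' c := by
      intro x' hx'
      have h1 := Metric.mem_ball.1 hx'
      have h2 := dist_triangle x' z c
      have h3 : κ * d ≤ 1 / 8 * d := by gcongr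
      linarith
    have hsub : Metric.ball z (3 * (κ * d)) ⊆ Metric.closedBall c R := fun x' hx' => by
      have := hdist x' hx'
      rw [Metric.mem_closedBall]; linarith
    have h1 := hstep z (κ * d) (4 * M / d ^ 2) (by positivity) (by nlinarith) (by positivity)
      hsub (fun x' hx' => by
        have h1 := hmax' x' (hsub hx')
        have h2 : (d / 2) ^ 2 * g x' ≤ M := le_trans (by
          have := hdist x' hx'
          have := hg0 x'
          gcongr) h1
        rw [le_div_iff₀ (by positivity)]; linarith)
    have h2 : M ≤ d ^ 2 * (C * (ε * (κ * d)⁻¹ ^ 2 + κ * d * (4 * M / d ^ 2))) := by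
      rw [hM]; gcongr
    have h3 : d ^ 2 * (C * (ε * (κ * d)⁻¹ ^ 2 + κ * d * (4 * M / d ^ 2)))
        = C * κ⁻¹ ^ 2 * ε + C * κ * (4 * M) * d := by field_simp
    have h4 : C * κ * (4 * M) * d ≤ 1 / 8 * (4 * M) * 1 := by gcongr
    linarith
  have hx1 : R / 2 ≤ R - dist x c := by linarith [Metric.mem_closedBall.1 hx]
  have h1 := hmax' x (Metric.closedBall_subset_closedBall (by linarith) hx)
  have h2 : (R / 2) ^ 2 * g x ≤ (R - dist x c) ^ 2 * g x := by
    have := hg0 x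
    gcongr
  have h3 : g x ≤ 4 / R ^ 2 * M := by
    rw [div_mul_eq_mul_div, le_div_iff₀ (by positivity)]; linarith
  refine h3.trans ?_
  rw [mul_assoc]
  gcongr

theorem continuousAt_opNorm_comp {Y E G : Type*} [TopologicalSpace Y] [NormedAddCommGroup E]
    [NormedSpace ℝ E] [NormedAddCommGroup G] [NormedSpace ℝ G] {f : Y → E →L[ℝ] G} {X : Y}
    (hf : ContinuousAt f X) : ContinuousAt (fun X => ‖f X‖) X := hf.norm

section Interior

variable {ι : Type*} [Fintype ι] {Z : Type*} [NormedAddCommGroup Z] [InnerProductSpace ℝ Z]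
  [FiniteDimensional ℝ Z] [MeasurableSpace Z] [BorelSpace Z]
  {E : Type*} [NormedAddCommGroup E] [NormedSpace ℝ E] [FiniteDimensional ℝ E]

variable (E) in
/-- Restriction of a bilinear form on `ℝ × E` to the factor `E`. -/
noncomputable def spatialPart (B : (ℝ × E) →L[ℝ] (ℝ × E) →L[ℝ] ℝ) : E →L[ℝ] E →L[ℝ] ℝ :=
  ((ContinuousLinearMap.compL ℝ E (ℝ × E) ℝ).flip (ContinuousLinearMap.inr ℝ ℝ E)).comp
    (B.comp (ContinuousLinearMap.inr ℝ ℝ E))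

theorem spatialPart_apply (B : (ℝ × E) →L[ℝ] (ℝ × E) →L[ℝ] ℝ) (p q : E) :
    spatialPart E B p q = B (0, p) (0, q) := rfl

theorem continuous_spatialPart : Continuous (spatialPart E) :=
  continuous_const.clm_comp (continuous_id.clm_comp continuous_const)

theorem exists_interior_hessian_bound {Λ R : ℝ} (hΛ : 0 ≤ Λ) (hR : 0 < R) (hR1 : R ≤ 1) :
    ∃ C, 0 ≤ C ∧ ∀ (A : ℝ × E → (E → E → ℝ) → ℝ) (b : ℝ × E → E) (F V : ℝ × E → ℝ) (c : ℝ × E)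
      (ε : ℝ), 0 ≤ ε → (∀ X ∈ Metric.closedBall c R, ContDiffAt ℝ 2 V X) →
      (∀ X₀ ρ H, 0 < ρ → ρ ≤ 1 → 0 ≤ H → Metric.ball X₀ (3 * ρ) ⊆ Metric.closedBall c R →
        (∀ X ∈ Metric.ball X₀ (3 * ρ), ∀ p q : E,
          |fderiv ℝ (fderiv ℝ V) X (0, p) (0, q)| ≤ H * ‖p‖ * ‖q‖) →
        ParabolicBounds ι Z Λ A b F V X₀ ρ ε H) →
      ∀ X ∈ Metric.closedBall c (R / 2), ∀ p q : E,
        |fderiv ℝ (fderiv ℝ V) X (0, p) (0, q)| ≤ C * ε * ‖p‖ * ‖q‖ := by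
  obtain ⟨C, hC, hstep⟩ := exists_hessian_step (ι := ι) (Z := Z) (E := E) hΛ
  obtain ⟨C', hC', hbound⟩ := exists_absorption_bound hC hR hR1
  refine ⟨C', hC', fun A b F V c ε hε hV hP X hX p q => ?_⟩
  have hle : ∀ X : ℝ × E, ∀ p q : E, |fderiv ℝ (fderiv ℝ V) X (0, p) (0, q)|
      ≤ ‖spatialPart E (fderiv ℝ (fderiv ℝ V) X)‖ * ‖p‖ * ‖q‖ := fun X p q =>
    (spatialPart E (fderiv ℝ (fderiv ℝ V) X)).le_opNorm₂ p q
  refine (hle X p q).trans ?_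
  gcongr
  refine hbound c (fun X => ‖spatialPart E (fderiv ℝ (fderiv ℝ V) X)‖) ε hε ?_
    (fun _ => ContinuousLinearMap.opNorm_nonneg _) ?_ X hX
  · intro X hX
    have h1 : ContDiffAt ℝ 1 (fderiv ℝ V) X := (hV X hX).fderiv_right (by norm_num)
    have h2 : ContDiffAt ℝ 0 (fderiv ℝ (fderiv ℝ V)) X := h1.fderiv_right (by norm_num)
    have h3 : Continuous (spatialPart E) := continuous_spatialPart
    have h4 : ContinuousAt (fun X => spatialPart E (fderiv ℝ (fderiv ℝ V) X)) X :=
      h3.continuousAt.comp h2.continuousAt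
    exact (continuousAt_opNorm_comp h4).continuousWithinAt
  · intro X₀ ρ H hρ hρ1 hH hsub hb
    refine ContinuousLinearMap.opNorm_le_bound₂ _ (by positivity) fun p q => ?_
    rw [spatialPart_apply]
    refine hstep A b F V X₀ ρ ε H hρ hρ1 hε hH (hP X₀ ρ H hρ hρ1 hH hsub fun X hX p q => ?_) p q
    exact (hle X p q).trans (by have := hb X hX; gcongr)

end Interior

section Uniform

variable {Y G : Type*} [NormedAddCommGroup Y] [NormedSpace ℝ Y] [NormedAddCommGroup G]
  [NormedSpace ℝ G] {K : Set Y}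

theorem eventually_forall_norm_sub_le (hK : IsCompact K) {Φ : ℝ × Y → G}
    (hΦ : ∀ X ∈ K, ContinuousAt Φ (0, X)) {ε : ℝ} (hε : 0 < ε) :
    ∀ᶠ h in nhds (0 : ℝ), ∀ X ∈ K, ‖Φ (h, X) - Φ (0, X)‖ ≤ ε := by
  refine hK.eventually_forall_of_forall_eventually (P := fun h X => ‖Φ (h, X) - Φ (0, X)‖ ≤ ε)
    fun X hX => ?_
  have h1 : ContinuousAt (fun z : ℝ × Y => Φ (0, z.2)) (0, X) :=
    ContinuousAt.comp (f := fun z : ℝ × Y => ((0 : ℝ), z.2)) (hΦ X hX) (by fun_prop)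
  have h2 : ContinuousAt (fun z : ℝ × Y => ‖Φ z - Φ (0, z.2)‖) (0, X) :=
    ((hΦ X hX).sub h1).norm
  have h3 : ∀ᶠ z in nhds ((0 : ℝ), X), ‖Φ z - Φ (0, z.2)‖ < ε :=
    h2.eventually_lt_const (by simpa using hε)
  exact h3.mono fun z hz => hz.le

theorem eventually_norm_diffQuot_sub_le (hK : IsCompact K) {O : Set Y} (hO : IsOpen O)
    (hKO : K ⊆ O) {f : Y → G} (hf : ContDiffOn ℝ 1 f O) (η : Y) {ε : ℝ} (hε : 0 < ε) :
    ∀ᶠ h in nhdsWithin (0 : ℝ) {0}ᶜ, ∀ X ∈ K,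
      ‖h⁻¹ • (f (X + h • η) - f X) - fderiv ℝ f X η‖ ≤ ε := by
  have hC : ∀ X ∈ O, ContDiffAt ℝ 1 f X := fun X hX => hf.contDiffAt (hO.mem_nhds hX)
  have hshift : ∀ X : Y, ContinuousAt (fun z : ℝ × Y => z.2 + z.1 • η) (0, X) := fun X => by
    fun_prop
  have h1 := eventually_forall_norm_sub_le hK (Φ := fun z => fderiv ℝ f (z.2 + z.1 • η) η)
    (fun X hX => by
      have : ContinuousAt (fderiv ℝ f) (X + (0 : ℝ) • η) := by
        rw [zero_smul, add_zero]
        exact ((hC X (hKO hX)).fderiv_right (m := 0) (by norm_num)).continuousAt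
      exact (ContinuousAt.comp (f := fun z : ℝ × Y => z.2 + z.1 • η) this
        (hshift X)).clm_apply continuousAt_const) hε
  have h2 : ∀ᶠ h in nhds (0 : ℝ), ∀ X ∈ K, X + h • η ∈ O :=
    hK.eventually_forall_of_forall_eventually (P := fun h X => X + h • η ∈ O) fun X hX =>
      (hshift X).eventually_mem (hO.mem_nhds (by simpa using hKO hX))
  obtain ⟨δ, hδ, hb⟩ := Metric.eventually_nhds_iff.1 (h1.and h2)
  refine eventually_nhdsWithin_iff.2 (Metric.eventually_nhds_iff.2 ⟨δ, hδ, fun h hh h0 X hX => ?_⟩)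
  have h0 : h ≠ 0 := h0
  have hd : ∀ a ∈ Metric.ball (0 : ℝ) δ, HasDerivWithinAt
      (fun a => f (X + a • η) - a • fderiv ℝ f X η)
      (fderiv ℝ f (X + a • η) η - fderiv ℝ f X η) (Metric.ball 0 δ) a := by
    intro a ha
    have e1 := ((hC _ ((hb ha).2 X hX)).differentiableAt (by norm_num)).hasFDerivAt
    have e2 : HasDerivAt (fun a : ℝ => X + a • η) η a := by
      simpa using ((hasDerivAt_id a).smul_const η).const_add X
    have e3 := e1.comp_hasDerivAt a e2
    have e4 : HasDerivAt (fun a : ℝ => a • fderiv ℝ f X η) (fderiv ℝ f X η) a := by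
      simpa using (hasDerivAt_id a).smul_const (fderiv ℝ f X η)
    exact (e3.sub e4).hasDerivWithinAt
  have := (convex_ball (0 : ℝ) δ).norm_image_sub_le_of_norm_hasDerivWithin_le (C := ε) hd
    (fun a ha => by simpa using (hb ha).1 X hX) (Metric.mem_ball_self hδ) hh
  rw [zero_smul, zero_smul, add_zero, sub_zero, sub_zero] at this
  have e : h⁻¹ • (f (X + h • η) - f X) - fderiv ℝ f X η
      = h⁻¹ • (f (X + h • η) - h • fderiv ℝ f X η - f X) := by
    rw [smul_sub, smul_sub, smul_sub, smul_smul, inv_mul_cancel₀ h0, one_smul]; abel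
  rw [e, norm_smul, norm_inv, inv_mul_le_iff₀ (norm_pos_iff.2 h0)]
  linarith

theorem eventually_lipschitz_sub_le (hK : IsCompact K) (hKc : Convex ℝ K) {O : Set (ℝ × Y)}
    (hO : IsOpen O) (hKO : ∀ X ∈ K, ((0 : ℝ), X) ∈ O) {Φ : ℝ × Y → G} (hΦ : ContDiffOn ℝ 1 Φ O)
    {ε : ℝ} (hε : 0 < ε) :
    ∀ᶠ h in nhds (0 : ℝ), (∀ X ∈ K, ‖Φ (h, X) - Φ (0, X)‖ ≤ ε) ∧
      ∀ X ∈ K, ∀ X' ∈ K, ‖Φ (h, X) - Φ (0, X) - (Φ (h, X') - Φ (0, X'))‖ ≤ ε * ‖X - X'‖ := by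
  have hC : ∀ z ∈ O, ContDiffAt ℝ 1 Φ z := fun z hz => hΦ.contDiffAt (hO.mem_nhds hz)
  have h1 := eventually_forall_norm_sub_le hK (Φ := Φ)
    (fun X hX => (hC _ (hKO X hX)).continuousAt) hε
  have h2 := eventually_forall_norm_sub_le hK
    (Φ := fun z => (fderiv ℝ Φ z).comp (ContinuousLinearMap.inr ℝ ℝ Y))
    (fun X hX => by
      have : ContinuousAt (fderiv ℝ Φ) (0, X) :=
        ((hC _ (hKO X hX)).fderiv_right (m := 0) (by norm_num)).continuousAt
      exact this.clm_comp continuousAt_const) hε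
  have h3 : ∀ᶠ h in nhds (0 : ℝ), ∀ X ∈ K, (h, X) ∈ O :=
    hK.eventually_forall_of_forall_eventually (P := fun h X => (h, X) ∈ O) fun X hX =>
      hO.mem_nhds (hKO X hX)
  filter_upwards [h1, h2, h3] with h h1 h2 h3
  refine ⟨h1, fun X hX X' hX' => ?_⟩
  have hd : ∀ a : ℝ, ∀ X : Y, (a, X) ∈ O → HasFDerivAt (fun X => Φ (a, X))
      ((fderiv ℝ Φ (a, X)).comp (ContinuousLinearMap.inr ℝ ℝ Y)) X := fun a X hX =>
    HasFDerivAt.comp (f := fun X : Y => (a, X)) X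
      ((hC _ hX).differentiableAt (by norm_num)).hasFDerivAt (hasFDerivAt_prodMk_right a X)
  exact hKc.norm_image_sub_le_of_norm_hasFDerivWithin_le (f := fun X => Φ (h, X) - Φ (0, X))
    (fun X hX => ((hd h X (h3 X hX)).sub (hd 0 X (hKO X hX))).hasFDerivWithinAt) h2 hX' hX

theorem exists_lipschitz_bound (hK : IsCompact K) (hKc : Convex ℝ K) {O : Set Y} (hO : IsOpen O)
    (hKO : K ⊆ O) {f : Y → G} (hf : ContDiffOn ℝ 1 f O) :
    ∃ L, 0 ≤ L ∧ (∀ X ∈ K, ‖f X‖ ≤ L) ∧ ∀ X ∈ K, ∀ X' ∈ K, ‖f X - f X'‖ ≤ L * ‖X - X'‖ := by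
  have hC : ∀ X ∈ O, ContDiffAt ℝ 1 f X := fun X hX => hf.contDiffAt (hO.mem_nhds hX)
  obtain ⟨L1, h1⟩ := hK.exists_bound_of_continuousOn (hf.continuousOn.mono hKO)
  obtain ⟨L2, h2⟩ := hK.exists_bound_of_continuousOn (f := fderiv ℝ f) fun X hX =>
    ((hC X (hKO hX)).fderiv_right (m := 0) (by norm_num)).continuousAt.continuousWithinAt
  refine ⟨max 0 (max L1 L2), le_max_left _ _, fun X hX => (h1 X hX).trans
    ((le_max_left _ _).trans (le_max_right _ _)), fun X hX X' hX' => ?_⟩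
  refine hKc.norm_image_sub_le_of_norm_hasFDerivWithin_le (f := f) (f' := fderiv ℝ f)
    (fun X hX => ((hC X (hKO hX)).differentiableAt (by norm_num)).hasFDerivAt.hasFDerivWithinAt)
    (fun X hX => (h2 X hX).trans ((le_max_right _ _).trans (le_max_right _ _))) hX' hX

end Uniform

section Frozen

variable {n : ℕ}

theorem exists_eigenvector_expansion {lam : ℝ} (σ : Fin n → Fin n → ℝ)
    (hsym : ∀ i j, σ i j = σ j i)
    (hell : ∀ ξ : EuclideanSpace ℝ (Fin n), lam * ‖ξ‖ ^ 2 ≤ (∑ i, ∑ j, σ i j * ξ i * ξ j) ∧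
      (∑ i, ∑ j, σ i j * ξ i * ξ j) ≤ lam⁻¹ * ‖ξ‖ ^ 2) :
    ∃ (v : OrthonormalBasis (Fin n) ℝ (EuclideanSpace ℝ (Fin n))) (μ : Fin n → ℝ),
      (∀ k, lam ≤ μ k ∧ μ k ≤ lam⁻¹) ∧ ∀ i j, σ i j = ∑ k, μ k * v k i * v k j := by
  have hA : (Matrix.of σ).IsHermitian := by
    ext i j
    simp [hsym i j]
  set v := hA.eigenvectorBasis with hv
  set μ := hA.eigenvalues with hμ
  have hvk : ∀ k i, ∑ j, σ i j * v k j = μ k * v k i := fun k i => by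
    have := congrFun (hA.mulVec_eigenvectorBasis k) i
    simpa [Matrix.mulVec, dotProduct] using this
  have hnorm : ∀ k, ‖v k‖ = 1 := v.orthonormal.1
  have hq : ∀ k, ∑ i, ∑ j, σ i j * v k i * v k j = μ k := fun k => by
    have h1 : ∀ i, ∑ j, σ i j * v k i * v k j = μ k * (v k i * v k i) := fun i => by
      have : ∑ j, σ i j * v k i * v k j = v k i * ∑ j, σ i j * v k j := by
        rw [Finset.mul_sum]; exact Finset.sum_congr rfl fun j _ => by ring
      rw [this, hvk]; ring
    have h2 : ∑ i, v k i * v k i = 1 := by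
      have := EuclideanSpace.real_norm_sq_eq (v k)
      rw [hnorm] at this
      simpa [sq] using this.symm
    simp_rw [h1, ← Finset.mul_sum, h2, mul_one]
  refine ⟨v, μ, fun k => ?_, fun i l => ?_⟩
  · have := hell (v k)
    rw [hq, hnorm] at this
    simpa using this
  · have h1 : ∀ j, ∑ k, v k j * v k l = if j = l then 1 else 0 := fun j => by
      have := v.sum_inner_mul_inner (EuclideanSpace.single j (1 : ℝ)) (EuclideanSpace.single l 1)
      simpa [EuclideanSpace.inner_single_left, EuclideanSpace.inner_single_right, eq_comm]
        using this
    have h2 : ∑ k, μ k * v k i * v k l = ∑ j, σ i j * ∑ k, v k j * v k l := by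
      simp_rw [← hvk, Finset.sum_mul, Finset.mul_sum]
      rw [Finset.sum_comm]
      exact Finset.sum_congr rfl fun _ _ => Finset.sum_congr rfl fun _ _ => by ring
    rw [h2]
    simp [h1]

/-- The Euclidean inclusion of the `i`-th spatial coordinate vector. -/
noncomputable def coordVec (i : Fin n) : EuclideanSpace ℝ (Fin n) × ℝ :=
  (EuclideanSpace.single i 1, 0)

theorem exists_sqrt_decomposition {lam : ℝ} (hlam : 0 < lam) (hlam1 : lam < 1)
    (σ : Fin n → Fin n → ℝ) (hsym : ∀ i j, σ i j = σ j i)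
    (hell : ∀ ξ : EuclideanSpace ℝ (Fin n), lam * ‖ξ‖ ^ 2 ≤ (∑ i, ∑ j, σ i j * ξ i * ξ j) ∧
      (∑ i, ∑ j, σ i j * ξ i * ξ j) ≤ lam⁻¹ * ‖ξ‖ ^ 2) :
    ∃ (e : OrthonormalBasis (Fin n ⊕ Unit) ℝ (EuclideanSpace ℝ (Fin n ⊕ Unit)))
      (S : EuclideanSpace ℝ (Fin n ⊕ Unit) →L[ℝ] EuclideanSpace ℝ (Fin n) × ℝ)
      (T : EuclideanSpace ℝ (Fin n) × ℝ → EuclideanSpace ℝ (Fin n ⊕ Unit)),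
      (∀ p, S (T p) = p) ∧ ‖S‖ ≤ (n + 1) * lam⁻¹ ∧ (∀ p, ‖T p‖ ≤ (n + 1) * lam⁻¹ * ‖p‖) ∧
      ∀ B : (ℝ × EuclideanSpace ℝ (Fin n) × ℝ) →L[ℝ] (ℝ × EuclideanSpace ℝ (Fin n) × ℝ) →L[ℝ] ℝ,
        ∑ i, ∑ j, σ i j * B (0, coordVec i) (0, coordVec j) + B (0, 0, 1) (0, 0, 1)
          = ∑ k, B (0, S (e k)) (0, S (e k)) := by
  obtain ⟨v, μ, hμ, hσ⟩ := exists_eigenvector_expansion σ hsym hell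
  have hμ0 : ∀ k, 0 < μ k := fun k => hlam.trans_le (hμ k).1
  have hl1 : 1 ≤ lam⁻¹ := (one_le_inv₀ hlam).2 hlam1.le
  have hs1 : ∀ k, √(μ k) ≤ lam⁻¹ := fun k => Real.sqrt_le_iff.2 ⟨by positivity, by
    nlinarith [(hμ k).2]⟩
  have hs2 : ∀ k, (√(μ k))⁻¹ ≤ lam⁻¹ := fun k => by
    refine inv_anti₀ hlam (Real.le_sqrt_of_sq_le ?_)
    nlinarith [(hμ k).1]
  set S : EuclideanSpace ℝ (Fin n ⊕ Unit) →L[ℝ] EuclideanSpace ℝ (Fin n) × ℝ :=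
    (∑ k, (EuclideanSpace.proj (Sum.inl k) : EuclideanSpace ℝ (Fin n ⊕ Unit) →L[ℝ] ℝ).smulRight
      (√(μ k) • v k, (0 : ℝ)))
    + (EuclideanSpace.proj (Sum.inr ()) : EuclideanSpace ℝ (Fin n ⊕ Unit) →L[ℝ] ℝ).smulRight
      (0, (1 : ℝ)) with hS
  have hSz : ∀ z, S z = (∑ k, z (Sum.inl k) • √(μ k) • v k, z (Sum.inr ())) := fun z => by
    simp only [hS, add_apply, sum_apply, ContinuousLinearMap.smulRight_apply]
    ext <;> simp [Prod.fst_sum, Prod.snd_sum]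
  set T : EuclideanSpace ℝ (Fin n) × ℝ → EuclideanSpace ℝ (Fin n ⊕ Unit) := fun p =>
    WithLp.toLp 2 (Sum.elim (fun k => (√(μ k))⁻¹ * inner ℝ (v k) p.1) fun _ => p.2) with hT
  refine ⟨EuclideanSpace.basisFun _ ℝ, S, T, fun p => ?_, ?_, fun p => ?_, fun B => ?_⟩
  · rw [hSz]
    refine Prod.ext ?_ rfl
    have : ∀ k, ((√(μ k))⁻¹ * inner ℝ (v k) p.1) • √(μ k) • v k = inner ℝ (v k) p.1 • v k :=
      fun k => by
        have := (Real.sqrt_pos.2 (hμ0 k)).ne'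
        rw [smul_smul]; congr 1; field_simp
    simp only [hT, Sum.elim_inl, this]
    exact v.sum_repr' p.1
  · refine ContinuousLinearMap.opNorm_le_bound _ (by positivity) fun z => ?_
    have h1 : ∀ l, ‖z l‖ ≤ ‖z‖ := fun l => PiLp.norm_apply_le z l
    rw [hSz, Prod.norm_def]
    refine max_le ?_ ((h1 _).trans (le_mul_of_one_le_left (norm_nonneg _) ?_))
    · change ‖∑ k, z (Sum.inl k) • √(μ k) • v k‖ ≤ _
      refine (norm_sum_le _ _).trans ((Finset.sum_le_card_nsmul _ _ (lam⁻¹ * ‖z‖)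
        fun k _ => ?_).trans ?_)
      · rw [norm_smul, norm_smul, v.orthonormal.1, mul_one, Real.norm_of_nonneg (Real.sqrt_nonneg _),
          mul_comm]
        exact mul_le_mul (hs1 k) (h1 _) (norm_nonneg _) (by positivity)
      · simp only [Finset.card_univ, Fintype.card_fin, nsmul_eq_mul]
        nlinarith [mul_nonneg (inv_nonneg.2 hlam.le) (norm_nonneg z)]
    · nlinarith [Nat.cast_nonneg (α := ℝ) n]
  · have h0 : ‖T p‖ ≤ ∑ l, ‖T p l‖ := by
      rw [EuclideanSpace.norm_eq]
      refine Real.sqrt_le_iff.2 ⟨by positivity, Finset.sum_sq_le_sq_sum_of_nonneg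
        fun l _ => norm_nonneg _⟩
    refine h0.trans ?_
    rw [Fintype.sum_sum_type]
    have h1 : ∀ k : Fin n, ‖T p (Sum.inl k)‖ ≤ lam⁻¹ * ‖p‖ := fun k => by
      simp only [hT, Sum.elim_inl]
      rw [norm_mul, norm_inv, Real.norm_of_nonneg (Real.sqrt_nonneg _)]
      refine mul_le_mul (hs2 k) ((norm_inner_le_norm _ _).trans ?_) (norm_nonneg _) (by positivity)
      rw [v.orthonormal.1, one_mul]; exact norm_fst_le p
    have h2 : ‖T p (Sum.inr ())‖ ≤ lam⁻¹ * ‖p‖ := by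
      simp only [hT, Sum.elim_inr]
      exact (norm_snd_le p).trans (le_mul_of_one_le_left (norm_nonneg _) hl1)
    have h3 := Finset.sum_le_card_nsmul Finset.univ _ _ fun k _ => h1 k
    simp only [Finset.card_univ, Fintype.card_fin, nsmul_eq_mul] at h3
    simp only [Finset.univ_unique, Finset.sum_singleton]
    have h4 : ‖T p (Sum.inr default)‖ ≤ lam⁻¹ * ‖p‖ := h2
    linarith
  · rw [Fintype.sum_sum_type]
    have hl : ∀ k : Fin n, S (EuclideanSpace.basisFun (Fin n ⊕ Unit) ℝ (Sum.inl k))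
        = ∑ i, (√(μ k) * v k i) • coordVec i := fun k => by
      rw [hSz]
      ext <;> simp [coordVec, Prod.fst_sum, Prod.snd_sum, Finset.sum_apply, Pi.single_apply]
    have hr : S (EuclideanSpace.basisFun (Fin n ⊕ Unit) ℝ (Sum.inr ())) = (0, 1) := by
      rw [hSz]; simp
    have hB : ∀ p q, B (0, p) (0, q) = spatialPart (EuclideanSpace ℝ (Fin n) × ℝ) B p q :=
      fun p q => rfl
    simp only [hB, hl, hr, map_sum, map_smul, sum_apply, smul_apply, smul_eq_mul,
      Finset.univ_unique, Finset.sum_singleton, PUnit.default_eq_unit]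
    congr 1
    simp_rw [hσ, Finset.sum_mul, Finset.mul_sum]
    have hsq : ∀ k, √(μ k) * √(μ k) = μ k := fun k => Real.mul_self_sqrt (hμ0 k).le
    rw [Finset.sum_congr rfl fun i _ => Finset.sum_comm, Finset.sum_comm]
    refine Finset.sum_congr rfl fun k _ => ?_
    rw [Finset.sum_comm]
    refine Finset.sum_congr rfl fun i _ => Finset.sum_congr rfl fun j _ => ?_
    conv_lhs => rw [← hsq]
    ring

end Frozen

section DiffQuot

variable {Y : Type*} [NormedAddCommGroup Y] [NormedSpace ℝ Y]

/-- Difference quotient of `f` in direction `η` with step `h`. -/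
noncomputable def diffQuot (f : Y → ℝ) (η : Y) (h : ℝ) (X : Y) : ℝ := h⁻¹ * (f (X + h • η) - f X)

theorem ContDiffAt.diffQuot {f : Y → ℝ} {η X : Y} {h : ℝ} (h1 : ContDiffAt ℝ 2 f X)
    (h2 : ContDiffAt ℝ 2 f (X + h • η)) : ContDiffAt ℝ 2 (diffQuot f η h) X := by
  have h3 : ContDiffAt ℝ 2 (fun X => f (X + h • η)) X :=
    ContDiffAt.comp (g := f) X h2 (contDiffAt_id.add contDiffAt_const)
  exact contDiffAt_const.mul (h3.sub h1)

theorem fderiv_diffQuot {f : Y → ℝ} {η X : Y} {h : ℝ} (h1 : ContDiffAt ℝ 2 f X)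
    (h2 : ContDiffAt ℝ 2 f (X + h • η)) :
    fderiv ℝ (diffQuot f η h) X = h⁻¹ • (fderiv ℝ f (X + h • η) - fderiv ℝ f X) := by
  have e1 := (hasFDerivAt_comp_add_right (h • η)).2
    (h2.differentiableAt (by norm_num)).hasFDerivAt
  have e2 := (h1.differentiableAt (by norm_num)).hasFDerivAt
  exact ((e1.sub e2).const_mul h⁻¹).fderiv

theorem fderiv_fderiv_diffQuot {f : Y → ℝ} {η X : Y} {h : ℝ} (h1 : ContDiffAt ℝ 2 f X)
    (h2 : ContDiffAt ℝ 2 f (X + h • η)) (p q : Y) :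
    fderiv ℝ (fderiv ℝ (diffQuot f η h)) X p q
      = h⁻¹ * (fderiv ℝ (fderiv ℝ f) (X + h • η) p q - fderiv ℝ (fderiv ℝ f) X p q) := by
  have h3 : ∀ᶠ X' in nhds X, ContDiffAt ℝ 2 f (X' + h • η) := by
    have : Filter.Tendsto (fun X' => X' + h • η) (nhds X) (nhds (X + h • η)) :=
      (continuous_id.add continuous_const).tendsto X
    exact this.eventually (h2.eventually (by simp))
  have e : fderiv ℝ (diffQuot f η h)
      =ᶠ[nhds X] fun X => h⁻¹ • (fderiv ℝ f (X + h • η) - fderiv ℝ f X) := by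
    filter_upwards [h1.eventually (by simp), h3] with X' k1 k2 using fderiv_diffQuot k1 k2
  have d : ∀ {X}, ContDiffAt ℝ 2 f X →
      HasFDerivAt (fderiv ℝ f) (fderiv ℝ (fderiv ℝ f) X) X := fun h =>
    ((h.fderiv_right (m := 1) (by norm_num)).differentiableAt (by norm_num)).hasFDerivAt
  have e1 := (hasFDerivAt_comp_add_right (h • η)).2 (d h2)
  have e2 := ((e1.sub (d h1)).const_smul h⁻¹).congr_of_eventuallyEq e
  refine (congrArg (fun L : Y →L[ℝ] Y →L[ℝ] ℝ => L p q) e2.fderiv).trans ?_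
  simp

theorem fderiv_sub_two {f g : Y → ℝ} {X : Y} (hf : ContDiffAt ℝ 2 f X) (hg : ContDiffAt ℝ 2 g X) :
    fderiv ℝ (fun X => f X - g X) X = fderiv ℝ f X - fderiv ℝ g X ∧ ∀ p q,
      fderiv ℝ (fderiv ℝ (fun X => f X - g X)) X p q
        = fderiv ℝ (fderiv ℝ f) X p q - fderiv ℝ (fderiv ℝ g) X p q := by
  have h1 : ∀ {X}, ContDiffAt ℝ 2 f X → ContDiffAt ℝ 2 g X →
      fderiv ℝ (fun X => f X - g X) X = fderiv ℝ f X - fderiv ℝ g X := fun h h' =>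
    ((h.differentiableAt (by norm_num)).hasFDerivAt.sub
      (h'.differentiableAt (by norm_num)).hasFDerivAt).fderiv
  have e : fderiv ℝ (fun X => f X - g X) =ᶠ[nhds X] fun X => fderiv ℝ f X - fderiv ℝ g X := by
    filter_upwards [hf.eventually (by simp), hg.eventually (by simp)] with X' k1 k2 using h1 k1 k2
  have d : ∀ {f : Y → ℝ}, ContDiffAt ℝ 2 f X →
      HasFDerivAt (fderiv ℝ f) (fderiv ℝ (fderiv ℝ f) X) X := fun h =>
    ((h.fderiv_right (m := 1) (by norm_num)).differentiableAt (by norm_num)).hasFDerivAt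
  refine ⟨h1 hf hg, fun p q => ?_⟩
  have e2 := ((d hf).sub (d hg)).congr_of_eventuallyEq e
  exact congrArg (fun L : Y →L[ℝ] Y →L[ℝ] ℝ => L p q) e2.fderiv

end DiffQuot

section Extension

variable {n : ℕ}

/-- Second-order part of the operator with matrix `diag(σ, 1)`, applied to a bilinear form. -/
noncomputable def principalPart (σ : EuclideanSpace ℝ (Fin n) → Fin n → Fin n → ℝ)
    (X : ℝ × EuclideanSpace ℝ (Fin n) × ℝ)
    (Q : EuclideanSpace ℝ (Fin n) × ℝ → EuclideanSpace ℝ (Fin n) × ℝ → ℝ) : ℝ :=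
  ∑ i, ∑ j, σ X.2.1 i j * Q (coordVec i) (coordVec j) + Q (0, 1) (0, 1)

/-- First-order coefficients of `y^{-r} ∇·(y^r diag(σ, 1) ∇)`. -/
noncomputable def drift (σ : EuclideanSpace ℝ (Fin n) → Fin n → Fin n → ℝ) (r : ℝ)
    (X : ℝ × EuclideanSpace ℝ (Fin n) × ℝ) : EuclideanSpace ℝ (Fin n) × ℝ :=
  (∑ j, (∑ i, fderiv ℝ (fun x => σ x i j) X.2.1 (EuclideanSpace.single i 1)) •
    EuclideanSpace.single j (1 : ℝ), r / X.2.2)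

/-- Source term in the equation satisfied by the difference quotients in `y`. -/
noncomputable def diffQuotSource (r : ℝ) (U : ℝ × EuclideanSpace ℝ (Fin n) × ℝ → ℝ)
    (z : ℝ × ℝ × EuclideanSpace ℝ (Fin n) × ℝ) : ℝ :=
  -r / (z.2.2.2 * (z.2.2.2 + z.1)) * fderiv ℝ U (z.2 + z.1 • (0, 0, 1)) (0, 0, 1)

variable {σ : EuclideanSpace ℝ (Fin n) → Fin n → Fin n → ℝ} {r : ℝ}
  {U : ℝ × EuclideanSpace ℝ (Fin n) × ℝ → ℝ}

theorem principalPart_sub (X : ℝ × EuclideanSpace ℝ (Fin n) × ℝ)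
    (Q Q' : EuclideanSpace ℝ (Fin n) × ℝ → EuclideanSpace ℝ (Fin n) × ℝ → ℝ) :
    principalPart σ X (fun p q => Q p q - Q' p q)
      = principalPart σ X Q - principalPart σ X Q' := by
  simp only [principalPart, mul_sub, Finset.sum_sub_distrib]; ring

theorem principalPart_const_mul (X : ℝ × EuclideanSpace ℝ (Fin n) × ℝ) (a : ℝ)
    (Q : EuclideanSpace ℝ (Fin n) × ℝ → EuclideanSpace ℝ (Fin n) × ℝ → ℝ) :
    principalPart σ X (fun p q => a * Q p q) = a * principalPart σ X Q := by
  simp only [principalPart, mul_add, Finset.mul_sum, mul_left_comm]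

theorem isOpen_upperHalf : IsOpen {X : ℝ × EuclideanSpace ℝ (Fin n) × ℝ | 0 < X.2.2} :=
  isOpen_lt continuous_const (by fun_prop)

theorem diffQuot_equation
    (hU : ∀ X : ℝ × EuclideanSpace ℝ (Fin n) × ℝ, 0 < X.2.2 → ContDiffAt ℝ 2 U X)
    (heq : ∀ X : ℝ × EuclideanSpace ℝ (Fin n) × ℝ, 0 < X.2.2 →
      fderiv ℝ U X (1, 0) = principalPart σ X (fun p q => fderiv ℝ (fderiv ℝ U) X (0, p) (0, q))
        + fderiv ℝ U X (0, drift σ r X))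
    {h : ℝ} (h0 : h ≠ 0) {X : ℝ × EuclideanSpace ℝ (Fin n) × ℝ} (hX : 0 < X.2.2)
    (hXh : 0 < X.2.2 + h) :
    fderiv ℝ (diffQuot U (0, 0, 1) h) X (1, 0)
      = principalPart σ X
          (fun p q => fderiv ℝ (fderiv ℝ (diffQuot U (0, 0, 1) h)) X (0, p) (0, q))
        + fderiv ℝ (diffQuot U (0, 0, 1) h) X (0, drift σ r X) + diffQuotSource r U (h, X) := by
  set X' := X + h • ((0 : ℝ), (0 : EuclideanSpace ℝ (Fin n)), (1 : ℝ)) with hX'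
  have e1 : X'.2.1 = X.2.1 := by simp [hX']
  have e2 : X'.2.2 = X.2.2 + h := by simp [hX']
  have hXh' : 0 < X'.2.2 := by rw [e2]; exact hXh
  have hc := hU X hX
  have hc' := hU X' hXh'
  simp only [fderiv_fderiv_diffQuot hc hc', fderiv_diffQuot hc hc', smul_apply, sub_apply,
    smul_eq_mul]
  rw [principalPart_const_mul, principalPart_sub, heq X hX, heq X' hXh']
  have e3 : ∀ Q, principalPart σ X' Q = principalPart σ X Q := fun Q => by
    rw [principalPart, principalPart, e1]
  have e4 : ((0 : ℝ), drift σ r X')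
      = (0, drift σ r X) + (r / (X.2.2 + h) - r / X.2.2) • ((0 : ℝ), 0, (1 : ℝ)) := by
    rw [drift, drift, e1, e2]
    simp
  rw [e3, e4, map_add, map_smul, smul_eq_mul, diffQuotSource]
  simp only [← hX']
  have h1 := hX.ne'
  have h2 := hXh.ne'
  field_simp
  ring

theorem contDiffOn_drift (hσ : ContDiff ℝ 2 σ) :
    ContDiffOn ℝ 1 (drift σ r) {X : ℝ × EuclideanSpace ℝ (Fin n) × ℝ | 0 < X.2.2} := by
  have hd : ∀ j, ContDiff ℝ 1 (fun X : ℝ × EuclideanSpace ℝ (Fin n) × ℝ =>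
      ∑ i, fderiv ℝ (fun x => σ x i j) X.2.1 (EuclideanSpace.single i 1)) := fun j =>
    ContDiff.sum fun i _ => by
      have h1 : ContDiff ℝ 2 (fun x => σ x i j) := contDiff_pi.1 (contDiff_pi.1 hσ i) j
      have h2 : ContDiff ℝ 1 (fderiv ℝ (fun x => σ x i j)) := h1.fderiv_right (by norm_num)
      exact (h2.comp (by fun_prop)).clm_apply contDiff_const
  refine ContDiffOn.prodMk (ContDiff.contDiffOn (ContDiff.sum fun j _ =>
    (hd j).smul contDiff_const)) (ContDiffOn.div contDiffOn_const (by fun_prop)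
      fun X hX => hX.ne')

theorem contDiffOn_diffQuotSource
    (hU : ContDiffOn ℝ 2 U {X : ℝ × EuclideanSpace ℝ (Fin n) × ℝ | 0 < X.2.2}) :
    ContDiffOn ℝ 1 (diffQuotSource r U)
      {z : ℝ × ℝ × EuclideanSpace ℝ (Fin n) × ℝ | 0 < z.2.2.2 ∧ 0 < z.2.2.2 + z.1} := by
  have h1 : ContDiffOn ℝ 1 (fderiv ℝ U) {X : ℝ × EuclideanSpace ℝ (Fin n) × ℝ | 0 < X.2.2} :=
    hU.fderiv_of_isOpen isOpen_upperHalf (by norm_num)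
  refine ContDiffOn.mul (ContDiffOn.div contDiffOn_const (by fun_prop)
    fun z hz => (mul_pos hz.1 hz.2).ne') (ContDiffOn.clm_apply ?_ contDiffOn_const)
  refine h1.comp (f := fun z : ℝ × ℝ × EuclideanSpace ℝ (Fin n) × ℝ => z.2 + z.1 • (0, 0, 1))
    (by fun_prop) fun z hz => ?_
  simpa using hz.2

theorem norm_coordVec (i : Fin n) : ‖coordVec i‖ = 1 := by
  simp [coordVec, Prod.norm_def]

theorem abs_principalPart_sub_le {X X₀ : ℝ × EuclideanSpace ℝ (Fin n) × ℝ} {a K : ℝ} (ha : 0 ≤ a)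
    (hσ : ‖σ X.2.1 - σ X₀.2.1‖ ≤ a)
    {Q : EuclideanSpace ℝ (Fin n) × ℝ → EuclideanSpace ℝ (Fin n) × ℝ → ℝ}
    (hQ : ∀ p q, |Q p q| ≤ K * ‖p‖ * ‖q‖) :
    |principalPart σ X Q - principalPart σ X₀ Q| ≤ n * n * (a * K) := by
  have e : principalPart σ X Q - principalPart σ X₀ Q
      = ∑ i, ∑ j, (σ X.2.1 i j - σ X₀.2.1 i j) * Q (coordVec i) (coordVec j) := by
    simp only [principalPart, sub_mul, Finset.sum_sub_distrib]; ring
  have h1 : ∀ i j, |(σ X.2.1 i j - σ X₀.2.1 i j) * Q (coordVec i) (coordVec j)| ≤ a * K :=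
    fun i j => by
      rw [abs_mul]
      have h2 := hQ (coordVec i) (coordVec j)
      rw [norm_coordVec, norm_coordVec, mul_one, mul_one] at h2
      have h3 : |σ X.2.1 i j - σ X₀.2.1 i j| ≤ a :=
        (norm_le_pi_norm ((σ X.2.1 - σ X₀.2.1) i) j).trans
          ((norm_le_pi_norm (σ X.2.1 - σ X₀.2.1) i).trans hσ)
      gcongr
  rw [e]
  refine (Finset.abs_sum_le_sum_abs _ _).trans ((Finset.sum_le_card_nsmul _ _ (n * (a * K))
    fun i _ => (Finset.abs_sum_le_sum_abs _ _).trans ((Finset.sum_le_card_nsmul _ _ _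
      fun j _ => h1 i j).trans_eq ?_)).trans_eq ?_)
  · simp
  · simp [mul_assoc]

end Extension

section Cauchy

variable {n : ℕ} {σ : EuclideanSpace ℝ (Fin n) → Fin n → Fin n → ℝ} {r lam : ℝ}
  {U : ℝ × EuclideanSpace ℝ (Fin n) × ℝ → ℝ}

theorem exists_parabolicBounds_diffQuot_sub (hlam : 0 < lam) (hlam1 : lam < 1)
    (hσ : ContDiff ℝ 2 σ) (hsym : ∀ x i j, σ x i j = σ x j i)
    (hell : ∀ x ξ : EuclideanSpace ℝ (Fin n),
      lam * ‖ξ‖ ^ 2 ≤ (∑ i, ∑ j, σ x i j * ξ i * ξ j) ∧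
      (∑ i, ∑ j, σ x i j * ξ i * ξ j) ≤ lam⁻¹ * ‖ξ‖ ^ 2)
    (hU : ContDiffOn ℝ 2 U {X : ℝ × EuclideanSpace ℝ (Fin n) × ℝ | 0 < X.2.2})
    (heq : ∀ X : ℝ × EuclideanSpace ℝ (Fin n) × ℝ, 0 < X.2.2 →
      fderiv ℝ U X (1, 0) = principalPart σ X (fun p q => fderiv ℝ (fderiv ℝ U) X (0, p) (0, q))
        + fderiv ℝ U X (0, drift σ r X))
    {c : ℝ × EuclideanSpace ℝ (Fin n) × ℝ} {R : ℝ}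
    (hcR : ∀ X ∈ Metric.closedBall c R, 0 < X.2.2) :
    ∃ Λ, 0 ≤ Λ ∧ ∀ ε, 0 < ε → ∃ δ, 0 < δ ∧ ∀ h h' : ℝ, h ≠ 0 → h' ≠ 0 → |h| < δ → |h'| < δ →
      (∀ X ∈ Metric.closedBall c R, 0 < X.2.2 + h) ∧
      (∀ X ∈ Metric.closedBall c R, 0 < X.2.2 + h') ∧
      ∀ X₀ ρ H, 0 < ρ → Metric.ball X₀ (3 * ρ) ⊆ Metric.closedBall c R →
        (∀ X ∈ Metric.ball X₀ (3 * ρ), ∀ p q : EuclideanSpace ℝ (Fin n) × ℝ,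
          |fderiv ℝ (fderiv ℝ fun X => diffQuot U (0, 0, 1) h X - diffQuot U (0, 0, 1) h' X)
            X (0, p) (0, q)| ≤ H * ‖p‖ * ‖q‖) →
        ParabolicBounds (Fin n ⊕ Unit) (EuclideanSpace ℝ (Fin n ⊕ Unit)) Λ (principalPart σ)
          (drift σ r) (fun X => diffQuotSource r U (h, X) - diffQuotSource r U (h', X))
          (fun X => diffQuot U (0, 0, 1) h X - diffQuot U (0, 0, 1) h' X) X₀ ρ ε H := by
  have hK := isCompact_closedBall c R
  have hKc := convex_closedBall c R
  have hUat : ∀ X : ℝ × EuclideanSpace ℝ (Fin n) × ℝ, 0 < X.2.2 → ContDiffAt ℝ 2 U X :=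
    fun X hX => hU.contDiffAt (isOpen_upperHalf.mem_nhds hX)
  obtain ⟨Ls, hLs, -, hLs2⟩ := exists_lipschitz_bound hK hKc isOpen_univ (subset_univ _)
    (f := fun X : ℝ × EuclideanSpace ℝ (Fin n) × ℝ => σ X.2.1)
    ((hσ.of_le (by norm_num)).comp (by fun_prop)).contDiffOn
  obtain ⟨Lb, hLb, hLb1, hLb2⟩ := exists_lipschitz_bound hK hKc isOpen_upperHalf hcR
    (contDiffOn_drift (r := r) hσ)
  have ha : 0 ≤ (n + 1) * lam⁻¹ := by positivity
  have hb : (0 : ℝ) ≤ n * n * Ls := by positivity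
  refine ⟨(n + 1) * lam⁻¹ + n * n * Ls + Lb, by positivity, fun ε hε => ?_⟩
  set Λ := (n + 1) * lam⁻¹ + n * n * Ls + Lb with hΛ
  have hU1 : ContDiffOn ℝ 1 (fderiv ℝ U) {X : ℝ × EuclideanSpace ℝ (Fin n) × ℝ | 0 < X.2.2} :=
    hU.fderiv_of_isOpen isOpen_upperHalf (by norm_num)
  have ev1 := eventually_norm_diffQuot_sub_le hK isOpen_upperHalf hcR
    (hU.of_le (by norm_num)) (0, 0, 1) (half_pos hε)
  have ev2 := eventually_norm_diffQuot_sub_le hK isOpen_upperHalf hcR hU1 (0, 0, 1) (half_pos hε)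
  have hO : IsOpen {z : ℝ × ℝ × EuclideanSpace ℝ (Fin n) × ℝ | 0 < z.2.2.2 ∧ 0 < z.2.2.2 + z.1} :=
    have h1 : IsOpen {z : ℝ × ℝ × EuclideanSpace ℝ (Fin n) × ℝ | 0 < z.2.2.2} :=
      isOpen_lt continuous_const (by fun_prop)
    have h2 : IsOpen {z : ℝ × ℝ × EuclideanSpace ℝ (Fin n) × ℝ | 0 < z.2.2.2 + z.1} :=
      isOpen_lt continuous_const (by fun_prop)
    h1.inter h2
  have hKO : ∀ X ∈ Metric.closedBall c R, ((0 : ℝ), X) ∈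
      {z : ℝ × ℝ × EuclideanSpace ℝ (Fin n) × ℝ | 0 < z.2.2.2 ∧ 0 < z.2.2.2 + z.1} :=
    fun X hX => ⟨hcR X hX, by simpa using hcR X hX⟩
  have ev3 := eventually_lipschitz_sub_le hK hKc hO hKO
    (contDiffOn_diffQuotSource (r := r) hU) (half_pos hε)
  have ev4 : ∀ᶠ h in nhds (0 : ℝ), ∀ X ∈ Metric.closedBall c R, 0 < X.2.2 + h :=
    hK.eventually_forall_of_forall_eventually
      (P := fun (h : ℝ) (X : ℝ × EuclideanSpace ℝ (Fin n) × ℝ) => 0 < X.2.2 + h)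
      fun X hX => Filter.mem_of_superset (hO.mem_nhds (hKO X hX)) fun z hz => hz.2
  obtain ⟨δ, hδ, hev⟩ := Metric.eventually_nhds_iff.1 ((eventually_nhdsWithin_iff.1
    (ev1.and ev2)).and (ev3.and ev4))
  refine ⟨δ, hδ, fun h h' h0 h0' hhδ hhδ' => ?_⟩
  obtain ⟨a1, ⟨a2, a3⟩, a4⟩ := hev (y := h) (by simpa using hhδ)
  obtain ⟨a1, a1'⟩ := a1 h0
  obtain ⟨b1, ⟨b2, b3⟩, b4⟩ := hev (y := h') (by simpa using hhδ')
  obtain ⟨b1, b1'⟩ := b1 h0'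
  refine ⟨a4, b4, fun X₀ ρ H hρ hsub hH => ?_⟩
  have hX0 : X₀ ∈ Metric.closedBall c R := hsub (Metric.mem_ball_self (by positivity))
  have hs : ∀ X ∈ Metric.closedBall c R, ∀ h : ℝ, 0 < X.2.2 + h → ContDiffAt ℝ 2 U
      (X + h • ((0 : ℝ), (0 : EuclideanSpace ℝ (Fin n)), (1 : ℝ))) := fun X hX h hh =>
    hUat _ (by simpa using hh)
  have hq : ∀ X ∈ Metric.closedBall c R, ∀ h : ℝ, 0 < X.2.2 + h →
      ContDiffAt ℝ 2 (diffQuot U (0, 0, 1) h) X := fun X hX h hh =>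
    (hUat X (hcR X hX)).diffQuot (hs X hX h hh)
  have hdq : ∀ X ∈ Metric.closedBall c R, ∀ h : ℝ, 0 < X.2.2 + h →
      fderiv ℝ (diffQuot U (0, 0, 1) h) X = h⁻¹ • (fderiv ℝ U (X + h • (0, 0, 1))
        - fderiv ℝ U X) := fun X hX h hh =>
    fderiv_diffQuot (hUat X (hcR X hX)) (hs X hX h hh)
  constructor
  · exact fun X hX => ((hq X (hsub hX) h (a4 X (hsub hX))).sub
      (hq X (hsub hX) h' (b4 X (hsub hX)))).contDiffWithinAt
  · intro X hX
    have h1 := a1 X (hsub hX)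
    have h2 := b1 X (hsub hX)
    rw [smul_eq_mul, Real.norm_eq_abs, abs_le] at h1 h2
    rw [diffQuot, diffQuot, abs_le]
    constructor <;> linarith [h1.1, h1.2, h2.1, h2.2]
  · intro X hX
    rw [(fderiv_sub_two (hq X (hsub hX) h (a4 X (hsub hX)))
      (hq X (hsub hX) h' (b4 X (hsub hX)))).1, hdq X (hsub hX) h (a4 X (hsub hX)),
      hdq X (hsub hX) h' (b4 X (hsub hX))]
    have h1 := a1' X (hsub hX)
    have h2 := b1' X (hsub hX)
    rw [← sub_sub_sub_cancel_right _ _ (fderiv ℝ (fderiv ℝ U) X (0, 0, 1))]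
    exact (norm_sub_le _ _).trans (by linarith)
  · exact hH
  · intro X hX
    have hX' := hsub hX
    obtain ⟨k1, k2⟩ := fderiv_sub_two (hq X hX' h (a4 X hX')) (hq X hX' h' (b4 X hX'))
    simp only [k1, k2, sub_apply]
    rw [principalPart_sub, diffQuot_equation hUat heq h0 (hcR X hX') (a4 X hX'),
      diffQuot_equation hUat heq h0' (hcR X hX') (b4 X hX')]
    ring
  · obtain ⟨e, S, T, hST, hS, hT, hB⟩ := exists_sqrt_decomposition hlam hlam1 (σ X₀.2.1)
      (hsym _) (hell _)
    exact ⟨e, S, T, hST, hS.trans (by linarith), fun p => (hT p).trans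
      (by gcongr; linarith), hB⟩
  · intro X hX Q K hK0 hQ
    refine (abs_principalPart_sub_le (a := Ls * ‖X - X₀‖) (by positivity)
      (hLs2 X (hsub hX) X₀ hX0) hQ).trans ?_
    calc (n : ℝ) * n * (Ls * ‖X - X₀‖ * K) = n * n * Ls * ‖X - X₀‖ * K := by ring
      _ ≤ _ := by gcongr; linarith
  · exact (hLb1 X₀ hX0).trans (by linarith)
  · exact fun X hX => (hLb2 X (hsub hX) X₀ hX0).trans (by gcongr; linarith)
  · have h1 := a2 X₀ hX0
    have h2 := b2 X₀ hX0
    rw [Real.norm_eq_abs, abs_le] at h1 h2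
    rw [abs_le]
    constructor <;> linarith [h1.1, h1.2, h2.1, h2.2]
  · intro X hX
    have h1 := a3 X (hsub hX) X₀ hX0
    have h2 := b3 X (hsub hX) X₀ hX0
    rw [Real.norm_eq_abs, abs_le] at h1 h2
    rw [abs_le]
    constructor <;> linarith [h1.1, h1.2, h2.1, h2.2]

theorem exists_diffQuot_hessian_cauchy (hlam : 0 < lam) (hlam1 : lam < 1)
    (hσ : ContDiff ℝ 2 σ) (hsym : ∀ x i j, σ x i j = σ x j i)
    (hell : ∀ x ξ : EuclideanSpace ℝ (Fin n),
      lam * ‖ξ‖ ^ 2 ≤ (∑ i, ∑ j, σ x i j * ξ i * ξ j) ∧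
      (∑ i, ∑ j, σ x i j * ξ i * ξ j) ≤ lam⁻¹ * ‖ξ‖ ^ 2)
    (hU : ContDiffOn ℝ 2 U {X : ℝ × EuclideanSpace ℝ (Fin n) × ℝ | 0 < X.2.2})
    (heq : ∀ X : ℝ × EuclideanSpace ℝ (Fin n) × ℝ, 0 < X.2.2 →
      fderiv ℝ U X (1, 0) = principalPart σ X (fun p q => fderiv ℝ (fderiv ℝ U) X (0, p) (0, q))
        + fderiv ℝ U X (0, drift σ r X))
    {c : ℝ × EuclideanSpace ℝ (Fin n) × ℝ} (hc : 0 < c.2.2) :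
    ∃ R, 0 < R ∧ (∀ X ∈ Metric.closedBall c R, 0 < X.2.2) ∧
      ∀ p q : EuclideanSpace ℝ (Fin n) × ℝ, ∀ ε, 0 < ε → ∃ δ, 0 < δ ∧ ∀ h h' : ℝ,
        h ≠ 0 → h' ≠ 0 → |h| < δ → |h'| < δ → ∀ X ∈ Metric.closedBall c R,
        0 < X.2.2 + h ∧ 0 < X.2.2 + h' ∧
        |h⁻¹ * (fderiv ℝ (fderiv ℝ U) (X + h • (0, 0, 1)) (0, p) (0, q)
            - fderiv ℝ (fderiv ℝ U) X (0, p) (0, q))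
          - h'⁻¹ * (fderiv ℝ (fderiv ℝ U) (X + h' • (0, 0, 1)) (0, p) (0, q)
            - fderiv ℝ (fderiv ℝ U) X (0, p) (0, q))| ≤ ε := by
  have hUat : ∀ X : ℝ × EuclideanSpace ℝ (Fin n) × ℝ, 0 < X.2.2 → ContDiffAt ℝ 2 U X :=
    fun X hX => hU.contDiffAt (isOpen_upperHalf.mem_nhds hX)
  set R := min 1 (c.2.2 / 2) with hR
  have hR0 : 0 < R := lt_min one_pos (half_pos hc)
  have hcR : ∀ X ∈ Metric.closedBall c R, 0 < X.2.2 := fun X hX => by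
    have h1 : |X.2.2 - c.2.2| ≤ R := (norm_snd_le (X - c).2).trans
      ((norm_snd_le (X - c)).trans (mem_closedBall_iff_norm.1 hX))
    linarith [(abs_le.1 h1).1, min_le_right 1 (c.2.2 / 2)]
  obtain ⟨Λ, hΛ, hP⟩ := exists_parabolicBounds_diffQuot_sub (r := r) hlam hlam1 hσ hsym hell hU
    heq hcR
  obtain ⟨C, hC, hbound⟩ := exists_interior_hessian_bound (ι := Fin n ⊕ Unit)
    (Z := EuclideanSpace ℝ (Fin n ⊕ Unit)) (E := EuclideanSpace ℝ (Fin n) × ℝ) hΛ hR0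
    (min_le_left _ _)
  refine ⟨R / 2, half_pos hR0, fun X hX => hcR X
    (Metric.closedBall_subset_closedBall (by linarith) hX), fun p q ε hε => ?_⟩
  have hD : 0 < (C + 1) * (‖p‖ + 1) * (‖q‖ + 1) := by positivity
  obtain ⟨δ, hδ, hPδ⟩ := hP (ε / ((C + 1) * (‖p‖ + 1) * (‖q‖ + 1))) (by positivity)
  refine ⟨δ, hδ, fun h h' h0 h0' hh hh' X hX => ?_⟩
  obtain ⟨a, b, hB⟩ := hPδ h h' h0 h0' hh hh'
  have hs : ∀ X ∈ Metric.closedBall c R, ∀ h : ℝ, 0 < X.2.2 + h → ContDiffAt ℝ 2 U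
      (X + h • ((0 : ℝ), (0 : EuclideanSpace ℝ (Fin n)), (1 : ℝ))) := fun X hX h hh =>
    hUat _ (by simpa using hh)
  have hq : ∀ X ∈ Metric.closedBall c R, ∀ h : ℝ, 0 < X.2.2 + h →
      ContDiffAt ℝ 2 (diffQuot U (0, 0, 1) h) X := fun X hX h hh =>
    (hUat X (hcR X hX)).diffQuot (hs X hX h hh)
  have hXR : X ∈ Metric.closedBall c R := Metric.closedBall_subset_closedBall (by linarith) hX
  have key := hbound _ _ _ _ c _ (by positivity)
    (fun X hX => (hq X hX h (a X hX)).sub (hq X hX h' (b X hX)))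
    (fun X₀ ρ H hρ _ _ => hB X₀ ρ H hρ) X hX p q
  refine ⟨a X hXR, b X hXR, ?_⟩
  rw [(fderiv_sub_two (hq X hXR h (a X hXR)) (hq X hXR h' (b X hXR))).2,
    fderiv_fderiv_diffQuot (hUat X (hcR X hXR)) (hs X hXR h (a X hXR)),
    fderiv_fderiv_diffQuot (hUat X (hcR X hXR)) (hs X hXR h' (b X hXR))] at key
  refine key.trans ?_
  calc C * (ε / ((C + 1) * (‖p‖ + 1) * (‖q‖ + 1))) * ‖p‖ * ‖q‖
      ≤ (C + 1) * (ε / ((C + 1) * (‖p‖ + 1) * (‖q‖ + 1))) * (‖p‖ + 1) * (‖q‖ + 1) := by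
        gcongr <;> linarith
    _ = ε := by field_simp

end Cauchy

section MixedDerivative

variable {Y : Type*} [NormedAddCommGroup Y] [NormedSpace ℝ Y]

theorem ContDiffAt.hasFDerivAt_fderiv_apply {U : Y → ℝ} {X : Y} (hU : ContDiffAt ℝ 2 U X) (Q : Y) :
    HasFDerivAt (fun X => fderiv ℝ U X Q) ((fderiv ℝ (fderiv ℝ U) X).flip Q) X := by
  have h1 : HasFDerivAt (fderiv ℝ U) (fderiv ℝ (fderiv ℝ U) X) X :=
    ((hU.fderiv_right (m := 1) (by norm_num)).differentiableAt (by norm_num)).hasFDerivAt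
  exact (h1.clm_apply (hasFDerivAt_const Q X)).congr_fderiv (by ext; simp)

theorem ContDiffAt.hasDerivAt_fderiv_apply {U : Y → ℝ} {γ : ℝ → Y} {P : Y} {a : ℝ}
    (hU : ContDiffAt ℝ 2 U (γ a)) (hγ : HasDerivAt γ P a) (Q : Y) :
    HasDerivAt (fun a => fderiv ℝ U (γ a) Q) (fderiv ℝ (fderiv ℝ U) (γ a) P Q) a :=
  (hU.hasFDerivAt_fderiv_apply Q).comp_hasDerivAt a hγ

theorem hasDerivAt_add_smul (X P : Y) (a : ℝ) : HasDerivAt (fun a : ℝ => X + a • P) P a := by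
  simpa using ((hasDerivAt_id a).smul_const P).const_add X

theorem exists_hasDerivAt_mixed {U : Y → ℝ} {c η P Q : Y} {R : ℝ} (hR : 0 < R)
    (hU : ∀ X ∈ Metric.closedBall c R, ContDiffAt ℝ 2 U X)
    (hcauchy : ∀ ε, 0 < ε → ∃ δ, 0 < δ ∧ ∀ h h' : ℝ, h ≠ 0 → h' ≠ 0 → |h| < δ → |h'| < δ →
      ∀ X ∈ Metric.closedBall c R, ContDiffAt ℝ 2 U (X + h • η) ∧
        |h⁻¹ * (fderiv ℝ (fderiv ℝ U) (X + h • η) P Q - fderiv ℝ (fderiv ℝ U) X P Q)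
          - h'⁻¹ * (fderiv ℝ (fderiv ℝ U) (X + h' • η) P Q - fderiv ℝ (fderiv ℝ U) X P Q)| ≤ ε) :
    ∃ g, HasDerivAt (fun a : ℝ => fderiv ℝ (fderiv ℝ U) (c + a • η) P Q) g 0 ∧
      HasDerivAt (fun a : ℝ => fderiv ℝ (fderiv ℝ U) (c + a • P) η Q) g 0 := by
  set F : ℝ → Y → ℝ := fun h X =>
    h⁻¹ * (fderiv ℝ (fderiv ℝ U) (X + h • η) P Q - fderiv ℝ (fderiv ℝ U) X P Q) with hF
  have hsmall : ∀ δ : ℝ, 0 < δ → ∀ᶠ h in nhdsWithin (0 : ℝ) {0}ᶜ, h ≠ 0 ∧ |h| < δ := fun δ hδ => by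
    refine eventually_mem_nhdsWithin.and (eventually_nhdsWithin_of_eventually_nhds ?_)
    filter_upwards [Metric.ball_mem_nhds (0 : ℝ) hδ] with h hh
    simpa using hh
  have hc1 : UniformCauchySeqOn F (nhdsWithin (0 : ℝ) {0}ᶜ) (Metric.closedBall c R) := by
    intro u hu
    obtain ⟨ε, hε, hεu⟩ := Metric.mem_uniformity_dist.1 hu
    obtain ⟨δ, hδ, H⟩ := hcauchy (ε / 2) (half_pos hε)
    filter_upwards [(hsmall δ hδ).prod_mk (hsmall δ hδ)] with m hm X hX
    refine hεu ?_
    rw [Real.dist_eq]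
    exact (H m.1 m.2 hm.1.1 hm.2.1 hm.1.2 hm.2.2 X hX).2.trans_lt (half_lt_self hε)
  have hlim : ∀ X, ∃ g, X ∈ Metric.closedBall c R →
      Filter.Tendsto (fun h => F h X) (nhdsWithin (0 : ℝ) {0}ᶜ) (nhds g) := fun X => by
    by_cases hX : X ∈ Metric.closedBall c R
    · obtain ⟨g, hg⟩ := cauchy_map_iff_exists_tendsto.1 (hc1.cauchy_map hX)
      exact ⟨g, fun _ => hg⟩
    · exact ⟨0, fun h => absurd h hX⟩
  choose G hG using hlim
  have hunif := hc1.tendstoUniformlyOn_of_tendsto (f := G) hG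
  refine ⟨G c, ?_, ?_⟩
  · rw [hasDerivAt_iff_tendsto_slope_zero]
    simpa [hF] using hG c (Metric.mem_closedBall_self hR.le)
  · have hγ : Continuous fun a : ℝ => c + a • P := by fun_prop
    have hS : IsOpen {a : ℝ | c + a • P ∈ Metric.ball c R} := Metric.isOpen_ball.preimage hγ
    have hsub : ∀ a ∈ {a : ℝ | c + a • P ∈ Metric.ball c R}, c + a • P ∈ Metric.closedBall c R :=
      fun a ha => Metric.ball_subset_closedBall ha
    obtain ⟨δ, hδ, H⟩ := hcauchy 1 one_pos
    have := hasDerivAt_of_tendstoUniformlyOn (l := nhdsWithin (0 : ℝ) {0}ᶜ) hS (x := 0)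
      (f := fun h a => h⁻¹ * (fderiv ℝ U (c + a • P + h • η) Q - fderiv ℝ U (c + a • P) Q))
      (f' := fun h a => F h (c + a • P)) (g' := fun a => G (c + a • P))
      (g := fun a => fderiv ℝ (fderiv ℝ U) (c + a • P) η Q)
      (fun u hu => (hunif u hu).mono fun h hh a ha => hh _ (hsub a ha)) ?_ ?_ (by simpa using hR)
    · simpa using this
    · filter_upwards [hsmall δ hδ] with h hh a ha
      have h1 := (H h h hh.1 hh.1 hh.2 hh.2 _ (hsub a ha)).1
      have h2 := hU _ (hsub a ha)
      exact ((h1.hasDerivAt_fderiv_apply ((hasDerivAt_add_smul c P a).add_const (h • η)) Q).sub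
        (h2.hasDerivAt_fderiv_apply (hasDerivAt_add_smul c P a) Q)).const_mul h⁻¹
    · intro a ha
      have h1 := ContDiffAt.hasDerivAt_fderiv_apply (γ := fun h : ℝ => c + a • P + h • η) (a := 0)
        (by simpa using hU _ (hsub a ha)) (hasDerivAt_add_smul _ η 0) Q
      rw [hasDerivAt_iff_tendsto_slope_zero] at h1
      simpa using h1

end MixedDerivative

theorem exists_hasDerivAt_hessian {n : ℕ} {σ : EuclideanSpace ℝ (Fin n) → Fin n → Fin n → ℝ}
    {r lam : ℝ} {U : ℝ × EuclideanSpace ℝ (Fin n) × ℝ → ℝ} (hlam : 0 < lam) (hlam1 : lam < 1)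
    (hσ : ContDiff ℝ 2 σ) (hsym : ∀ x i j, σ x i j = σ x j i)
    (hell : ∀ x ξ : EuclideanSpace ℝ (Fin n),
      lam * ‖ξ‖ ^ 2 ≤ (∑ i, ∑ j, σ x i j * ξ i * ξ j) ∧
      (∑ i, ∑ j, σ x i j * ξ i * ξ j) ≤ lam⁻¹ * ‖ξ‖ ^ 2)
    (hU : ContDiffOn ℝ 2 U {X : ℝ × EuclideanSpace ℝ (Fin n) × ℝ | 0 < X.2.2})
    (heq : ∀ X : ℝ × EuclideanSpace ℝ (Fin n) × ℝ, 0 < X.2.2 →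
      fderiv ℝ U X (1, 0) = principalPart σ X (fun p q => fderiv ℝ (fderiv ℝ U) X (0, p) (0, q))
        + fderiv ℝ U X (0, drift σ r X))
    {c : ℝ × EuclideanSpace ℝ (Fin n) × ℝ} (hc : 0 < c.2.2) (p q : EuclideanSpace ℝ (Fin n) × ℝ) :
    ∃ g, HasDerivAt (fun a : ℝ => fderiv ℝ (fderiv ℝ U) (c + a • (0, 0, 1)) (0, p) (0, q)) g 0 ∧
      HasDerivAt (fun a : ℝ => fderiv ℝ (fderiv ℝ U) (c + a • (0, p)) (0, 0, 1) (0, q)) g 0 := by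
  have hUat : ∀ X : ℝ × EuclideanSpace ℝ (Fin n) × ℝ, 0 < X.2.2 → ContDiffAt ℝ 2 U X :=
    fun X hX => hU.contDiffAt (isOpen_upperHalf.mem_nhds hX)
  obtain ⟨R, hR, hcR, H⟩ := exists_diffQuot_hessian_cauchy hlam hlam1 hσ hsym hell hU heq hc
  refine exists_hasDerivAt_mixed hR (fun X hX => hUat X (hcR X hX)) fun ε hε => ?_
  obtain ⟨δ, hδ, Hδ⟩ := H p q ε hε
  refine ⟨δ, hδ, fun h h' h0 h0' hh hh' X hX => ?_⟩
  obtain ⟨k1, -, k2⟩ := Hδ h h' h0 h0' hh hh' X hX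
  exact ⟨hUat _ (by simpa using k1), k2⟩

section DivergenceForm

variable {n : ℕ} {σ : EuclideanSpace ℝ (Fin n) → Fin n → Fin n → ℝ} {r : ℝ}

theorem dtP_eq {u : ℝ → EuclideanSpace ℝ (Fin n) → ℝ → ℝ} {t : ℝ} {x : EuclideanSpace ℝ (Fin n)}
    {y : ℝ} {L : ℝ × EuclideanSpace ℝ (Fin n) × ℝ →L[ℝ] ℝ}
    (hL : HasFDerivAt (fun q : ℝ × EuclideanSpace ℝ (Fin n) × ℝ => u q.1 q.2.1 q.2.2) L (t, x, y)) :
    dtP n u t x y = L (1, 0) := by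
  have hγ : HasDerivAt (fun τ : ℝ => (τ, x, y)) ((1 : ℝ), (0 : EuclideanSpace ℝ (Fin n) × ℝ)) t :=
    (hasDerivAt_id t).prodMk (hasDerivAt_const t (x, y))
  exact (hL.comp_hasDerivAt t hγ).deriv

theorem hasDerivAt_line_x (t : ℝ) (x v : EuclideanSpace ℝ (Fin n)) (y : ℝ) :
    HasDerivAt (fun a : ℝ => (t, x + a • v, y)) ((0 : ℝ), v, (0 : ℝ)) 0 :=
  (hasDerivAt_const 0 t).prodMk ((hasDerivAt_add_smul x v 0).prodMk (hasDerivAt_const 0 y))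

theorem hasDerivAt_line_y (t : ℝ) (x : EuclideanSpace ℝ (Fin n)) (y : ℝ) :
    HasDerivAt (fun b : ℝ => (t, x, b)) ((0 : ℝ), (0 : EuclideanSpace ℝ (Fin n)), (1 : ℝ)) y :=
  (hasDerivAt_const y t).prodMk ((hasDerivAt_const y x).prodMk (hasDerivAt_id y))

theorem dxP_eq {u : ℝ → EuclideanSpace ℝ (Fin n) → ℝ → ℝ} {t : ℝ} {x : EuclideanSpace ℝ (Fin n)}
    {y : ℝ} {L : ℝ × EuclideanSpace ℝ (Fin n) × ℝ →L[ℝ] ℝ}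
    (hL : HasFDerivAt (fun q : ℝ × EuclideanSpace ℝ (Fin n) × ℝ => u q.1 q.2.1 q.2.2) L (t, x, y))
    (i : Fin n) : dxP n u i t x y = L (0, coordVec i) :=
  (HasFDerivAt.comp_hasDerivAt (l := fun q : ℝ × EuclideanSpace ℝ (Fin n) × ℝ => u q.1 q.2.1 q.2.2)
    (f := fun a : ℝ => (t, x + a • EuclideanSpace.single i (1 : ℝ), y)) 0 (by simpa using hL)
    (hasDerivAt_line_x t x _ y)).deriv

theorem deriv_y_eq {u : ℝ → EuclideanSpace ℝ (Fin n) → ℝ → ℝ} {t : ℝ}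
    {x : EuclideanSpace ℝ (Fin n)} {y : ℝ} {L : ℝ × EuclideanSpace ℝ (Fin n) × ℝ →L[ℝ] ℝ}
    (hL : HasFDerivAt (fun q : ℝ × EuclideanSpace ℝ (Fin n) × ℝ => u q.1 q.2.1 q.2.2) L (t, x, y)) :
    deriv (fun b => u t x b) y = L (0, 0, 1) :=
  (HasFDerivAt.comp_hasDerivAt (l := fun q : ℝ × EuclideanSpace ℝ (Fin n) × ℝ => u q.1 q.2.1 q.2.2)
    (f := fun b : ℝ => (t, x, b)) y hL (hasDerivAt_line_y t x y)).deriv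

/-- The `i`-th flux term of the divergence, differentiated by the product rule. -/
theorem deriv_flux (hσ : ContDiff ℝ 2 σ) (x : EuclideanSpace ℝ (Fin n)) (k : ℝ) (i : Fin n)
    {f v : Fin n → ℝ → ℝ} {w : Fin n → ℝ} (hf : ∀ j a, f j a = v j a)
    (hv : ∀ j, HasDerivAt (v j) (w j) 0) :
    deriv (fun a : ℝ => k * ∑ j, σ (x + a • EuclideanSpace.single i (1 : ℝ)) i j * f j a) 0
      = k * ∑ j, (fderiv ℝ (fun x => σ x i j) x (EuclideanSpace.single i 1) * v j 0
        + σ x i j * w j) := by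
  obtain rfl : f = v := by ext j a; exact hf j a
  have h1 : ∀ j, HasDerivAt (fun a : ℝ => σ (x + a • EuclideanSpace.single i (1 : ℝ)) i j)
      (fderiv ℝ (fun x => σ x i j) x (EuclideanSpace.single i 1)) 0 := fun j => by
    have h2 : ContDiff ℝ 2 (fun x => σ x i j) := contDiff_pi.1 (contDiff_pi.1 hσ i) j
    have h3 := ((h2.differentiable (by norm_num)) x).hasFDerivAt
    exact HasFDerivAt.comp_hasDerivAt (l := fun x => σ x i j)
      (f := fun a : ℝ => x + a • EuclideanSpace.single i (1 : ℝ)) 0 (by simpa using h3)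
      (hasDerivAt_add_smul x _ 0)
  refine ((HasDerivAt.fun_sum fun j _ => (h1 j).mul (hv j)).const_mul k).deriv.trans ?_
  simp

theorem apply_drift (L : ℝ × EuclideanSpace ℝ (Fin n) × ℝ →L[ℝ] ℝ)
    (X : ℝ × EuclideanSpace ℝ (Fin n) × ℝ) :
    L (0, drift σ r X) = ∑ i, ∑ j, fderiv ℝ (fun x => σ x i j) X.2.1 (EuclideanSpace.single i 1)
      * L (0, coordVec j) + r / X.2.2 * L (0, 0, 1) := by
  have h : ((0 : ℝ), drift σ r X) = ∑ j, (∑ i, fderiv ℝ (fun x => σ x i j) X.2.1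
      (EuclideanSpace.single i 1)) • ((0 : ℝ), coordVec j)
      + (r / X.2.2) • ((0 : ℝ), (0 : EuclideanSpace ℝ (Fin n)), (1 : ℝ)) := by
    simp [drift, coordVec, Prod.ext_iff, Prod.fst_sum, Prod.snd_sum]
  rw [h, map_add, map_sum, Finset.sum_comm]
  simp only [map_smul, smul_eq_mul, Finset.sum_mul]

theorem divFormP_eq (hσ : ContDiff ℝ 2 σ) {u : ℝ → EuclideanSpace ℝ (Fin n) → ℝ → ℝ}
    {U : ℝ × EuclideanSpace ℝ (Fin n) × ℝ → ℝ}
    (hUu : ∀ X, U X = u X.1 X.2.1 X.2.2)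
    (hU : ∀ X : ℝ × EuclideanSpace ℝ (Fin n) × ℝ, 0 < X.2.2 → ContDiffAt ℝ 2 U X)
    {t : ℝ} {x : EuclideanSpace ℝ (Fin n)} {y : ℝ} (hy : 0 < y) :
    divFormP n σ r u t x y = y ^ r * (principalPart σ (t, x, y)
      (fun p q => fderiv ℝ (fderiv ℝ U) (t, x, y) (0, p) (0, q))
        + fderiv ℝ U (t, x, y) (0, drift σ r (t, x, y))) := by
  obtain rfl : U = fun X => u X.1 X.2.1 X.2.2 := funext hUu
  have hd : ∀ X : ℝ × EuclideanSpace ℝ (Fin n) × ℝ, 0 < X.2.2 → HasFDerivAt _ _ X :=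
    fun X hX => ((hU X hX).differentiableAt (by norm_num)).hasFDerivAt
  set U := fun X : ℝ × EuclideanSpace ℝ (Fin n) × ℝ => u X.1 X.2.1 X.2.2 with hUdef
  have h1 : ∀ i, dxP n (fun t' x' y' => y' ^ r * ∑ j, σ x' i j * dxP n u j t' x' y') i t x y
      = y ^ r * ∑ j, (fderiv ℝ (fun x => σ x i j) x (EuclideanSpace.single i 1)
          * fderiv ℝ U (t, x, y) (0, coordVec j)
        + σ x i j * fderiv ℝ (fderiv ℝ U) (t, x, y) (0, coordVec i) (0, coordVec j)) := fun i => by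
    have := deriv_flux hσ x (y ^ r) i
      (f := fun j a => dxP n u j t (x + a • EuclideanSpace.single i (1 : ℝ)) y)
      (v := fun j a => fderiv ℝ U (t, x + a • EuclideanSpace.single i (1 : ℝ), y) (0, coordVec j))
      (w := fun j => fderiv ℝ (fderiv ℝ U) (t, x, y) (0, coordVec i) (0, coordVec j))
      (fun j a => dxP_eq (hd (t, _, y) hy) j) fun j => by
        simpa [coordVec] using ContDiffAt.hasDerivAt_fderiv_apply (U := U)
          (γ := fun a : ℝ => (t, x + a • EuclideanSpace.single i (1 : ℝ), y)) (a := 0)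
          (hU _ hy) (hasDerivAt_line_x t x _ y) (0, coordVec j)
    simpa [dxP] using this
  have h2 : deriv (fun b : ℝ => b ^ r * deriv (fun c => u t x c) b) y
      = y ^ r * (fderiv ℝ (fderiv ℝ U) (t, x, y) (0, 0, 1) (0, 0, 1)
        + r / y * fderiv ℝ U (t, x, y) (0, 0, 1)) := by
    have e : (fun b : ℝ => b ^ r * deriv (fun c => u t x c) b)
        =ᶠ[nhds y] fun b => b ^ r * fderiv ℝ U (t, x, b) (0, 0, 1) := by
      filter_upwards [lt_mem_nhds hy] with b hb
      rw [deriv_y_eq (hd (t, x, b) hb)]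
    rw [e.deriv_eq]
    refine ((Real.hasDerivAt_rpow_const (p := r) (Or.inl hy.ne')).mul
      ((hU (t, x, y) hy).hasDerivAt_fderiv_apply (hasDerivAt_line_y t x y)
        (0, 0, 1))).deriv.trans ?_
    rw [Real.rpow_sub_one hy.ne']
    field_simp
    ring
  rw [divFormP, h2, Finset.sum_congr rfl fun i _ => h1 i, ← Finset.mul_sum, apply_drift,
    principalPart]
  simp only [Finset.sum_add_distrib]
  ring

theorem conjugate_equation (hσ : ContDiff ℝ 2 σ) {u : ℝ → EuclideanSpace ℝ (Fin n) → ℝ → ℝ}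
    {U : ℝ × EuclideanSpace ℝ (Fin n) × ℝ → ℝ}
    (hUu : ∀ X, U X = u X.1 X.2.1 X.2.2)
    (hU : ∀ X : ℝ × EuclideanSpace ℝ (Fin n) × ℝ, 0 < X.2.2 → ContDiffAt ℝ 2 U X)
    (heq : ∀ X : ℝ × EuclideanSpace ℝ (Fin n) × ℝ, 0 < X.2.2 →
      fderiv ℝ U X (1, 0) = principalPart σ X (fun p q => fderiv ℝ (fderiv ℝ U) X (0, p) (0, q))
        + fderiv ℝ U X (0, drift σ r X))
    {t : ℝ} {x : EuclideanSpace ℝ (Fin n)} {y : ℝ} (hy : 0 < y) {g : Fin n → Fin n → ℝ}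
    (hg1 : ∀ i j, HasDerivAt (fun a : ℝ =>
      fderiv ℝ (fderiv ℝ U) ((t, x, y) + a • (0, 0, 1)) (0, coordVec i) (0, coordVec j)) (g i j) 0)
    (hg2 : ∀ i j, HasDerivAt (fun a : ℝ =>
      fderiv ℝ (fderiv ℝ U) ((t, x, y) + a • (0, coordVec i)) (0, 0, 1) (0, coordVec j))
        (g i j) 0) :
    y ^ (-r) * dtP n (fun t' x' y' => -(y' ^ r * deriv (fun c => u t' x' c) y')) t x y
      - divFormP n σ (-r) (fun t' x' y' => -(y' ^ r * deriv (fun c => u t' x' c) y')) t x y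
        = 0 := by
  obtain rfl : U = fun X => u X.1 X.2.1 X.2.2 := funext hUu
  have hd : ∀ X : ℝ × EuclideanSpace ℝ (Fin n) × ℝ, 0 < X.2.2 → HasFDerivAt _ _ X :=
    fun X hX => ((hU X hX).differentiableAt (by norm_num)).hasFDerivAt
  set U := fun X : ℝ × EuclideanSpace ℝ (Fin n) × ℝ => u X.1 X.2.1 X.2.2 with hUdef
  set W : ℝ → EuclideanSpace ℝ (Fin n) → ℝ → ℝ :=
    fun t' x' y' => -(y' ^ r * deriv (fun c => u t' x' c) y') with hW
  have hsymm : ∀ X : ℝ × EuclideanSpace ℝ (Fin n) × ℝ, 0 < X.2.2 → ∀ p q,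
      fderiv ℝ (fderiv ℝ U) X p q = fderiv ℝ (fderiv ℝ U) X q p := fun X hX p q =>
    (ContDiffAt.isSymmSndFDerivAt (hU X hX) (by simp)) p q
  have hrr : ∀ {b : ℝ}, 0 < b → b ^ (-r) * b ^ r = 1 := fun hb => by
    rw [← Real.rpow_add hb]; simp
  have hWd : ∀ X : ℝ × EuclideanSpace ℝ (Fin n) × ℝ, 0 < X.2.2 →
      ∃ L : ℝ × EuclideanSpace ℝ (Fin n) × ℝ →L[ℝ] ℝ,
        HasFDerivAt (fun X : ℝ × EuclideanSpace ℝ (Fin n) × ℝ => W X.1 X.2.1 X.2.2) L X ∧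
        ∀ p : ℝ × EuclideanSpace ℝ (Fin n) × ℝ, L p =
          -(X.2.2 ^ r * (fderiv ℝ (fderiv ℝ U) X p (0, 0, 1)
            + r / X.2.2 * p.2.2 * fderiv ℝ U X (0, 0, 1))) := fun X hX => by
    have e : (fun X : ℝ × EuclideanSpace ℝ (Fin n) × ℝ => W X.1 X.2.1 X.2.2)
        =ᶠ[nhds X] fun X => -(X.2.2 ^ r * fderiv ℝ U X (0, 0, 1)) := by
      filter_upwards [isOpen_upperHalf.mem_nhds hX] with X hX
      rw [hW]
      exact congrArg (fun z => -(X.2.2 ^ r * z)) (deriv_y_eq (hd X hX))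
    have h1 : HasFDerivAt (fun X : ℝ × EuclideanSpace ℝ (Fin n) × ℝ => X.2.2 ^ r) _ X :=
      HasDerivAt.comp_hasFDerivAt (f := fun X : ℝ × EuclideanSpace ℝ (Fin n) × ℝ => X.2.2) X
        (Real.hasDerivAt_rpow_const (p := r) (Or.inl hX.ne'))
        (((ContinuousLinearMap.snd ℝ _ ℝ).comp
          (ContinuousLinearMap.snd ℝ ℝ (EuclideanSpace ℝ (Fin n) × ℝ))).hasFDerivAt)
    refine ⟨_, ((h1.mul ((hU X hX).hasFDerivAt_fderiv_apply (0, 0, 1))).neg).congr_of_eventuallyEq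
      e, fun p => ?_⟩
    have := hX.ne'
    simp [Real.rpow_sub_one hX.ne']
    field_simp
    ring
  have hyr := hrr hy
  obtain ⟨L, hL, hL'⟩ := hWd (t, x, y) hy
  have ht : dtP n W t x y = -(y ^ r * fderiv ℝ (fderiv ℝ U) (t, x, y) (0, 0, 1) (1, 0)) := by
    rw [dtP_eq hL, hL', hsymm _ hy]; simp
  have hx : ∀ j x, dxP n W j t x y
      = -(y ^ r * fderiv ℝ (fderiv ℝ U) (t, x, y) (0, 0, 1) (0, coordVec j)) := fun j x => by
    obtain ⟨L, hL, hL'⟩ := hWd (t, x, y) hy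
    rw [dxP_eq hL, hL', hsymm _ hy]; simp [coordVec]
  have h1 : ∀ i, dxP n (fun t' x' y' => y' ^ (-r) * ∑ j, σ x' i j * dxP n W j t' x' y') i t x y
      = -∑ j, (fderiv ℝ (fun x => σ x i j) x (EuclideanSpace.single i 1)
          * fderiv ℝ (fderiv ℝ U) (t, x, y) (0, 0, 1) (0, coordVec j)
        + σ x i j * g i j) := fun i => by
    have := deriv_flux hσ x (y ^ (-r)) i
      (f := fun j a => dxP n W j t (x + a • EuclideanSpace.single i (1 : ℝ)) y)
      (v := fun j a => -(y ^ r * fderiv ℝ (fderiv ℝ U)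
        (t, x + a • EuclideanSpace.single i (1 : ℝ), y) (0, 0, 1) (0, coordVec j)))
      (w := fun j => -(y ^ r * g i j)) (fun j a => hx j _) fun j => by
        refine (((hg2 i j).const_mul (y ^ r)).neg).congr_of_eventuallyEq (.of_forall fun a => ?_)
        simp [coordVec]
    refine this.trans ?_
    rw [Finset.mul_sum, ← Finset.sum_neg_distrib]
    refine Finset.sum_congr rfl fun j _ => ?_
    rw [zero_smul, add_zero]
    linear_combination (-(fderiv ℝ (fun x => σ x i j) x (EuclideanSpace.single i 1)
      * fderiv ℝ (fderiv ℝ U) (t, x, y) (0, 0, 1) (0, coordVec j) + σ x i j * g i j)) * hyr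
  have h2 : deriv (fun b : ℝ => b ^ (-r) * deriv (fun c => W t x c) b) y
      = -(fderiv ℝ (fderiv ℝ U) (t, x, y) (0, 0, 1) (1, 0)
        - ∑ i, ∑ j, (fderiv ℝ (fun x => σ x i j) x (EuclideanSpace.single i 1)
          * fderiv ℝ (fderiv ℝ U) (t, x, y) (0, 0, 1) (0, coordVec j)
        + σ x i j * g i j)) := by
    have e : (fun b : ℝ => b ^ (-r) * deriv (fun c => W t x c) b)
        =ᶠ[nhds y] fun b => -(fderiv ℝ U (t, x, b) (1, 0)
          - ∑ i, ∑ j, (fderiv ℝ (fun x => σ x i j) x (EuclideanSpace.single i 1)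
            * fderiv ℝ U (t, x, b) (0, coordVec j)
          + σ x i j * fderiv ℝ (fderiv ℝ U) (t, x, b) (0, coordVec i) (0, coordVec j))) := by
      filter_upwards [lt_mem_nhds hy] with b hb
      obtain ⟨L, hL, hL'⟩ := hWd (t, x, b) hb
      rw [deriv_y_eq hL, hL', heq _ hb, apply_drift, principalPart]
      simp only [Finset.sum_add_distrib]
      linear_combination (-(fderiv ℝ (fderiv ℝ U) (t, x, b) (0, 0, 1) (0, 0, 1)
        + r / b * fderiv ℝ U (t, x, b) (0, 0, 1))) * hrr hb
    rw [e.deriv_eq]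
    have hU' : ∀ q, HasDerivAt (fun b => fderiv ℝ U (t, x, b) q)
        (fderiv ℝ (fderiv ℝ U) (t, x, y) (0, 0, 1) q) y := fun q =>
      (hU (t, x, y) hy).hasDerivAt_fderiv_apply (hasDerivAt_line_y t x y) q
    have hg : ∀ i j, HasDerivAt (fun b => fderiv ℝ (fderiv ℝ U) (t, x, b) (0, coordVec i)
        (0, coordVec j)) (g i j) y := fun i j => by
      have h3 := HasDerivAt.comp_sub_const (x := y) (a := y) (by simpa using hg1 i j)
      simpa using h3
    exact (((hU' (1, 0)).sub (HasDerivAt.fun_sum fun i _ => HasDerivAt.fun_sum fun j _ =>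
      ((hU' (0, coordVec j)).const_mul _).add ((hg i j).const_mul _))).neg).deriv
  rw [divFormP, h2, ht, Finset.sum_congr rfl fun i _ => h1 i, Finset.sum_neg_distrib]
  linear_combination (-fderiv ℝ (fderiv ℝ U) (t, x, y) (0, 0, 1) (1, 0)) * hyr

end DivergenceForm

/-- duality: if `u₁` is a `C²` classical solution of
`y^{2s-1} ∂_t u₁ - ∇_{x,y}·(y^{2s-1} σ̃ ∇_{x,y} u₁) = 0` in `ℝ^{n+1} × (0,∞)`, with
`σ` of class `C²`, symmetric and uniformly elliptic and `σ̃ = diag(σ,1)`, then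
`u₂ := -y^{2s-1} ∂_y u₁` is a classical solution of
`y^{1-2s} ∂_t u₂ - ∇_{x,y}·(y^{1-2s} σ̃ ∇_{x,y} u₂) = 0` there. -/
theorem stmt9 (n : ℕ) (hn : 1 ≤ n) (s lam : ℝ) (hs : s ∈ Set.Ioo (0 : ℝ) 1)
    (hlam : lam ∈ Set.Ioo (0 : ℝ) 1)
    (σ : EuclideanSpace ℝ (Fin n) → Fin n → Fin n → ℝ)
    (hσ : ContDiff ℝ 2 σ)
    (hsym : ∀ x i j, σ x i j = σ x j i)
    (hell : ∀ (x ξ : EuclideanSpace ℝ (Fin n)),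
      lam * ‖ξ‖ ^ 2 ≤ (∑ i, ∑ j, σ x i j * ξ i * ξ j) ∧
      (∑ i, ∑ j, σ x i j * ξ i * ξ j) ≤ lam⁻¹ * ‖ξ‖ ^ 2)
    (u₁ : ℝ → EuclideanSpace ℝ (Fin n) → ℝ → ℝ)
    (hu₁ : ContDiffOn ℝ 2 (fun q : ℝ × EuclideanSpace ℝ (Fin n) × ℝ => u₁ q.1 q.2.1 q.2.2)
      {q : ℝ × EuclideanSpace ℝ (Fin n) × ℝ | 0 < q.2.2})
    (heq : ∀ (t : ℝ) (x : EuclideanSpace ℝ (Fin n)) (y : ℝ), 0 < y →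
      y ^ (2 * s - 1) * dtP n u₁ t x y - divFormP n σ (2 * s - 1) u₁ t x y = 0) :
    ∀ (t : ℝ) (x : EuclideanSpace ℝ (Fin n)) (y : ℝ), 0 < y →
      y ^ (1 - 2 * s) *
          dtP n (fun t' x' y' => -(y' ^ (2 * s - 1) * deriv (fun c => u₁ t' x' c) y')) t x y
        - divFormP n σ (1 - 2 * s)
            (fun t' x' y' => -(y' ^ (2 * s - 1) * deriv (fun c => u₁ t' x' c) y')) t x y = 0 := by
  have hr : 1 - 2 * s = -(2 * s - 1) := by ring
  have hU : ∀ X : ℝ × EuclideanSpace ℝ (Fin n) × ℝ, 0 < X.2.2 → ContDiffAt ℝ 2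
      (fun q : ℝ × EuclideanSpace ℝ (Fin n) × ℝ => u₁ q.1 q.2.1 q.2.2) X :=
    fun X hX => hu₁.contDiffAt (isOpen_upperHalf.mem_nhds hX)
  have heq' : ∀ X : ℝ × EuclideanSpace ℝ (Fin n) × ℝ, 0 < X.2.2 →
      fderiv ℝ (fun q : ℝ × EuclideanSpace ℝ (Fin n) × ℝ => u₁ q.1 q.2.1 q.2.2) X (1, 0)
        = principalPart σ X (fun p q => fderiv ℝ (fderiv ℝ
            fun q : ℝ × EuclideanSpace ℝ (Fin n) × ℝ => u₁ q.1 q.2.1 q.2.2) X (0, p) (0, q))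
          + fderiv ℝ (fun q : ℝ × EuclideanSpace ℝ (Fin n) × ℝ => u₁ q.1 q.2.1 q.2.2) X
            (0, drift σ (2 * s - 1) X) := fun X hX => by
    have h := heq X.1 X.2.1 X.2.2 hX
    rw [divFormP_eq hσ (fun _ => rfl) hU hX,
      dtP_eq ((hU X hX).differentiableAt (by norm_num)).hasFDerivAt, ← mul_sub] at h
    exact sub_eq_zero.1 ((mul_eq_zero.1 h).resolve_left (Real.rpow_pos_of_pos hX _).ne')
  intro t x y hy
  have hmix := fun i j => exists_hasDerivAt_hessian hlam.1 hlam.2 hσ hsym hell hu₁ heq'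
    (c := (t, x, y)) hy (coordVec i) (coordVec j)
  choose g hg1 hg2 using hmix
  rw [hr]
  exact conjugate_equation hσ (fun _ => rfl) hU heq' hy hg1 hg2
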